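/- Let (u₁,m₁) be a solution of the discounted MFG system with m₁(0) = m₁⁰, let m̃₂ solve the linear Fokker–Planck equation −∂ₜm̃₂ + Δm̃₂ + div(m̃₂ D_pH(x,Du₁)) = 0 with m̃₂(0) = m₂⁰, and for each s > 0 let ζ(s,·) solve Δζ(s,·) = m₁(s) − m̃₂(s) on 𝕋^d with ∫_{𝕋^d} ζ(s,x) dx = 0. Then for every time s > 0 there exists a constant K_s > 0, independent of m₁⁰ and m₂⁰ and bounded on {s ≥ ε} for each ε > 0, such that ‖Dζ(s,·)‖_{L²(𝕋^d)} ≤ K_s d(m₁⁰, m₂⁰). -/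

import Mathlib

/- Common framework for "On the long time convergence of potential MFG" (M. Masoero).

We work on the flat torus `𝕋^d`, modeled as `Td d := Fin d → AddCircle 1`.
Smooth functions on the torus are represented by `ℤ^d`-periodic functions on
`Vd d := Fin d → ℝ`; a function on `Vd d` is transported to the torus through the
canonical (measurable) section `secT : Td d → Vd d`.  Probability measures on the
torus are `PTd d := ProbabilityMeasure (Td d)`, endowed with the 1-Wasserstein
distance `W1` defined through Kantorovich duality.  The Fokker--Planck equations
and their stationary analogues are stated in the sense of distributions, i.e.
against smooth periodic test functions; `σ` is the viscosity parameter
(everywhere `σ = 1` except in the non-convex example). -/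

open MeasureTheory Real Set Filter

noncomputable section

abbrev Vd (d : ℕ) : Type := Fin d → ℝ
abbrev Td (d : ℕ) : Type := Fin d → AddCircle (1 : ℝ)

instance factOneposR : Fact ((0:ℝ) < 1) := ⟨one_pos⟩

/-- The canonical measurable section of the torus, with values in `[0,1)^d`. -/
def secT {d : ℕ} (y : Td d) : Vd d := fun i => ((AddCircle.equivIco 1 0) (y i)).1

/-- The vector of `ℝ^d` associated with an integer vector. -/
def intVec {d : ℕ} (z : Fin d → ℤ) : Vd d := fun i => (z i : ℝ)

/-- Euclidean scalar product on `ℝ^d`. -/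
def dotp {d : ℕ} (a b : Vd d) : ℝ := ∑ i, a i * b i

/-- Squared euclidean norm on `ℝ^d`. -/
def sqnorm {d : ℕ} (a : Vd d) : ℝ := ∑ i, (a i)^2

/-- Spatial gradient. -/
def gradv {d : ℕ} (g : Vd d → ℝ) (x : Vd d) : Vd d := fun i => fderiv ℝ g x (Pi.single i 1)

/-- Second derivative of `g` at `x` in the directions `v, w`. -/
def D2 {d : ℕ} (g : Vd d → ℝ) (x v w : Vd d) : ℝ := fderiv ℝ (fun y => fderiv ℝ g y v) x w

/-- Laplacian. -/
def lapl {d : ℕ} (g : Vd d → ℝ) (x : Vd d) : ℝ := ∑ i, D2 g x (Pi.single i 1) (Pi.single i 1)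

/-- Divergence of a vector field. -/
def divv {d : ℕ} (b : Vd d → Vd d) (x : Vd d) : ℝ :=
  ∑ i, fderiv ℝ (fun y => b y i) x (Pi.single i 1)

/-- Time derivative of a time dependent function. -/
def tderiv {d : ℕ} (u : ℝ → Vd d → ℝ) (t : ℝ) (x : Vd d) : ℝ := deriv (fun s => u s x) t

abbrev PTd (d : ℕ) := ProbabilityMeasure (Td d)

/-- The 1-Wasserstein (Monge--Kantorovich) distance, via Kantorovich duality. -/
def W1 {d : ℕ} (μ ν : PTd d) : ℝ :=
  sSup { r | ∃ φ : Td d → ℝ, LipschitzWith 1 φ ∧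
    r = (∫ y, φ y ∂(μ : Measure (Td d))) - ∫ y, φ y ∂(ν : Measure (Td d)) }

/-- The convex combination `(1-t) μ + t ν`. -/
def lineComb {d : ℕ} (t : ℝ) (μ ν : PTd d) : Measure (Td d) :=
  ENNReal.ofReal (1 - t) • (μ : Measure (Td d)) + ENNReal.ofReal t • (ν : Measure (Td d))

/-- The standing assumptions of the paper: a Hamiltonian `H` (a `ℤ^d`-periodic function of
`(x,p)`), its convex conjugate `Hstar` in the `p` variable, a `C²` coupling function
`Fc` on `P(𝕋^d)` with flat derivative `Fd` (represented by periodic functions on `ℝ^d`),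
with the regularity and growth conditions of the paper. -/
structure MFGSetting (d : ℕ) where
  H : Vd d → Vd d → ℝ
  Hstar : Vd d → Vd d → ℝ
  Fc : PTd d → ℝ
  Fd : Measure (Td d) → Vd d → ℝ
  Cbar : ℝ
  Cbar_pos : 0 < Cbar
  θ : ℝ
  θ_mem : θ ∈ Set.Ioo (0:ℝ) 1
  Cg : ℝ
  Cg_pos : 0 < Cg
  CF : ℝ
  H_smooth : ContDiff ℝ 2 (fun q : Vd d × Vd d => H q.1 q.2)
  H_per : ∀ (x : Vd d) (z : Fin d → ℤ) (p : Vd d), H (x + intVec z) p = H x p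
  Dpp_lip : ∃ L : ℝ, 0 ≤ L ∧ ∀ (x p₁ p₂ v w : Vd d),
    |D2 (fun p => H x p) p₁ v w - D2 (fun p => H x p) p₂ v w| ≤ L * ‖p₁ - p₂‖ * ‖v‖ * ‖w‖
  Dpp_lower : ∀ x p v : Vd d, Cbar⁻¹ * sqnorm v ≤ D2 (fun p' => H x p') p v v
  Dpp_upper : ∀ x p v : Vd d, D2 (fun p' => H x p') p v v ≤ Cbar * sqnorm v
  Dxx_growth : ∀ x p v w : Vd d,
    |D2 (fun x' => H x' p) x v w| ≤ Cg * (1 + ‖p‖) ^ (1 + θ) * ‖v‖ * ‖w‖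
  Dxp_growth : ∀ x p v w : Vd d,
    |fderiv ℝ (fun x' => fderiv ℝ (fun p' => H x' p') p v) x w| ≤ Cg * (1 + ‖p‖) ^ θ * ‖v‖ * ‖w‖
  Hstar_eq : ∀ x q : Vd d, IsLUB (Set.range fun p => dotp q p - H x p) (Hstar x q)
  Fd_per : ∀ (μ : Measure (Td d)) (x : Vd d) (z : Fin d → ℤ), Fd μ (x + intVec z) = Fd μ x
  Fd_smooth : ∀ μ : Measure (Td d), IsProbabilityMeasure μ → ContDiff ℝ 2 (Fd μ)
  Fd_D2_bound : ∀ μ : Measure (Td d), IsProbabilityMeasure μ →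
    ∀ x v w : Vd d, |D2 (Fd μ) x v w| ≤ CF * ‖v‖ * ‖w‖
  flat_deriv : ∀ μ ν : PTd d,
    Fc ν - Fc μ = ∫ t in Set.Icc (0:ℝ) 1,
      ((∫ y, Fd (lineComb t μ ν) (secT y) ∂(ν : Measure (Td d))) -
        ∫ y, Fd (lineComb t μ ν) (secT y) ∂(μ : Measure (Td d)))
  Fd_normalized : ∀ μ : PTd d, (∫ y, Fd (μ : Measure (Td d)) (secT y) ∂(μ : Measure (Td d))) = 0
  Fc_bounded : ∃ M : ℝ, ∀ μ : PTd d, |Fc μ| ≤ M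
  Fd_bounded : ∃ M : ℝ, ∀ (μ : PTd d) (x : Vd d), |Fd (μ : Measure (Td d)) x| ≤ M

/-- Smooth periodic test functions on `[0,∞) × 𝕋^d` (resp. `ℝ × 𝕋^d`). -/
def IsTestFun {d : ℕ} (φ : ℝ → Vd d → ℝ) : Prop :=
  ContDiff ℝ 2 (fun q : ℝ × Vd d => φ q.1 q.2) ∧
  ∀ (t : ℝ) (x : Vd d) (z : Fin d → ℤ), φ t (x + intVec z) = φ t x

/-- The weak (distributional) formulation of the Fokker--Planck equation
`-∂ₜ m + σ Δ m + div(m α) = 0` between times `s₁` and `s₂`. -/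
def FPeq {d : ℕ} (σ : ℝ) (m : ℝ → PTd d) (α : ℝ → Td d → Vd d) (s₁ s₂ : ℝ) : Prop :=
  ∀ φ : ℝ → Vd d → ℝ, IsTestFun φ →
    (∫ y, φ s₂ (secT y) ∂(m s₂ : Measure (Td d))) -
      (∫ y, φ s₁ (secT y) ∂(m s₁ : Measure (Td d))) =
    ∫ s in s₁..s₂, ∫ y, (tderiv φ s (secT y) + σ * lapl (φ s) (secT y)
        - dotp (α s y) (gradv (φ s) (secT y))) ∂(m s : Measure (Td d))

/-- Continuity of a curve of measures with respect to the 1-Wasserstein distance. -/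
def W1ContOn {d : ℕ} (m : ℝ → PTd d) (I : Set ℝ) : Prop :=
  ∀ t ∈ I, ∀ ε > 0, ∃ η > 0, ∀ s ∈ I, |s - t| < η → W1 (m s) (m t) < ε

/-- Continuity of a function on `P(𝕋^d)` with respect to the 1-Wasserstein distance. -/
def W1Continuous {d : ℕ} (χ : PTd d → ℝ) : Prop :=
  ∀ μ : PTd d, ∀ ε > 0, ∃ η > 0, ∀ ν : PTd d, W1 μ ν < η → |χ ν - χ μ| < ε

/-- W1-closed subsets of `P(𝕋^d)`. -/
def IsClosedW1 {d : ℕ} (C : Set (PTd d)) : Prop :=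
  ∀ μ : PTd d, (∀ ε > 0, ∃ ν ∈ C, W1 μ ν < ε) → μ ∈ C

/-- The running cost `∫ H*(x,α(s)) dm(s) + 𝓕(m(s))`. -/
def runCost {d : ℕ} (S : MFGSetting d) (m : ℝ → PTd d) (α : ℝ → Td d → Vd d) (s : ℝ) : ℝ :=
  (∫ y, S.Hstar (secT y) (α s y) ∂(m s : Measure (Td d))) + S.Fc (m s)

/-- Admissible pairs `(m,α)` on `[0,T]` starting from `m₀` (with `α ∈ L²_m`). -/
def AdmOn {d : ℕ} (S : MFGSetting d) (σ : ℝ) (m₀ : PTd d) (T : ℝ)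
    (m : ℝ → PTd d) (α : ℝ → Td d → Vd d) : Prop :=
  m 0 = m₀ ∧ W1ContOn m (Set.Icc 0 T) ∧
  (∀ s₁ s₂ : ℝ, 0 ≤ s₁ → s₁ ≤ s₂ → s₂ ≤ T → FPeq σ m α s₁ s₂) ∧
  Measurable (fun q : ℝ × Td d => α q.1 q.2) ∧
  (∫⁻ s in Set.Ioc (0:ℝ) T, ∫⁻ y, ENNReal.ofReal (sqnorm (α s y)) ∂(m s : Measure (Td d))) < ⊤ ∧
  IntervalIntegrable (runCost S m α) volume 0 T

/-- Admissible pairs `(m,α)` on `[0,T]` starting from `m₀`, with `α` merely in `L¹_m`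
(the class `Π_T` used for problems with prescribed endpoints). -/
def AdmOn1 {d : ℕ} (S : MFGSetting d) (σ : ℝ) (m₀ : PTd d) (T : ℝ)
    (m : ℝ → PTd d) (α : ℝ → Td d → Vd d) : Prop :=
  m 0 = m₀ ∧ W1ContOn m (Set.Icc 0 T) ∧
  (∀ s₁ s₂ : ℝ, 0 ≤ s₁ → s₁ ≤ s₂ → s₂ ≤ T → FPeq σ m α s₁ s₂) ∧
  Measurable (fun q : ℝ × Td d => α q.1 q.2) ∧
  (∫⁻ s in Set.Ioc (0:ℝ) T, ∫⁻ y, ENNReal.ofReal (Real.sqrt (sqnorm (α s y)))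
      ∂(m s : Measure (Td d))) < ⊤ ∧
  IntervalIntegrable (runCost S m α) volume 0 T

/-- The finite horizon cost. -/
def costT {d : ℕ} (S : MFGSetting d) (m : ℝ → PTd d) (α : ℝ → Td d → Vd d) (T : ℝ) : ℝ :=
  ∫ s in (0:ℝ)..T, runCost S m α s

/-- The value `𝒰(T,m₀)` of the finite horizon problem. -/
def Ufun {d : ℕ} (S : MFGSetting d) (σ : ℝ) (T : ℝ) (m₀ : PTd d) : ℝ :=
  sInf { r | ∃ m α, AdmOn S σ m₀ T m α ∧ r = costT S m α T }

/-- Admissible pairs for the infinite horizon `δ`-discounted problem. -/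
def AdmDisc {d : ℕ} (S : MFGSetting d) (σ : ℝ) (δ : ℝ) (m₀ : PTd d)
    (m : ℝ → PTd d) (α : ℝ → Td d → Vd d) : Prop :=
  m 0 = m₀ ∧ W1ContOn m (Set.Ici 0) ∧
  (∀ s₁ s₂ : ℝ, 0 ≤ s₁ → s₁ ≤ s₂ → FPeq σ m α s₁ s₂) ∧
  Measurable (fun q : ℝ × Td d => α q.1 q.2) ∧
  (∫⁻ s in Set.Ioi (0:ℝ), ENNReal.ofReal (Real.exp (-δ * s)) *
      ∫⁻ y, ENNReal.ofReal (sqnorm (α s y)) ∂(m s : Measure (Td d))) < ⊤ ∧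
  Integrable (fun s => Real.exp (-δ * s) * runCost S m α s) (volume.restrict (Set.Ioi 0))

/-- The discounted cost. -/
def costDisc {d : ℕ} (S : MFGSetting d) (δ : ℝ) (m : ℝ → PTd d) (α : ℝ → Td d → Vd d) : ℝ :=
  ∫ s in Set.Ioi (0:ℝ), Real.exp (-δ * s) * runCost S m α s

/-- The value `𝒱_δ(m₀)` of the discounted problem. -/
def Vfun {d : ℕ} (S : MFGSetting d) (σ : ℝ) (δ : ℝ) (m₀ : PTd d) : ℝ :=
  sInf { r | ∃ m α, AdmDisc S σ δ m₀ m α ∧ r = costDisc S δ m α }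

/-- `D_p H (x, p)`. -/
def DpH {d : ℕ} (S : MFGSetting d) (x p : Vd d) : Vd d :=
  fun i => fderiv ℝ (fun p' => S.H x p') p (Pi.single i 1)

/-- `C^{1,2}` regularity on `I × 𝕋^d` of a (periodic) time-dependent function. -/
def Creg12 {d : ℕ} (u : ℝ → Vd d → ℝ) (I : Set ℝ) : Prop :=
  ContinuousOn (fun q : ℝ × Vd d => u q.1 q.2) (I ×ˢ Set.univ) ∧
  (∀ x : Vd d, ∀ t ∈ I, DifferentiableAt ℝ (fun s => u s x) t) ∧
  (∀ t ∈ I, ContDiff ℝ 2 (u t)) ∧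
  (∀ t ∈ I, ∀ (x : Vd d) (z : Fin d → ℤ), u t (x + intVec z) = u t x)

/-- `(u,m)` is a classical solution of the `δ`-discounted MFG system on `[0,∞) × 𝕋^d`:
`-∂ₜ u - Δ u + δ u + H(x,Du) = F(x,m)` and `-∂ₜ m + Δ m + div(m D_pH(x,Du)) = 0`. -/
def SolvesDiscMFG {d : ℕ} (S : MFGSetting d) (δ : ℝ) (u : ℝ → Vd d → ℝ) (m : ℝ → PTd d) : Prop :=
  Creg12 u (Set.Ici 0) ∧
  (∀ t ∈ Set.Ici (0:ℝ), ∀ x : Vd d,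
    - tderiv u t x - lapl (u t) x + δ * u t x + S.H x (gradv (u t) x)
      = S.Fd (m t : Measure (Td d)) x) ∧
  W1ContOn m (Set.Ici 0) ∧
  (∀ s₁ s₂ : ℝ, 0 ≤ s₁ → s₁ ≤ s₂ →
    FPeq 1 m (fun s y => DpH S (secT y) (gradv (u s) (secT y))) s₁ s₂)

/-- Admissible pairs for the stationary (ergodic) problem:
`σ Δ m + div(m α) = 0` in the sense of distributions and `α ∈ L²_m`. -/
def StatAdm {d : ℕ} (σ : ℝ) (m : PTd d) (α : Td d → Vd d) : Prop :=
  Measurable α ∧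
  (∫⁻ y, ENNReal.ofReal (sqnorm (α y)) ∂(m : Measure (Td d))) < ⊤ ∧
  ∀ g : Vd d → ℝ, ContDiff ℝ 2 g → (∀ (x : Vd d) (z : Fin d → ℤ), g (x + intVec z) = g x) →
    (∫ y, (σ * lapl g (secT y) - dotp (α y) (gradv g (secT y))) ∂(m : Measure (Td d))) = 0

/-- `ergInf S σ = -λ̄`, the value of the stationary minimization problem. -/
def ergInf {d : ℕ} (S : MFGSetting d) (σ : ℝ) : ℝ :=
  sInf { r | ∃ m α, StatAdm σ m α ∧
    r = (∫ y, S.Hstar (secT y) (α y) ∂(m : Measure (Td d))) + S.Fc m }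

/-- The set of values over which the dynamic programming principle for a corrector
`χ` takes its infimum. -/
def DPPval {d : ℕ} (S : MFGSetting d) (σ : ℝ) (χ : PTd d → ℝ) (lam t : ℝ) (m₀ : PTd d) :
    Set ℝ :=
  { r | ∃ m α, AdmOn S σ m₀ t m α ∧
      r = (∫ s in (0:ℝ)..t, runCost S m α s) + χ (m t) + lam * t }

/-- `χ` is a corrector function: it is continuous and satisfies the dynamic
programming principle with the critical value `λ`. -/
def IsCorrector {d : ℕ} (S : MFGSetting d) (σ : ℝ) (lam : ℝ) (χ : PTd d → ℝ) : Prop :=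
  W1Continuous χ ∧ ∀ (m₀ : PTd d) (t : ℝ), 0 < t → χ m₀ = sInf (DPPval S σ χ lam t m₀)

/-- `(m,α)` is a calibrated curve (defined on all of `ℝ`). -/
def IsCalibrated {d : ℕ} (S : MFGSetting d) (σ : ℝ) (lam : ℝ)
    (m : ℝ → PTd d) (α : ℝ → Td d → Vd d) : Prop :=
  W1ContOn m Set.univ ∧
  (∀ s₁ s₂ : ℝ, s₁ ≤ s₂ → FPeq σ m α s₁ s₂) ∧
  Measurable (fun q : ℝ × Td d => α q.1 q.2) ∧
  (∀ t₁ t₂ : ℝ, (∫⁻ s in Set.Ioc t₁ t₂,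
      ∫⁻ y, ENNReal.ofReal (sqnorm (α s y)) ∂(m s : Measure (Td d))) < ⊤) ∧
  (∀ t₁ t₂ : ℝ, IntervalIntegrable (runCost S m α) volume t₁ t₂) ∧
  ∃ χ : PTd d → ℝ, IsCorrector S σ lam χ ∧ ∀ t₁ t₂ : ℝ, t₁ < t₂ →
    χ (m t₁) = lam * (t₂ - t₁) + (∫ s in t₁..t₂, runCost S m α s) + χ (m t₂)

/-- The projected Mather set. -/
def MatherSet {d : ℕ} (S : MFGSetting d) (σ : ℝ) (lam : ℝ) : Set (PTd d) :=
  { μ | ∃ m α, IsCalibrated S σ lam m α ∧ m 0 = μ }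

/-- Invariant subsets of the projected Mather set. -/
def IsInvariantMFG {d : ℕ} (S : MFGSetting d) (σ : ℝ) (lam : ℝ) (C : Set (PTd d)) : Prop :=
  ∀ μ ∈ C, ∃ m α, IsCalibrated S σ lam m α ∧ m 0 = μ ∧ ∀ t : ℝ, m t ∈ C

/-- Minimal invariant subsets of the projected Mather set. -/
def IsMinimalInvariant {d : ℕ} (S : MFGSetting d) (σ : ℝ) (lam : ℝ) (N : Set (PTd d)) : Prop :=
  N.Nonempty ∧ N ⊆ MatherSet S σ lam ∧ IsClosedW1 N ∧ IsInvariantMFG S σ lam N ∧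
  ∀ C : Set (PTd d), C ⊆ N → C.Nonempty → IsClosedW1 C → IsInvariantMFG S σ lam C → C = N

/-- `δ 𝒱_δ → -λ` uniformly as `δ → 0⁺`. -/
def IsLimitValueV {d : ℕ} (S : MFGSetting d) (σ : ℝ) (lam : ℝ) : Prop :=
  ∀ ε > 0, ∃ δ₀ > 0, ∀ δ : ℝ, 0 < δ → δ ≤ δ₀ → ∀ μ : PTd d,
    |δ * Vfun S σ δ μ - (-lam)| < ε

/-- `𝒰(T,·)/T → -λ` uniformly as `T → ∞`. -/
def IsLimitValueU {d : ℕ} (S : MFGSetting d) (σ : ℝ) (lam : ℝ) : Prop :=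
  ∀ ε > 0, ∃ T₀ : ℝ, ∀ T : ℝ, T₀ ≤ T → ∀ μ : PTd d,
    |Ufun S σ T μ / T - (-lam)| < ε

/-- A function `Φ` on `P(𝕋^d)` is `C¹` with flat derivative `dΦ` (normalized so that
`∫ dΦ(m,·) dm = 0`, periodic in the space variable and jointly continuous). -/
def IsC1Flat {d : ℕ} (Φ : PTd d → ℝ) (dΦ : Measure (Td d) → Vd d → ℝ) : Prop :=
  (∀ (μ : Measure (Td d)) (x : Vd d) (z : Fin d → ℤ), dΦ μ (x + intVec z) = dΦ μ x) ∧
  (∀ μ ν : PTd d,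
    Φ ν - Φ μ = ∫ t in Set.Icc (0:ℝ) 1,
      ((∫ y, dΦ (lineComb t μ ν) (secT y) ∂(ν : Measure (Td d))) -
        ∫ y, dΦ (lineComb t μ ν) (secT y) ∂(μ : Measure (Td d)))) ∧
  (∀ μ : PTd d, (∫ y, dΦ (μ : Measure (Td d)) (secT y) ∂(μ : Measure (Td d))) = 0) ∧
  (∀ ε > 0, ∀ (μ : PTd d) (x : Vd d), ∃ η > 0, ∀ (ν : PTd d) (x' : Vd d),
    W1 μ ν < η → ‖x' - x‖ < η → |dΦ (ν : Measure (Td d)) x' - dΦ (μ : Measure (Td d)) x| < ε)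

/-! ### Torus basics -/

def tm {d : ℕ} (x : Vd d) : Td d := fun i => (x i : AddCircle (1:ℝ))

lemma tm_add {d : ℕ} (x y : Vd d) : tm (x + y) = tm x + tm y := by
  funext i; simp [tm]

lemma tm_zero {d : ℕ} : tm (0 : Vd d) = 0 := by
  funext i; simp [tm]

lemma tm_neg {d : ℕ} (x : Vd d) : tm (-x) = -tm x := by
  funext i; simp [tm]

lemma tm_secT {d : ℕ} (y : Td d) : tm (secT y) = y := by
  funext i
  exact (AddCircle.equivIco 1 0).symm_apply_apply (y i)

lemma secT_mem {d : ℕ} (y : Td d) (i : Fin d) : secT y i ∈ Set.Ico (0:ℝ) 1 := by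
  have h := ((AddCircle.equivIco 1 0) (y i)).2
  simpa [secT] using h

lemma tm_eq_iff {d : ℕ} {x x' : Vd d} (h : tm x = tm x') : ∃ z : Fin d → ℤ, x = x' + intVec z := by
  have h' : ∀ i, ∃ z : ℤ, x i = x' i + z := by
    intro i
    have hi : ((x i : ℝ) : AddCircle (1:ℝ)) = ((x' i : ℝ) : AddCircle (1:ℝ)) := congrFun h i
    have h0 : ((x i - x' i : ℝ) : AddCircle (1:ℝ)) = 0 := by
      rw [AddCircle.coe_sub, hi, sub_self]
    obtain ⟨n, hn⟩ := (AddCircle.coe_eq_zero_iff (p := (1:ℝ))).1 h0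
    refine ⟨n, ?_⟩
    have : (n : ℝ) = x i - x' i := by simpa using hn
    linarith
  choose z hz using h'
  exact ⟨z, funext fun i => by simp [intVec, hz i]⟩

lemma per_secT {d : ℕ} {E : Type*} {f : Vd d → E} (hf : ∀ (x : Vd d) (z : Fin d → ℤ), f (x + intVec z) = f x)
    {x : Vd d} {y : Td d} (h : tm x = y) : f (secT y) = f x := by
  obtain ⟨z, hz⟩ := tm_eq_iff (x := secT y) (x' := x) (by rw [tm_secT, h])
  rw [hz, hf]

lemma isOpenQuotientMap_tm {d : ℕ} : IsOpenQuotientMap (tm (d := d)) :=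
  IsOpenQuotientMap.piMap (f := fun (_ : Fin d) (x : ℝ) => (x : AddCircle (1:ℝ)))
    fun _ => QuotientAddGroup.isOpenQuotientMap_mk

lemma continuous_tm {d : ℕ} : Continuous (tm (d := d)) := isOpenQuotientMap_tm.continuous

lemma continuous_lift {d : ℕ} {E : Type*} [TopologicalSpace E] {f : Vd d → E} (hc : Continuous f)
    (hf : ∀ (x : Vd d) (z : Fin d → ℤ), f (x + intVec z) = f x) :
    Continuous (fun y : Td d => f (secT y)) := by
  rw [isOpenQuotientMap_tm.isQuotientMap.continuous_iff]
  have : (fun y : Td d => f (secT y)) ∘ tm = f := funext fun x => per_secT hf rfl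
  rwa [this]

instance instProbCircle : IsProbabilityMeasure (volume : Measure (AddCircle (1:ℝ))) :=
  ⟨by rw [AddCircle.measure_univ]; simp⟩

instance instProbTd {d : ℕ} : IsProbabilityMeasure (volume : Measure (Td d)) := by
  show IsProbabilityMeasure (Measure.pi fun _ : Fin d => (volume : Measure (AddCircle (1:ℝ))))
  infer_instance

instance instHaarTd {d : ℕ} : (volume : Measure (Td d)).IsAddHaarMeasure := by
  show (Measure.pi fun _ : Fin d => (volume : Measure (AddCircle (1:ℝ)))).IsAddHaarMeasure
  infer_instance

lemma bdd_of_cont {d : ℕ} {g : Td d → ℝ} (hg : Continuous g) : ∃ M, 0 ≤ M ∧ ∀ y, |g y| ≤ M := by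
  obtain ⟨M, hM⟩ := isCompact_univ.exists_bound_of_continuousOn hg.continuousOn
  exact ⟨|M|, abs_nonneg _, fun y => (by simpa using hM y trivial : |g y| ≤ M).trans (le_abs_self M)⟩

lemma integrable_cont {d : ℕ} {g : Td d → ℝ} (hg : Continuous g) (μ : Measure (Td d)) [IsFiniteMeasure μ] :
    Integrable g μ := by
  obtain ⟨M, _, hM⟩ := bdd_of_cont hg
  exact Integrable.of_bound hg.aestronglyMeasurable M (ae_of_all _ fun y => by simpa using hM y)

/-! ### Gaussian -/

def gs (z : ℝ) : ℝ := (√(2*π))⁻¹ * Real.exp (-z^2/2)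

lemma gs_eq : gs = ProbabilityTheory.gaussianPDFReal 0 1 := by
  funext z; simp [gs, ProbabilityTheory.gaussianPDFReal]

lemma gs_pos (z : ℝ) : 0 < gs z := by unfold gs; positivity

lemma gs_cont : Continuous gs := by unfold gs; fun_prop

lemma gs_integrable : Integrable gs := by
  rw [gs_eq]; exact ProbabilityTheory.integrable_gaussianPDFReal 0 1

lemma gs_integral : ∫ z, gs z = 1 := by
  rw [gs_eq]; exact ProbabilityTheory.integral_gaussianPDFReal_eq_one 0 (by simp)

lemma gs_gauss {E : Type*} [NormedAddCommGroup E] [NormedSpace ℝ E] (f : ℝ → E) :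
    ∫ z, f z ∂(ProbabilityTheory.gaussianReal 0 1) = ∫ z, gs z • f z := by
  rw [ProbabilityTheory.integral_gaussianReal_eq_integral_smul (by simp), gs_eq]

lemma gs_mul_integrable : Integrable (fun z => z * gs z) := by
  have h := integrable_mul_exp_neg_mul_sq (b := 1/2) (by norm_num)
  refine (h.const_mul (√(2*π))⁻¹).congr (ae_of_all _ fun z => ?_)
  simp only [gs]
  rw [show -z^2/2 = -(1/2) * z^2 by ring]; ring

/-- characteristic function -/
lemma gs_char (ξ : ℝ) : ∫ z : ℝ, Complex.exp (ξ * z * Complex.I) * (gs z : ℂ) = Complex.exp (-(ξ:ℂ)^2/2) := by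
  have h := ProbabilityTheory.charFun_gaussianReal (μ := 0) (v := 1) ξ
  rw [charFun_apply_real, gs_gauss] at h
  simp only [Complex.real_smul] at h
  rw [← (show (∫ z : ℝ, Complex.exp (ξ * z * Complex.I) * (gs z : ℂ)) = _ from integral_congr_ae (ae_of_all _ fun z => mul_comm _ _))] at h
  rw [h]; congr 1; simp; ring

lemma gs_char' (ξ : ℝ) : ∫ z : ℝ, Complex.exp (ξ * z * Complex.I) * ((z * gs z : ℝ) : ℂ)
    = ξ * Complex.I * Complex.exp (-(ξ:ℂ)^2/2) := by
  have key := integral_mul_deriv_eq_deriv_mul_of_integrable (A := ℂ)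
    (u := fun z : ℝ => Complex.exp (ξ * z * Complex.I)) (v := fun z : ℝ => -(gs z : ℂ))
    (u' := fun z : ℝ => Complex.exp (ξ * z * Complex.I) * (ξ * Complex.I))
    (v' := fun z : ℝ => ((z * gs z : ℝ) : ℂ)) ?_ ?_ ?_ ?_ ?_
  · rw [key, ← gs_char, ← integral_const_mul, ← integral_neg]
    congr 1; funext z; ring
  · intro z _
    have h1 : HasDerivAt (fun z : ℝ => (ξ * (z:ℂ) * Complex.I)) (ξ * Complex.I) z := by
      have := ((Complex.ofRealCLM.hasDerivAt (x := z)).const_mul (ξ:ℂ)).mul_const Complex.I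
      simpa using this
    exact h1.cexp
  · intro z _
    have h1 : HasDerivAt gs (-(z * gs z)) z := by
      have h2 : HasDerivAt (fun z : ℝ => -z^2/2) (-z) z := by
        have := ((hasDerivAt_pow 2 z).neg).div_const 2
        refine this.congr_deriv ?_
        ring
      have := (h2.exp).const_mul (√(2*π))⁻¹
      refine this.congr_deriv ?_
      simp only [gs]; ring
    have h3 := h1.ofReal_comp.neg
    refine h3.congr_deriv ?_
    push_cast; ring
  · refine Integrable.mono' (gs_mul_integrable.norm) ?_ (ae_of_all _ fun z => ?_)
    · exact (by fun_prop : Continuous fun z : ℝ => Complex.exp (ξ * z * Complex.I)).aestronglyMeasurable.mul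
        (Complex.continuous_ofReal.comp (continuous_id.mul gs_cont)).aestronglyMeasurable
    · simp only [Pi.mul_apply, norm_mul]
      rw [show (ξ:ℂ) * z * Complex.I = ((ξ*z : ℝ):ℂ) * Complex.I by push_cast; ring, Complex.norm_exp_ofReal_mul_I]
      simp
  · refine Integrable.mono' (gs_integrable.norm.const_mul |ξ|) ?_ (ae_of_all _ fun z => ?_)
    · exact (by fun_prop : Continuous fun z : ℝ => Complex.exp (ξ * z * Complex.I) * (ξ * Complex.I)).aestronglyMeasurable.mul
        (Complex.continuous_ofReal.comp gs_cont).neg.aestronglyMeasurable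
    · simp only [Pi.mul_apply, norm_mul]
      rw [show (ξ:ℂ) * z * Complex.I = ((ξ*z : ℝ):ℂ) * Complex.I by push_cast; ring, Complex.norm_exp_ofReal_mul_I]
      simp
  · refine Integrable.mono' (gs_integrable.norm) ?_ (ae_of_all _ fun z => ?_)
    · exact (by fun_prop : Continuous fun z : ℝ => Complex.exp (ξ * z * Complex.I)).aestronglyMeasurable.mul
        (Complex.continuous_ofReal.comp gs_cont).neg.aestronglyMeasurable
    · simp only [Pi.mul_apply, norm_mul]
      rw [show (ξ:ℂ) * z * Complex.I = ((ξ*z : ℝ):ℂ) * Complex.I by push_cast; ring, Complex.norm_exp_ofReal_mul_I]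
      simp

def Gs {d : ℕ} (z : Vd d) : ℝ := ∏ i, gs (z i)

lemma Gs_pos {d : ℕ} (z : Vd d) : 0 < Gs z := Finset.prod_pos fun _ _ => gs_pos _

lemma Gs_integrable {d : ℕ} : Integrable (Gs (d := d)) :=
  Integrable.fintype_prod (f := fun _ => gs) fun _ => gs_integrable

lemma Gs_integral {d : ℕ} : ∫ z : Vd d, Gs z = 1 := by
  simp only [Gs]
  rw [integral_fintype_prod_volume_eq_prod (fun (_ : Fin d) => gs)]
  simp [gs_integral]

lemma Gs_mul_eq {d : ℕ} (i : Fin d) (z : Vd d) :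
    z i * Gs z = ∏ j, (if j = i then (fun t => t * gs t) else gs) (z j) := by
  rw [Gs, ← Finset.mul_prod_erase _ _ (Finset.mem_univ i), ← Finset.mul_prod_erase _ _ (Finset.mem_univ i)]
  simp only [if_true, ← mul_assoc]
  congr 1
  refine Finset.prod_congr rfl fun j hj => ?_
  rw [if_neg (Finset.ne_of_mem_erase hj)]

lemma Gs_mul_integrable {d : ℕ} (i : Fin d) : Integrable (fun z : Vd d => z i * Gs z) := by
  simp only [Gs_mul_eq]
  refine Integrable.fintype_prod (f := fun j => (if j = i then (fun t => t * gs t) else gs)) fun j => ?_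
  by_cases h : j = i
  · simp only [h, if_true]; exact gs_mul_integrable
  · simp only [h, if_false]; exact gs_integrable

lemma Gs_neg {d : ℕ} (z : Vd d) : Gs (-z) = Gs z := by simp [Gs, gs]

lemma Gs_exp {d : ℕ} (z : Vd d) : Gs z = (√(2*π))⁻¹^d * Real.exp (-(∑ i, z i^2)/2) := by
  simp only [Gs, gs, Finset.prod_mul_distrib, ← Real.exp_sum]
  rw [Finset.prod_const, Finset.card_univ, Fintype.card_fin]
  congr 2
  rw [← Finset.sum_div, Finset.sum_neg_distrib]

/-! ### Weighted averages -/

def Aw {d : ℕ} (w : Vd d → ℝ) (σ : ℝ) (g : Td d → ℝ) (y : Td d) : ℝ :=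
  ∫ z : Vd d, g (y + tm (σ • z)) * w z

lemma cont_shift {d : ℕ} {g : Td d → ℝ} (hg : Continuous g) (σ : ℝ) :
    Continuous (fun p : Td d × Vd d => g (p.1 + tm (σ • p.2))) :=
  hg.comp (continuous_fst.add (continuous_tm.comp (continuous_snd.const_smul σ)))

lemma Aw_integrable {d : ℕ} {w : Vd d → ℝ} (hw : Integrable w) {g : Td d → ℝ} (hg : Continuous g)
    (σ : ℝ) (y : Td d) : Integrable (fun z => g (y + tm (σ • z)) * w z) := by
  obtain ⟨M, _, hM⟩ := bdd_of_cont hg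
  refine hw.bdd_mul (c := M) ?_ (ae_of_all _ fun z => by simpa using hM _)
  exact ((cont_shift hg σ).comp (Continuous.prodMk_right y)).aestronglyMeasurable

lemma Aw_cont {d : ℕ} {w : Vd d → ℝ} (hw : Integrable w) {g : Td d → ℝ} (hg : Continuous g)
    (σ : ℝ) : Continuous (Aw w σ g) := by
  obtain ⟨M, _, hM⟩ := bdd_of_cont hg
  refine continuous_of_dominated (bound := fun z => M * |w z|) (fun y => (Aw_integrable hw hg σ y).aestronglyMeasurable)
    (fun y => ae_of_all _ fun z => ?_) (hw.abs.const_mul M) (ae_of_all _ fun z => ?_)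
  · rw [norm_mul]; exact mul_le_mul_of_nonneg_right (by simpa using hM _) (norm_nonneg _)
  · exact ((cont_shift hg σ).comp (Continuous.prodMk_left z)).mul continuous_const

lemma Aw_sub {d : ℕ} {w : Vd d → ℝ} (hw : Integrable w) {g h : Td d → ℝ} (hg : Continuous g) (hh : Continuous h)
    (σ : ℝ) (y : Td d) : Aw w σ (fun y => g y - h y) y = Aw w σ g y - Aw w σ h y := by
  simp only [Aw, sub_mul]
  exact integral_sub (Aw_integrable hw hg σ y) (Aw_integrable hw hh σ y)

lemma Aw_smul {d : ℕ} {w : Vd d → ℝ} {g : Td d → ℝ} (c : ℝ)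
    (σ : ℝ) (y : Td d) : Aw w σ (fun y => c * g y) y = c * Aw w σ g y := by
  simp only [Aw, mul_assoc]
  exact integral_const_mul _ _

lemma Aw_sum {d : ℕ} {ι : Type*} {w : Vd d → ℝ} (hw : Integrable w) (s : Finset ι) {g : ι → Td d → ℝ} (hg : ∀ i, Continuous (g i))
    (σ : ℝ) (y : Td d) : Aw w σ (fun y => ∑ i ∈ s, g i y) y = ∑ i ∈ s, Aw w σ (g i) y := by
  simp only [Aw, Finset.sum_mul]
  exact integral_finsetSum _ fun i _ => (Aw_integrable hw (hg i) σ y)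

lemma Aw_adj {d : ℕ} {w : Vd d → ℝ} (hw : Integrable w) {f g : Td d → ℝ} (hf : Continuous f) (hg : Continuous g)
    (σ : ℝ) : ∫ y, f y * Aw w σ g y = ∫ y, g y * Aw (fun z => w (-z)) σ f y := by
  have hint : ∀ {w : Vd d → ℝ} (_ : Integrable w) {f g : Td d → ℝ} (_ : Continuous f) (_ : Continuous g),
      Integrable (Function.uncurry fun (y : Td d) (z : Vd d) => f y * (g (y + tm (σ • z)) * w z))
        ((volume : Measure (Td d)).prod (volume : Measure (Vd d))) := by
    intro w hw f g hf hg
    obtain ⟨M, _, hM⟩ := bdd_of_cont hf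
    obtain ⟨N, hN0, hN⟩ := bdd_of_cont hg
    have h1 : Integrable (fun p : Td d × Vd d => w p.2) (volume.prod volume) := hw.comp_snd volume
    have h2 := h1.bdd_mul (c := M * N) (f := fun p : Td d × Vd d => f p.1 * g (p.1 + tm (σ • p.2)))
      ((hf.comp continuous_fst).mul (cont_shift hg σ)).aestronglyMeasurable
      (ae_of_all _ fun p => by
        rw [norm_mul]; exact mul_le_mul (by simpa using hM _) (by simpa using hN _) (norm_nonneg _) ((abs_nonneg _).trans (hM p.1)))
    refine h2.congr (ae_of_all _ fun p => ?_)
    simp [Function.uncurry, mul_assoc]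
  have hw' : Integrable (fun z => w (-z)) := hw.comp_neg
  simp only [Aw, ← integral_const_mul]
  rw [integral_integral_swap (hint hw hf hg), integral_integral_swap (hint hw' hg hf)]
  rw [← integral_neg_eq_self]
  refine integral_congr_ae (ae_of_all _ fun z => ?_)
  simp only []
  rw [← integral_add_right_eq_self (μ := (volume : Measure (Td d))) _ (tm (σ • z))]
  refine integral_congr_ae (ae_of_all _ fun y => ?_)
  simp only [smul_neg, tm_neg, add_neg_cancel_right]
  ring

/-! ### Characters -/

def ch {d : ℕ} (k : Fin d → ℤ) (c : ℂ) (y : Td d) : ℝ := (c * UnitAddTorus.mFourier k y).re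

lemma ch_cont {d : ℕ} (k : Fin d → ℤ) (c : ℂ) : Continuous (ch k c) :=
  Complex.continuous_re.comp (continuous_const.mul (UnitAddTorus.mFourier k).continuous)

lemma mF_tm {d : ℕ} (k : Fin d → ℤ) (y : Td d) (v : Vd d) :
    UnitAddTorus.mFourier k (y + tm v) = UnitAddTorus.mFourier k y * ∏ j, Complex.exp ((2*π*k j * v j : ℝ) * Complex.I) := by
  simp only [UnitAddTorus.mFourier, ContinuousMap.coe_mk, Pi.add_apply]
  rw [← Finset.prod_mul_distrib]
  refine Finset.prod_congr rfl fun j _ => ?_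
  rw [fourier_apply, fourier_apply, smul_add, AddCircle.toCircle_add]
  rw [Circle.coe_mul]
  congr 1
  rw [← fourier_apply, tm, fourier_coe_apply]
  congr 1; push_cast; ring

lemma mF_zero {d : ℕ} (k : Fin d → ℤ) : UnitAddTorus.mFourier k (0 : Td d) = 1 := by
  simp [UnitAddTorus.mFourier]

/-- ch in coordinates -/
lemma ch_tm {d : ℕ} (k : Fin d → ℤ) (c : ℂ) (x : Vd d) :
    ch k c (tm x) = (c * Complex.exp ((2*π*∑ j, (k j:ℝ) * x j : ℝ) * Complex.I)).re := by
  have := mF_tm k 0 x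
  rw [zero_add, mF_zero, one_mul] at this
  rw [ch, this, ← Complex.exp_sum]
  congr 3
  rw [← Finset.sum_mul]; congr 1; push_cast; rw [Finset.mul_sum]
  refine Finset.sum_congr rfl fun j _ => ?_
  ring

lemma Aw_ch {d : ℕ} (k : Fin d → ℤ) (c : ℂ) (σ : ℝ) (w : Fin d → ℝ → ℝ) (hw : ∀ i, Integrable (w i)) (y : Td d) :
    Aw (fun z => ∏ j, w j (z j)) σ (ch k c) y =
      (c * UnitAddTorus.mFourier k y * ∏ j, ∫ t : ℝ, Complex.exp ((2*π*k j*σ:ℝ) * t * Complex.I) * (w j t : ℂ)).re := by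
  rw [← integral_fintype_prod_volume_eq_prod (𝕜 := ℂ) (fun j (t:ℝ) => Complex.exp ((2*π*k j*σ:ℝ) * t * Complex.I) * (w j t : ℂ))]
  rw [← integral_const_mul]
  have hi : Integrable (fun z : Vd d => c * UnitAddTorus.mFourier k y * ∏ j, (Complex.exp ((2*π*k j*σ:ℝ) * z j * Complex.I) * (w j (z j) : ℂ))) := by
    refine Integrable.const_mul (Integrable.fintype_prod
      (f := fun j (t:ℝ) => Complex.exp ((2*π*k j*σ:ℝ) * t * Complex.I) * (w j t : ℂ)) fun j => ?_) _
    refine (hw j).ofReal.bdd_mul (c := 1) (by fun_prop) (ae_of_all _ fun t => ?_)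
    rw [show ((2*π*k j*σ:ℝ):ℂ) * t * Complex.I = ((2*π*k j*σ*t : ℝ):ℂ) * Complex.I by push_cast; ring,
      Complex.norm_exp_ofReal_mul_I]
  have := Complex.reCLM.integral_comp_comm hi
  simp only [Complex.reCLM_apply] at this
  rw [← this, Aw]
  refine integral_congr_ae (ae_of_all _ fun z => ?_)
  simp only [ch]
  rw [mF_tm, Finset.prod_mul_distrib, ← Complex.ofReal_prod, ← mul_assoc, ← mul_assoc, Complex.re_mul_ofReal]
  have he : ∀ j, Complex.exp ((2*π*k j * (σ • z) j : ℝ) * Complex.I) = Complex.exp ((2*π*k j*σ:ℝ) * z j * Complex.I) := by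
    intro j; congr 1; simp; ring
  simp only [he]

def lam {d : ℕ} (k : Fin d → ℤ) : ℝ := 4*π^2*∑ j, (k j:ℝ)^2

def Ph {d : ℕ} (r : ℝ) (g : Td d → ℝ) : Td d → ℝ := Aw Gs (√(2*r)) g
def Qh {d : ℕ} (i : Fin d) (r : ℝ) (g : Td d → ℝ) (y : Td d) : ℝ := (√(2*r))⁻¹ * Aw (fun z => z i * Gs z) (√(2*r)) g y

lemma Ph_ch {d : ℕ} (k : Fin d → ℤ) (c : ℂ) {r : ℝ} (hr : 0 ≤ r) (y : Td d) :
    Ph r (ch k c) y = Real.exp (-(lam k)*r) * ch k c y := by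
  have h := Aw_ch k c (√(2*r)) (fun _ => gs) (fun _ => gs_integrable) y
  show Aw (fun z => ∏ j, gs (z j)) _ _ _ = _
  rw [h]
  simp only [gs_char]
  rw [← Complex.exp_sum]
  have : (∑ j, -(((2*π*k j*√(2*r):ℝ):ℂ))^2/2) = ((-(lam k)*r : ℝ) : ℂ) := by
    rw [← Complex.ofReal_inj.2 (show (∑ j, -(2*π*k j*√(2*r))^2/2) = -(lam k)*r from ?_)]
    · push_cast; rfl
    · simp only [mul_pow, Real.sq_sqrt (by positivity : 0 ≤ 2*r), lam]
      rw [Finset.mul_sum, ← Finset.sum_neg_distrib, Finset.sum_mul]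
      refine Finset.sum_congr rfl fun j _ => ?_
      ring
  rw [this, ← Complex.ofReal_exp, Complex.re_mul_ofReal, ch, mul_comm]

lemma Qh_ch {d : ℕ} (i : Fin d) (k : Fin d → ℤ) (c : ℂ) {r : ℝ} (hr : 0 < r) (y : Td d) :
    Qh i r (ch k c) y = Real.exp (-(lam k)*r) * ch k (2*π*k i*Complex.I*c) y := by
  have hσ : 0 < √(2*r) := by positivity
  have h := Aw_ch k c (√(2*r)) (fun j => if j = i then (fun t => t * gs t) else gs) (fun j => by
    by_cases h : j = i
    · simp only [h, if_true]; exact gs_mul_integrable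
    · simp only [h, if_false]; exact gs_integrable) y
  rw [Qh]
  simp only [Gs_mul_eq]
  rw [h]
  have h2 : ∀ j, (∫ t : ℝ, Complex.exp ((2*π*k j*√(2*r):ℝ) * t * Complex.I) * (((if j = i then (fun t => t * gs t) else gs) t : ℝ) : ℂ))
      = (if j = i then ((2*π*k j*√(2*r):ℝ):ℂ) * Complex.I else 1) * Complex.exp (-((2*π*k j*√(2*r):ℝ):ℂ)^2/2) := by
    intro j
    by_cases h : j = i
    · simp only [h, if_true]; exact gs_char' _
    · simp only [h, if_false, one_mul]; exact gs_char _
  simp only [h2]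
  rw [Finset.prod_mul_distrib, Finset.prod_ite_eq' Finset.univ i, if_pos (Finset.mem_univ i)]
  rw [← Complex.exp_sum]
  have : (∑ j, -(((2*π*k j*√(2*r):ℝ):ℂ))^2/2) = ((-(lam k)*r : ℝ) : ℂ) := by
    rw [← Complex.ofReal_inj.2 (show (∑ j, -(2*π*k j*√(2*r))^2/2) = -(lam k)*r from ?_)]
    · push_cast; rfl
    · simp only [mul_pow, Real.sq_sqrt (by positivity : 0 ≤ 2*r), lam]
      rw [Finset.mul_sum, ← Finset.sum_neg_distrib, Finset.sum_mul]
      refine Finset.sum_congr rfl fun j _ => ?_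
      ring
  rw [this, ← Complex.ofReal_exp, ← mul_assoc, Complex.re_mul_ofReal, ch, mul_comm _ (Real.exp _), ← mul_assoc, mul_comm _ (Real.exp _), mul_assoc]
  congr 1
  rw [← Complex.re_ofReal_mul]
  congr 1
  have h3 : (((√(2*r))⁻¹:ℝ):ℂ) * ((√(2*r):ℝ):ℂ) = 1 := by
    rw [← Complex.ofReal_mul, inv_mul_cancel₀ hσ.ne']; simp
  push_cast at h3 ⊢
  linear_combination (c * UnitAddTorus.mFourier k y * 2 * π * k i * Complex.I) * h3

/-! ### Trigonometric sums and density -/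

def Tsum {d : ℕ} (s : Finset (Fin d → ℤ)) (c : (Fin d → ℤ) → ℂ) (y : Td d) : ℝ := ∑ k ∈ s, ch k (c k) y

lemma Tsum_cont {d : ℕ} (s : Finset (Fin d → ℤ)) (c : (Fin d → ℤ) → ℂ) : Continuous (Tsum s c) :=
  continuous_finsetSum _ fun k _ => ch_cont k (c k)

lemma trig_dense {d : ℕ} {g : Td d → ℝ} (hg : Continuous g) {ε : ℝ} (hε : 0 < ε) :
    ∃ s c, ∀ y, |g y - Tsum s c y| ≤ ε := by
  let G : C(UnitAddTorus (Fin d), ℂ) := ⟨fun y => (g y : ℂ), Complex.continuous_ofReal.comp hg⟩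
  have hG : G ∈ (Submodule.span ℂ (Set.range (UnitAddTorus.mFourier (d := Fin d)))).topologicalClosure := by
    rw [UnitAddTorus.span_mFourier_closure_eq_top]; trivial
  rw [← SetLike.mem_coe, Submodule.topologicalClosure_coe, Metric.mem_closure_iff] at hG
  obtain ⟨f, hf, hd⟩ := hG ε hε
  rw [SetLike.mem_coe, Finsupp.mem_span_range_iff_exists_finsupp] at hf
  obtain ⟨c, rfl⟩ := hf
  refine ⟨c.support, c, fun y => ?_⟩
  have h1 := (ContinuousMap.dist_apply_le_dist (f := G) (g := c.sum fun i a => a • UnitAddTorus.mFourier i) y).trans hd.le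
  rw [dist_eq_norm] at h1
  refine le_trans ?_ h1
  refine le_trans (le_of_eq ?_) (Complex.abs_re_le_norm _)
  congr 1
  simp [G, Tsum, Finsupp.sum, ch, ContinuousMap.coe_sum]

lemma dens_eq {d : ℕ} (T1 T2 : (Td d → ℝ) → ℝ) (C : ℝ)
    (h1 : ∀ f g : Td d → ℝ, Continuous f → Continuous g → ∀ ε, (∀ y, |f y - g y| ≤ ε) → |T1 f - T1 g| ≤ C * ε)
    (h2 : ∀ f g : Td d → ℝ, Continuous f → Continuous g → ∀ ε, (∀ y, |f y - g y| ≤ ε) → |T2 f - T2 g| ≤ C * ε)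
    (h : ∀ s c, T1 (Tsum s c) = T2 (Tsum s c)) {g : Td d → ℝ} (hg : Continuous g) : T1 g = T2 g := by
  refine eq_of_abs_sub_le_all fun ε hε => ?_
  obtain ⟨s, c, hs⟩ := trig_dense hg (ε := ε / (2 * (|C| + 1))) (by positivity)
  have a1 := h1 g _ hg (Tsum_cont s c) _ hs
  have a2 := h2 g _ hg (Tsum_cont s c) _ hs
  rw [h s c] at a1
  have a3 : C * (ε / (2 * (|C| + 1))) ≤ ε / 2 := by
    rw [mul_div_assoc', div_le_div_iff₀ (by positivity) (by positivity)]
    nlinarith [le_abs_self C]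
  rw [abs_le] at *
  constructor <;> linarith [a1.1, a1.2, a2.1, a2.2]

/-! ### Heat operators: basic properties -/

lemma Ph_cont {d : ℕ} {g : Td d → ℝ} (hg : Continuous g) (r : ℝ) : Continuous (Ph r g) :=
  Aw_cont Gs_integrable hg _

lemma Qh_cont {d : ℕ} {g : Td d → ℝ} (hg : Continuous g) (i : Fin d) (r : ℝ) : Continuous (Qh i r g) :=
  continuous_const.mul (Aw_cont (Gs_mul_integrable i) hg _)

lemma Ph_const {d : ℕ} (r c : ℝ) (y : Td d) : Ph r (fun _ => c) y = c := by
  simp [Ph, Aw, integral_const_mul, Gs_integral]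

lemma Ph_zero {d : ℕ} (g : Td d → ℝ) (y : Td d) : Ph 0 g y = g y := by
  simp [Ph, Aw, tm_zero, integral_const_mul, Gs_integral]

lemma Ph_mono {d : ℕ} {g h : Td d → ℝ} (hg : Continuous g) (hh : Continuous h) (hgh : ∀ y, g y ≤ h y) (r : ℝ) (y : Td d) :
    Ph r g y ≤ Ph r h y :=
  integral_mono (Aw_integrable Gs_integrable hg _ y) (Aw_integrable Gs_integrable hh _ y)
    fun z => mul_le_mul_of_nonneg_right (hgh _) (Gs_pos z).le

lemma Ph_sub {d : ℕ} {g h : Td d → ℝ} (hg : Continuous g) (hh : Continuous h) (r : ℝ) (y : Td d) :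
    Ph r (fun y => g y - h y) y = Ph r g y - Ph r h y := Aw_sub Gs_integrable hg hh _ y

lemma Ph_smul {d : ℕ} {g : Td d → ℝ} (c r : ℝ) (y : Td d) :
    Ph r (fun y => c * g y) y = c * Ph r g y := Aw_smul c _ y

lemma Qh_sub {d : ℕ} {g h : Td d → ℝ} (hg : Continuous g) (hh : Continuous h) (i : Fin d) (r : ℝ) (y : Td d) :
    Qh i r (fun y => g y - h y) y = Qh i r g y - Qh i r h y := by
  simp only [Qh, Aw_sub (Gs_mul_integrable i) hg hh]; ring

lemma Ph_abs_le {d : ℕ} {g h : Td d → ℝ} (hg : Continuous g) (hh : Continuous h) (hgh : ∀ y, |g y| ≤ h y) (r : ℝ) (y : Td d) :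
    |Ph r g y| ≤ Ph r h y := by
  rw [abs_le]
  constructor
  · have := Ph_mono (g := fun y => (-1) * h y) (h := g) (by fun_prop) hg (fun y => by linarith [(abs_le.1 (hgh y)).1]) r y
    rw [Ph_smul] at this; linarith
  · exact Ph_mono hg hh (fun y => (le_abs_self _).trans (hgh y)) r y

lemma Ph_bound {d : ℕ} {g : Td d → ℝ} (hg : Continuous g) {M : ℝ} (hM : ∀ y, |g y| ≤ M) (r : ℝ) (y : Td d) :
    |Ph r g y| ≤ M := by
  have := Ph_abs_le (h := fun _ => M) hg continuous_const hM r y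
  rwa [Ph_const] at this

lemma sqrt_four {r : ℝ} : √(2*(2*r)) = √2 * √(2*r) := Real.sqrt_mul (by norm_num) _

lemma Ph_double {d : ℕ} (h : Td d → ℝ) (r : ℝ) (y : Td d) :
    ∫ z : Vd d, h (y + tm (√(2*r) • z)) * Gs ((√2)⁻¹ • z) = √2^d * Ph (2*r) h y := by
  have := Measure.integral_comp_smul (volume : Measure (Vd d)) (fun z : Vd d => h (y + tm (√(2*r) • z)) * Gs ((√2)⁻¹ • z)) (√2)
  rw [Ph, Aw, sqrt_four]
  simp only [smul_smul, inv_mul_cancel₀ (show √2 ≠ 0 by positivity), one_smul, Module.finrank_fin_fun, smul_eq_mul] at this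
  rw [abs_of_pos (by positivity)] at this
  simp only [mul_comm (√2) (√(2*r))]
  rw [this, ← mul_assoc, mul_inv_cancel₀ (by positivity), one_mul]

lemma Gs_half {d : ℕ} (z : Vd d) : Gs ((√2)⁻¹ • z) = (√(2*π))⁻¹^d * Real.exp (-(∑ i, z i^2)/4) := by
  rw [Gs_exp]; congr 2
  simp only [Pi.smul_apply, smul_eq_mul, mul_pow, inv_pow, Real.sq_sqrt (show (0:ℝ) ≤ 2 by norm_num)]
  rw [← Finset.mul_sum]; ring

lemma Gs_half_integrable {d : ℕ} : Integrable (fun z : Vd d => Gs ((√2)⁻¹ • z)) :=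
  Gs_integrable.comp_smul (by positivity)

lemma Gs_dom {d : ℕ} (i : Fin d) (z : Vd d) : |z i * Gs z| ≤ Gs ((√2)⁻¹ • z) := by
  rw [abs_mul, abs_of_pos (Gs_pos z), Gs_half, Gs_exp, mul_left_comm]
  refine mul_le_mul_of_nonneg_left ?_ (by positivity)
  have h1 : |z i| ≤ Real.exp ((∑ i, z i^2)/4) := by
    have h2 : z i ^2 ≤ ∑ i, z i^2 := Finset.single_le_sum (f := fun i => z i^2) (fun j _ => sq_nonneg _) (Finset.mem_univ i)
    have h3 := Real.add_one_le_exp ((∑ i, z i^2)/4)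
    have h4 := sq_abs (z i)
    nlinarith [sq_nonneg (|z i| - 2)]
  calc |z i| * Real.exp (-(∑ i, z i^2)/2) ≤ Real.exp ((∑ i, z i^2)/4) * Real.exp (-(∑ i, z i^2)/2) :=
        mul_le_mul_of_nonneg_right h1 (by positivity)
    _ = _ := by rw [← Real.exp_add]; congr 1; ring

lemma Qh_dom {d : ℕ} {g h : Td d → ℝ} (hg : Continuous g) (hh : Continuous h) (hgh : ∀ y, |g y| ≤ h y) (i : Fin d) (r : ℝ) (y : Td d) :
    |Qh i r g y| ≤ (√(2*r))⁻¹ * (√2^d * Ph (2*r) h y) := by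
  rw [Qh, abs_mul, abs_of_nonneg (by positivity : 0 ≤ (√(2*r))⁻¹)]
  refine mul_le_mul_of_nonneg_left ?_ (by positivity)
  rw [← Ph_double, Aw]
  refine norm_integral_le_of_norm_le (f := fun z : Vd d => g (y + tm (√(2*r) • z)) * (z i * Gs z)) (Aw_integrable Gs_half_integrable hh _ y) (ae_of_all _ fun z => ?_)
  rw [norm_mul]
  exact mul_le_mul (hgh _) (Gs_dom i z) (norm_nonneg _) ((abs_nonneg _).trans (hgh _))

lemma Qh_bound {d : ℕ} {g : Td d → ℝ} (hg : Continuous g) {M : ℝ} (hM : ∀ y, |g y| ≤ M) (i : Fin d) (r : ℝ) (y : Td d) :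
    |Qh i r g y| ≤ (√(2*r))⁻¹ * √2^d * M := by
  have := Qh_dom (h := fun _ => M) hg continuous_const hM i r y
  rwa [Ph_const, ← mul_assoc] at this

lemma Ph_adj {d : ℕ} {f g : Td d → ℝ} (hf : Continuous f) (hg : Continuous g) (r : ℝ) :
    ∫ y, f y * Ph r g y = ∫ y, g y * Ph r f y := by
  have := Aw_adj Gs_integrable hf hg (√(2*r))
  simp only [Gs_neg] at this
  exact this

lemma Qh_adj {d : ℕ} {f g : Td d → ℝ} (hf : Continuous f) (hg : Continuous g) (i : Fin d) (r : ℝ) :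
    ∫ y, f y * Qh i r g y = - ∫ y, g y * Qh i r f y := by
  have := Aw_adj (Gs_mul_integrable i) hf hg (√(2*r))
  simp only [Gs_neg, Pi.neg_apply] at this
  have e : ∀ y, Aw (fun z : Vd d => -z i * Gs z) (√(2*r)) f y = - Aw (fun z : Vd d => z i * Gs z) (√(2*r)) f y := by
    intro y; simp only [Aw]; rw [← integral_neg]; congr 1; ext z; ring
  simp only [e] at this
  simp only [Qh, mul_left_comm _ (√(2*r))⁻¹, integral_const_mul]
  rw [this]; simp [integral_neg]

lemma Ph_int {d : ℕ} {g : Td d → ℝ} (hg : Continuous g) (r : ℝ) : ∫ y, Ph r g y = ∫ y, g y := by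
  have := Ph_adj (f := fun _ => (1:ℝ)) continuous_const hg r
  simpa [Ph_const] using this

lemma Ph_harnack {d : ℕ} {h : Td d → ℝ} (hh : Continuous h) (h0 : ∀ y, 0 ≤ h y) {r : ℝ} (hr : 0 < r) (y y' : Td d) :
    Ph r h y ≤ Real.exp (d/(4*r)) * (√2^d * Ph (2*r) h y') := by
  have hs : 0 < √(2*r) := by positivity
  set a : Vd d := (√(2*r))⁻¹ • secT (y - y') with ha
  have hy : y = y' + tm (√(2*r) • a) := by
    rw [ha, smul_smul, mul_inv_cancel₀ hs.ne', one_smul, tm_secT]; abel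
  have hasq : ∑ i, a i ^2 ≤ d/(2*r) := by
    have : ∀ i, a i^2 ≤ 1/(2*r) := fun i => by
      simp only [ha, Pi.smul_apply, smul_eq_mul, mul_pow, inv_pow, Real.sq_sqrt (by positivity : 0 ≤ 2*r)]
      have := secT_mem (y-y') i
      rw [one_div]
      exact mul_le_of_le_one_right (by positivity) (by nlinarith [this.1, this.2])
    calc _ ≤ ∑ i : Fin d, 1/(2*r) := Finset.sum_le_sum fun i _ => this i
      _ = _ := by simp; ring
  have e1 : Ph r h y = ∫ w : Vd d, h (y' + tm (√(2*r) • w)) * Gs (w - a) := by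
    rw [Ph, Aw, ← integral_sub_right_eq_self _ a]
    congr 1; ext w
    rw [hy, add_assoc, ← tm_add, ← smul_add]; simp
  rw [e1, ← Ph_double, ← integral_const_mul]
  refine integral_mono (Aw_integrable (Gs_integrable.comp_sub_right a) hh _ y') ((Aw_integrable Gs_half_integrable hh _ y').const_mul _) fun w => ?_
  simp only []
  rw [mul_left_comm]
  refine mul_le_mul_of_nonneg_left ?_ (h0 _)
  rw [Gs_half, Gs_exp, mul_left_comm, ← Real.exp_add]
  refine mul_le_mul_of_nonneg_left (Real.exp_le_exp.2 ?_) (by positivity)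
  have : ∑ i, w i^2 ≤ 2 * ∑ i, (w - a) i^2 + 2 * ∑ i, a i^2 := by
    rw [Finset.mul_sum, Finset.mul_sum, ← Finset.sum_add_distrib]
    refine Finset.sum_le_sum fun i _ => ?_
    simp only [Pi.sub_apply]; nlinarith [sq_nonneg (w i - 2 * a i)]
  have e2 : (d:ℝ)/(4*r) = (d/(2*r))/2 := by field_simp; ring
  rw [e2]; linarith

def Charn (d : ℕ) (r : ℝ) : ℝ := Real.exp (d/(4*r)) * √2^d

lemma Charn_pos (d : ℕ) (r : ℝ) : 0 < Charn d r := by unfold Charn; positivity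

lemma Ph_L1 {d : ℕ} {h : Td d → ℝ} (hh : Continuous h) (h0 : ∀ y, 0 ≤ h y) {r : ℝ} (hr : 0 < r) (y : Td d) :
    Ph r h y ≤ Charn d r * ∫ y, h y := by
  rw [← Ph_int hh (2*r), ← integral_const_mul]
  have : Ph r h y = ∫ _ : Td d, Ph r h y := by simp
  rw [this]
  refine integral_mono (integrable_const _) ((integrable_cont (Ph_cont hh _) _).const_mul _) fun y' => ?_
  simp only []
  rw [Charn, mul_assoc]
  exact Ph_harnack hh h0 hr y y'

lemma Ph_tendsto {d : ℕ} {g : Td d → ℝ} (hg : Continuous g) (y : Td d) :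
    Tendsto (fun r => Ph r g y) (nhds 0) (nhds (g y)) := by
  obtain ⟨M, _, hM⟩ := bdd_of_cont hg
  have : Continuous (fun r => Ph r g y) := by
    refine continuous_of_dominated (bound := fun z => M * Gs z) (fun r => (Aw_integrable Gs_integrable hg _ y).aestronglyMeasurable)
      (fun r => ae_of_all _ fun z => ?_) (Gs_integrable.const_mul M) (ae_of_all _ fun z => ?_)
    · rw [norm_mul, Real.norm_of_nonneg (Gs_pos z).le]; exact mul_le_mul_of_nonneg_right (by simpa using hM _) (Gs_pos z).le
    · refine Continuous.mul (hg.comp (continuous_const.add (continuous_tm.comp ?_))) continuous_const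
      fun_prop
  have h := this.tendsto 0
  rwa [Ph_zero] at h

/-! ### Trig sums under heat operators, semigroup -/

lemma ch_smul {d : ℕ} (k : Fin d → ℤ) (a : ℝ) (c : ℂ) (y : Td d) : a * ch k c y = ch k (a * c) y := by
  rw [ch, ch, mul_assoc, Complex.re_ofReal_mul]

lemma Ph_Tsum {d : ℕ} (s : Finset (Fin d → ℤ)) (c : (Fin d → ℤ) → ℂ) {r : ℝ} (hr : 0 ≤ r) :
    Ph r (Tsum s c) = Tsum s (fun k => (Real.exp (-(lam k)*r) : ℝ) * c k) := by
  ext y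
  have := Aw_sum (Gs_integrable (d := d)) s (fun k => ch_cont k (c k)) (√(2*r)) y
  refine this.trans (Finset.sum_congr rfl fun k _ => ?_)
  rw [← ch_smul, ← Ph_ch k (c k) hr y]; rfl

lemma Qh_Tsum {d : ℕ} (i : Fin d) (s : Finset (Fin d → ℤ)) (c : (Fin d → ℤ) → ℂ) {r : ℝ} (hr : 0 < r) :
    Qh i r (Tsum s c) = Tsum s (fun k => (Real.exp (-(lam k)*r) : ℝ) * (2*π*k i*Complex.I*c k)) := by
  ext y
  have := Aw_sum (Gs_mul_integrable (d := d) i) s (fun k => ch_cont k (c k)) (√(2*r)) y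
  rw [Qh]
  refine (congrArg _ this).trans ?_
  rw [Finset.mul_sum]
  refine Finset.sum_congr rfl fun k _ => ?_
  rw [← ch_smul, ← Qh_ch i k (c k) hr y]; rfl

lemma Tsum_congr {d : ℕ} {s : Finset (Fin d → ℤ)} {c c' : (Fin d → ℤ) → ℂ} (h : ∀ k, c k = c' k) : Tsum s c = Tsum s c' := by
  rw [funext h]

lemma Ph_diff {d : ℕ} {f g : Td d → ℝ} (hf : Continuous f) (hg : Continuous g) (r : ℝ) {ε : ℝ} (h : ∀ y, |f y - g y| ≤ ε) (y : Td d) :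
    |Ph r f y - Ph r g y| ≤ ε := by
  rw [← Ph_sub hf hg]; exact Ph_bound (hf.sub hg) h r y

lemma Qh_diff {d : ℕ} {f g : Td d → ℝ} (hf : Continuous f) (hg : Continuous g) (i : Fin d) (r : ℝ) {ε : ℝ} (h : ∀ y, |f y - g y| ≤ ε) (y : Td d) :
    |Qh i r f y - Qh i r g y| ≤ (√(2*r))⁻¹ * √2^d * ε := by
  rw [← Qh_sub hf hg]; exact Qh_bound (hf.sub hg) h i r y

lemma Ph_Ph {d : ℕ} {g : Td d → ℝ} (hg : Continuous g) {a b : ℝ} (ha : 0 ≤ a) (hb : 0 ≤ b) (y : Td d) :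
    Ph a (Ph b g) y = Ph (a+b) g y := by
  refine dens_eq (fun g => Ph a (Ph b g) y) (fun g => Ph (a+b) g y) 1
    (fun f g hf hg ε h => ?_) (fun f g hf hg ε h => ?_) (fun s c => ?_) hg
  · rw [one_mul]; exact Ph_diff (Ph_cont hf _) (Ph_cont hg _) _ (Ph_diff hf hg _ h) y
  · rw [one_mul]; exact Ph_diff hf hg _ h y
  · rw [Ph_Tsum _ _ hb, Ph_Tsum _ _ ha, Ph_Tsum _ _ (add_nonneg ha hb)]
    refine congrFun (Tsum_congr fun k => ?_) y
    rw [← mul_assoc, ← Complex.ofReal_mul, ← Real.exp_add]; congr 3; ring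

lemma Ph_Qh {d : ℕ} {g : Td d → ℝ} (hg : Continuous g) (i : Fin d) {a b : ℝ} (ha : 0 ≤ a) (hb : 0 < b) (y : Td d) :
    Ph a (Qh i b g) y = Qh i (a+b) g y := by
  refine dens_eq (fun g => Ph a (Qh i b g) y) (fun g => Qh i (a+b) g y) (max ((√(2*b))⁻¹ * √2^d) ((√(2*(a+b)))⁻¹ * √2^d))
    (fun f g hf hg ε h => ?_) (fun f g hf hg ε h => ?_) (fun s c => ?_) hg
  · have hε : 0 ≤ ε := (abs_nonneg _).trans (h 0)
    exact (Ph_diff (Qh_cont hf _ _) (Qh_cont hg _ _) _ (Qh_diff hf hg _ _ h) y).trans (mul_le_mul_of_nonneg_right (le_max_left _ _) hε)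
  · have hε : 0 ≤ ε := (abs_nonneg _).trans (h 0)
    exact (Qh_diff hf hg _ _ h y).trans (mul_le_mul_of_nonneg_right (le_max_right _ _) hε)
  · rw [Qh_Tsum _ _ _ hb, Ph_Tsum _ _ ha, Qh_Tsum _ _ _ (by linarith)]
    refine congrFun (Tsum_congr fun k => ?_) y
    rw [← mul_assoc, ← Complex.ofReal_mul, ← Real.exp_add]; congr 3; ring

/-! ### Calculus on the torus -/

def grd {d : ℕ} (a : Fin d → ℝ) : Vd d →L[ℝ] ℝ := ∑ i, a i • (ContinuousLinearMap.proj i : Vd d →L[ℝ] ℝ)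

lemma grd_apply {d : ℕ} (a : Fin d → ℝ) (v : Vd d) : grd a v = ∑ i, a i * v i := by simp [grd]

lemma grd_single {d : ℕ} (a : Fin d → ℝ) (i : Fin d) : grd a (Pi.single i 1) = a i := by
  rw [grd_apply]; simp [Pi.single_apply]

lemma grd_norm {d : ℕ} (a : Fin d → ℝ) : ‖grd a‖ ≤ ∑ i, |a i| := by
  refine ContinuousLinearMap.opNorm_le_bound _ (Finset.sum_nonneg fun _ _ => abs_nonneg _) fun v => ?_
  rw [grd_apply, Finset.sum_mul]
  refine (norm_sum_le _ _).trans (Finset.sum_le_sum fun i _ => ?_)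
  rw [norm_mul]
  exact mul_le_mul_of_nonneg_left (norm_le_pi_norm v i) (norm_nonneg _)

lemma grd_sub {d : ℕ} (a b : Fin d → ℝ) : grd a - grd b = grd (fun i => a i - b i) := by
  ext v; simp [grd_apply, sub_mul]

lemma clm_eq_grd {d : ℕ} (A : Vd d →L[ℝ] ℝ) : A = grd (fun i => A (Pi.single i 1)) := by
  ext v
  rw [grd_apply]
  conv_lhs => rw [pi_eq_sum_univ' v]
  rw [map_sum]
  refine Finset.sum_congr rfl fun i _ => ?_
  rw [map_smul, smul_eq_mul, mul_comm]

def HasG {d : ℕ} (f : Td d → ℝ) (D : Fin d → Td d → ℝ) : Prop :=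
  (∀ i, Continuous (D i)) ∧ ∀ x, HasFDerivAt (fun x => f (tm x)) (grd fun i => D i (tm x)) x

lemma cont_of_tm {d : ℕ} {E : Type*} [TopologicalSpace E] {f : Td d → E} (h : Continuous (fun x => f (tm x))) : Continuous f :=
  isOpenQuotientMap_tm.isQuotientMap.continuous_iff.2 h

lemma HasG.cont {d : ℕ} {f : Td d → ℝ} {D : Fin d → Td d → ℝ} (h : HasG f D) : Continuous f :=
  cont_of_tm (continuous_iff_continuousAt.2 fun x => (h.2 x).continuousAt)

lemma HasG.line {d : ℕ} {f : Td d → ℝ} {D : Fin d → Td d → ℝ} (h : HasG f D) (y : Td d) (v : Vd d) (s : ℝ) :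
    HasDerivAt (fun s : ℝ => f (y + tm (s • v))) (∑ i, D i (y + tm (s • v)) * v i) s := by
  have h1 := h.2 (secT y + s • v)
  have h2 : HasDerivAt (fun s : ℝ => secT y + s • v) v s := by
    simpa using ((hasDerivAt_id s).smul_const v).const_add (secT y)
  have h3 := h1.comp_hasDerivAt s h2
  simp only [Function.comp_def, grd_apply, tm_add, tm_secT] at h3
  exact h3

lemma HasG.mul {d : ℕ} {f g : Td d → ℝ} {D E : Fin d → Td d → ℝ} (h : HasG f D) (h' : HasG g E) :
    HasG (fun y => f y * g y) (fun i y => f y * E i y + g y * D i y) := by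
  refine ⟨fun i => (h.cont.mul (h'.1 i)).add (h'.cont.mul (h.1 i)), fun x => ?_⟩
  have := (h.2 x).mul (h'.2 x)
  refine this.congr_fderiv ?_
  ext v; simp only [_root_.add_apply, _root_.smul_apply, grd_apply, smul_eq_mul, Finset.mul_sum]
  rw [← Finset.sum_add_distrib]; exact Finset.sum_congr rfl fun i _ => by ring

lemma HasG.comp {d : ℕ} {f : Td d → ℝ} {D : Fin d → Td d → ℝ} (h : HasG f D) {j j' : ℝ → ℝ} (hj : ∀ a, HasDerivAt j (j' a) a)
    (hc : Continuous j') : HasG (fun y => j (f y)) (fun i y => j' (f y) * D i y) := by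
  refine ⟨fun i => (hc.comp h.cont).mul (h.1 i), fun x => ?_⟩
  have := (hj (f (tm x))).comp_hasFDerivAt x (h.2 x)
  refine this.congr_fderiv ?_
  ext v; simp only [_root_.smul_apply, grd_apply, smul_eq_mul, Finset.mul_sum]
  exact Finset.sum_congr rfl fun i _ => by ring

lemma cont_addR {d : ℕ} {g : Td d → ℝ} (hg : Continuous g) (w : Td d) : Continuous (fun y => g (y + w)) :=
  hg.comp (continuous_id.add continuous_const)

lemma cont_addL {d : ℕ} {g : Td d → ℝ} (hg : Continuous g) (w : Td d) : Continuous (fun y => g (w + y)) :=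
  hg.comp (continuous_const.add continuous_id)

lemma HasG.int_zero {d : ℕ} {f : Td d → ℝ} {D : Fin d → Td d → ℝ} (h : HasG f D) (i : Fin d) : ∫ y, D i y = 0 := by
  obtain ⟨M, _, hM⟩ := bdd_of_cont (h.1 i)
  have key := hasDerivAt_integral_of_dominated_loc_of_deriv_le (μ := (volume : Measure (Td d))) (x₀ := (0:ℝ)) (s := univ)
    (F := fun s y => f (y + tm (s • Pi.single i 1))) (F' := fun s y => D i (y + tm (s • Pi.single i 1))) (bound := fun _ => M)
    univ_mem (Eventually.of_forall fun s => (cont_addR h.cont _).aestronglyMeasurable)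
    (integrable_cont (cont_addR h.cont _) _)
    (cont_addR (h.1 i) _).aestronglyMeasurable
    (ae_of_all _ fun y s _ => hM _) (integrable_const _) (ae_of_all _ fun y s _ => by
      have := h.line y (Pi.single i 1) s
      refine this.congr_deriv ?_
      simp [Pi.single_apply])
  have h2 := key.2
  simp only [zero_smul, tm_zero, add_zero, integral_add_right_eq_self (μ := (volume : Measure (Td d))) f] at h2
  exact (h2.unique (hasDerivAt_const _ _))

lemma HasG.ibp {d : ℕ} {f g : Td d → ℝ} {D E : Fin d → Td d → ℝ} (h : HasG f D) (h' : HasG g E) (i : Fin d) :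
    ∫ y, f y * E i y = - ∫ y, g y * D i y := by
  have := (h.mul h').int_zero i
  have e := integral_add (μ := (volume : Measure (Td d))) (f := fun y => f y * E i y) (g := fun y => g y * D i y)
    (integrable_cont (h.cont.mul (h'.1 i)) _) (integrable_cont (h'.cont.mul (h.1 i)) _)
  rw [e] at this
  linarith

/-- good lifts -/
lemma exists_lift {d : ℕ} (y y' : Td d) : ∃ v : Vd d, y = y' + tm v ∧ ‖v‖ ≤ dist y y' := by
  have : ∀ a : AddCircle (1:ℝ), ∃ v : ℝ, (v : AddCircle (1:ℝ)) = a ∧ |v| = ‖a‖ := by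
    intro a
    induction a using QuotientAddGroup.induction_on with
    | H x =>
      refine ⟨x - round x, ?_, ?_⟩
      · rw [AddCircle.coe_sub, sub_eq_self]
        have := AddCircle.coe_period (1:ℝ)
        rw [show ((round x : ℤ) : ℝ) = (round x : ℤ) • (1:ℝ) by simp, AddCircle.coe_zsmul, this, smul_zero]
      · exact (UnitAddCircle.norm_eq (x := x)).symm
  choose φ h1 h2 using this
  refine ⟨fun i => φ (y i - y' i), ?_, ?_⟩
  · ext i; simp [tm, h1]
  · rw [pi_norm_le_iff_of_nonneg dist_nonneg]
    intro i
    rw [Real.norm_eq_abs, h2, ← dist_eq_norm]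
    exact dist_le_pi_dist y y' i

lemma HasG.lip {d : ℕ} {f : Td d → ℝ} {D : Fin d → Td d → ℝ} (h : HasG f D) {C : ℝ} (hC : 0 ≤ C) (hD : ∀ i y, |D i y| ≤ C) :
    LipschitzWith (d * C).toNNReal f := by
  refine LipschitzWith.of_dist_le_mul fun y y' => ?_
  obtain ⟨v, hv, hn⟩ := exists_lift y y'
  rw [Real.coe_toNNReal _ (by positivity)]
  have h1 := Convex.norm_image_sub_le_of_norm_hasDerivWithin_le (f := fun s : ℝ => f (y' + tm (s • v))) (s := univ) (C := d * C * ‖v‖)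
    (fun s _ => (h.line y' v s).hasDerivWithinAt) (fun s _ => ?_) convex_univ (mem_univ 0) (mem_univ 1)
  · simp only [one_smul, zero_smul, tm_zero, add_zero, ← hv] at h1
    rw [dist_eq_norm]
    refine h1.trans ?_
    simp only [sub_zero, norm_one, mul_one]
    exact mul_le_mul_of_nonneg_left hn (by positivity)
  · calc ‖∑ i, D i (y' + tm (s • v)) * v i‖ ≤ ∑ i : Fin d, C * ‖v‖ := (norm_sum_le _ _).trans (Finset.sum_le_sum fun i _ => by
          rw [norm_mul]; exact mul_le_mul (hD _ _) (norm_le_pi_norm v i) (norm_nonneg _) hC)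
      _ = _ := by simp; ring

lemma HasG.poincare {d : ℕ} {f : Td d → ℝ} {D : Fin d → Td d → ℝ} (h : HasG f D) (h0 : ∫ y, f y = 0) :
    ∫ y, |f y| ≤ ∫ y, ∑ i, |D i y| := by
  set N : Td d → ℝ := fun y => ∑ i, |D i y| with hN
  have hNc : Continuous N := continuous_finsetSum _ fun i _ => (h.1 i).abs
  have step : ∀ w : Td d, ∫ y, |f (y + w) - f y| ≤ ∫ y, N y := by
    intro w
    set v := secT w with hv
    have hc2 : Continuous (fun p : Td d × ℝ => N (p.1 + tm (p.2 • v))) :=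
      hNc.comp (continuous_fst.add (continuous_tm.comp (continuous_snd.smul continuous_const)))
    have h1 : ∀ y, |f (y + w) - f y| ≤ ∫ s in (0:ℝ)..1, N (y + tm (s • v)) := by
      intro y
      have hcs : Continuous (fun s : ℝ => ∑ i, D i (y + tm (s • v)) * v i) := by
        refine continuous_finsetSum _ fun i _ => ((h.1 i).comp (continuous_const.add (continuous_tm.comp (continuous_id.smul continuous_const)))).mul continuous_const
      have := intervalIntegral.integral_eq_sub_of_hasDerivAt (a := 0) (b := 1) (fun s _ => h.line y v s) (hcs.intervalIntegrable _ _)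
      simp only [one_smul, zero_smul, tm_zero, add_zero] at this
      rw [hv, tm_secT] at this
      rw [← this]
      have hii : IntervalIntegrable (fun s : ℝ => N (y + tm (s • v))) volume 0 1 :=
        Continuous.intervalIntegrable (hc2.comp (Continuous.prodMk_right y)) _ _
      refine intervalIntegral.norm_integral_le_of_norm_le (f := fun s : ℝ => ∑ i, D i (y + tm (s • v)) * v i) zero_le_one (ae_of_all _ fun s _ => ?_) hii
      refine (norm_sum_le _ _).trans (Finset.sum_le_sum fun i _ => ?_)
      rw [norm_mul]
      have := secT_mem w i
      refine mul_le_of_le_one_right (norm_nonneg _) ?_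
      rw [Real.norm_eq_abs, abs_le]; constructor <;> linarith [this.1, this.2]
    have hint : Integrable (Function.uncurry fun (y : Td d) (s : ℝ) => N (y + tm (s • v))) ((volume : Measure (Td d)).prod (volume.restrict (Set.uIoc 0 1))) := by
      obtain ⟨M, _, hM⟩ := bdd_of_cont hNc
      have : IsFiniteMeasure (volume.restrict (Set.uIoc (0:ℝ) 1)) := ⟨by simp [Set.uIoc_of_le]⟩
      exact Integrable.of_bound hc2.aestronglyMeasurable M (ae_of_all _ fun p => hM _)
    calc ∫ y, |f (y + w) - f y| ≤ ∫ y, ∫ s in (0:ℝ)..1, N (y + tm (s • v)) := by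
          refine integral_mono (integrable_cont ((cont_addR h.cont w).sub h.cont).abs _) ?_ h1
          have := hint.integral_prod_left
          simpa only [intervalIntegral.integral_of_le (zero_le_one (α := ℝ)), Function.uncurry, Set.uIoc_of_le (zero_le_one (α := ℝ))] using this
      _ = ∫ s in (0:ℝ)..1, ∫ y, N (y + tm (s • v)) := by
          simp only [intervalIntegral.integral_of_le (zero_le_one (α := ℝ))]
          rw [Set.uIoc_of_le (zero_le_one (α := ℝ))] at hint
          exact integral_integral_swap hint
      _ = ∫ y, N y := by
          simp only [integral_add_right_eq_self (μ := (volume : Measure (Td d))) N]; simp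
  have hcc : Continuous (fun p : Td d × Td d => |f (p.1 + p.2) - f p.1|) := by
    have := h.cont; fun_prop
  have hint2 : Integrable (Function.uncurry fun (y w : Td d) => |f (y + w) - f y|) ((volume : Measure (Td d)).prod volume) := by
    obtain ⟨M, _, hM⟩ := bdd_of_cont h.cont
    refine Integrable.of_bound hcc.aestronglyMeasurable (M + M) (ae_of_all _ fun p => ?_)
    simp only [Function.uncurry, norm_abs_eq_norm]
    exact (norm_sub_le _ _).trans (add_le_add (hM _) (hM _))
  have h2 : ∀ y, |f y| ≤ ∫ w, |f (y + w) - f y| := by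
    intro y
    have : -f y = ∫ w, (f (y + w) - f y) := by
      rw [integral_sub (integrable_cont (cont_addL h.cont y) _) (integrable_const _),
        integral_add_left_eq_self (μ := (volume : Measure (Td d))) f, h0]; simp
    rw [← abs_neg, this]
    exact abs_integral_le_integral_abs
  calc ∫ y, |f y| ≤ ∫ y, ∫ w, |f (y + w) - f y| :=
        integral_mono (integrable_cont h.cont.abs _) hint2.integral_prod_left h2
    _ = ∫ w, ∫ y, |f (y + w) - f y| := integral_integral_swap hint2
    _ ≤ ∫ _ : Td d, ∫ y, N y := integral_mono hint2.integral_prod_right (integrable_const _) step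
    _ = _ := by simp

/-- periodic C1 functions -/
lemma HasG.of_per {d : ℕ} {g : Vd d → ℝ} (hp : ∀ (x : Vd d) (z : Fin d → ℤ), g (x + intVec z) = g x) (hg : ContDiff ℝ 1 g) :
    HasG (fun y => g (secT y)) (fun i y => gradv g (secT y) i) := by
  have hf : ∀ x z, fderiv ℝ g (x + intVec z) = fderiv ℝ g x := by
    intro x z
    have : (fun x => g (x + intVec z)) = g := funext fun x => hp x z
    conv_rhs => rw [← this]
    rw [fderiv_comp_add_right]
  have hG : ∀ (x : Vd d) z, gradv g (x + intVec z) = gradv g x := fun x z => by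
    ext i; simp [gradv, hf]
  refine ⟨fun i => ?_, fun x => ?_⟩
  · refine continuous_lift (f := fun x => gradv g x i) ?_ (fun x z => by rw [hG])
    exact (hg.continuous_fderiv one_ne_zero).clm_apply continuous_const
  · have e1 : (fun x => g (secT (tm x))) = g := funext fun x => per_secT hp rfl
    have e2 : gradv g (secT (tm x)) = gradv g x := per_secT hG rfl
    simp only [e1, e2]
    have := (hg.differentiable (by norm_num) x).hasFDerivAt
    rwa [clm_eq_grd (fderiv ℝ g x)] at this

/-! ### Derivatives of heat averages -/

lemma ch_HasG {d : ℕ} (k : Fin d → ℤ) (c : ℂ) : HasG (ch k c) (fun i => ch k (2*π*k i*Complex.I*c)) := by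
  refine ⟨fun i => ch_cont _ _, fun x => ?_⟩
  simp only [ch_tm]
  have h1 : HasFDerivAt (fun x : Vd d => (2*π*∑ j, (k j:ℝ) * x j : ℝ)) ((2*π) • grd (fun j => (k j:ℝ))) x := by
    have := ((grd (fun j => (k j:ℝ))).hasFDerivAt (x := x)).const_mul (2*π)
    simpa only [grd_apply] using this
  have h2 : ∀ t : ℝ, HasDerivAt (fun t : ℝ => (c * Complex.exp ((t:ℝ) * Complex.I)).re) ((Complex.I * c * Complex.exp ((t:ℝ) * Complex.I)).re) t := by
    intro t
    have h3 : HasDerivAt (fun t : ℝ => c * Complex.exp ((t:ℝ) * Complex.I)) (Complex.I * c * Complex.exp ((t:ℝ) * Complex.I)) t := by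
      have h4 : HasDerivAt (fun t : ℝ => ((t:ℝ):ℂ) * Complex.I) (1 * Complex.I) t := (Complex.ofRealCLM.hasDerivAt (x := t)).mul_const Complex.I
      refine (h4.cexp.const_mul c).congr_deriv ?_
      ring
    exact Complex.reCLM.hasFDerivAt.comp_hasDerivAt t h3
  refine ((h2 _).comp_hasFDerivAt x h1).congr_fderiv ?_
  ext v
  simp only [_root_.smul_apply, grd_apply, smul_eq_mul]
  rw [← mul_assoc, Finset.mul_sum]
  refine Finset.sum_congr rfl fun i _ => ?_
  rw [show ((2:ℂ)*π*k i*Complex.I*c) * Complex.exp ((2*π*∑ j, (k j:ℝ) * x j : ℝ) * Complex.I) = ((2*π*k i : ℝ):ℂ) * (Complex.I * c * Complex.exp ((2*π*∑ j, (k j:ℝ) * x j : ℝ) * Complex.I)) by push_cast; ring,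
    Complex.re_ofReal_mul]
  ring

lemma Tsum_HasG {d : ℕ} (s : Finset (Fin d → ℤ)) (c : (Fin d → ℤ) → ℂ) :
    HasG (Tsum s c) (fun i => Tsum s (fun k => 2*π*k i*Complex.I*c k)) := by
  refine ⟨fun i => Tsum_cont _ _, fun x => ?_⟩
  have := HasFDerivAt.fun_sum (u := s) (fun k _ => (ch_HasG k (c k)).2 x)
  refine this.congr_fderiv ?_
  ext v
  simp only [_root_.sum_apply, grd_apply, Tsum, Finset.sum_mul]
  exact Finset.sum_comm

lemma Ph_HasG {d : ℕ} {g : Td d → ℝ} (hg : Continuous g) {r : ℝ} (hr : 0 < r) : HasG (Ph r g) (fun i => Qh i r g) := by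
  refine ⟨fun i => Qh_cont hg i r, fun x => ?_⟩
  have hex : ∀ n : ℕ, ∃ p : Finset (Fin d → ℤ) × ((Fin d → ℤ) → ℂ), ∀ y, |g y - Tsum p.1 p.2 y| ≤ 1/(n+1:ℝ) := fun n => by
    obtain ⟨s, c, h⟩ := trig_dense hg (ε := 1/(n+1:ℝ)) (by positivity)
    exact ⟨(s,c), h⟩
  choose p hp using hex
  set C := (√(2*r))⁻¹ * √2^d with hC
  refine hasFDerivAt_of_tendstoUniformly (l := atTop) (f := fun n x => Ph r (Tsum (p n).1 (p n).2) (tm x))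
    (f' := fun n x => grd fun i => Qh i r (Tsum (p n).1 (p n).2) (tm x)) (g' := fun x => grd fun i => Qh i r g (tm x)) ?_ (fun n x => ?_) (fun x => ?_) x
  · rw [Metric.tendstoUniformly_iff]
    intro ε hε
    have ht : Tendsto (fun n : ℕ => d * (C * (1/(n+1:ℝ)))) atTop (nhds (d * (C * 0))) :=
      (tendsto_one_div_add_atTop_nhds_zero_nat.const_mul C).const_mul (d:ℝ)
    rw [mul_zero, mul_zero] at ht
    filter_upwards [ht.eventually (gt_mem_nhds hε)] with n hn x
    refine lt_of_le_of_lt ?_ hn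
    rw [dist_eq_norm, grd_sub]
    refine (grd_norm _).trans ?_
    calc _ ≤ ∑ i : Fin d, C * (1/(n+1:ℝ)) := Finset.sum_le_sum fun i _ => Qh_diff hg (Tsum_cont _ _) i r (hp n) _
      _ = _ := by simp
  · have h1 := (Tsum_HasG (p n).1 (fun k => (Real.exp (-(lam k)*r) : ℝ) * (p n).2 k)).2 x
    rw [Ph_Tsum _ _ hr.le]
    refine h1.congr_fderiv (congrArg grd (funext fun i => ?_))
    rw [Qh_Tsum _ _ _ hr]
    exact congrFun (Tsum_congr fun k => by ring) _
  · rw [tendsto_iff_dist_tendsto_zero]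
    refine squeeze_zero (fun _ => dist_nonneg) (fun n => ?_) (tendsto_one_div_add_atTop_nhds_zero_nat (𝕜 := ℝ))
    rw [dist_comm, dist_eq_norm]
    exact Ph_diff hg (Tsum_cont _ _) r (hp n) _

lemma Qh_half {d : ℕ} {g : Td d → ℝ} (hg : Continuous g) {r : ℝ} (hr : 0 < r) (j : Fin d) :
    Qh j r g = Ph (r/2) (Qh j (r/2) g) := by
  ext y; rw [Ph_Qh hg j (by positivity) (by positivity)]; congr 1; ring

lemma Qh_HasG {d : ℕ} {g : Td d → ℝ} (hg : Continuous g) {r : ℝ} (hr : 0 < r) (j : Fin d) :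
    HasG (Qh j r g) (fun i => Qh i (r/2) (Qh j (r/2) g)) := by
  rw [Qh_half hg hr]
  exact Ph_HasG (Qh_cont hg _ _) (by positivity)

lemma HasG.fd {d : ℕ} {f : Td d → ℝ} {D : Fin d → Td d → ℝ} (h : HasG f D) (x : Vd d) :
    fderiv ℝ (fun x => f (tm x)) x = grd fun i => D i (tm x) := (h.2 x).fderiv

lemma HasG.c1 {d : ℕ} {f : Td d → ℝ} {D : Fin d → Td d → ℝ} (h : HasG f D) : ContDiff ℝ 1 (fun x => f (tm x)) := by
  rw [contDiff_one_iff_fderiv]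
  refine ⟨fun x => (h.2 x).differentiableAt, ?_⟩
  rw [show fderiv ℝ (fun x => f (tm x)) = fun x => grd fun i => D i (tm x) from funext h.fd]
  exact continuous_finsetSum _ fun i _ => ((h.1 i).comp continuous_tm).smul continuous_const

lemma HasG.c2 {d : ℕ} {f : Td d → ℝ} {D : Fin d → Td d → ℝ} {DD : Fin d → Fin d → Td d → ℝ} (h : HasG f D)
    (h2 : ∀ j, HasG (D j) (DD j)) : ContDiff ℝ 2 (fun x => f (tm x)) := by
  rw [show (2 : WithTop ℕ∞) = 1 + 1 by norm_num, contDiff_succ_iff_fderiv]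
  refine ⟨fun x => (h.2 x).differentiableAt, by simp, ?_⟩
  rw [show fderiv ℝ (fun x => f (tm x)) = fun x => grd fun i => D i (tm x) from funext h.fd]
  exact ContDiff.sum fun i _ => (h2 i).c1.smul contDiff_const

lemma HasG.gr {d : ℕ} {f : Td d → ℝ} {D : Fin d → Td d → ℝ} (h : HasG f D) (x : Vd d) :
    gradv (fun x => f (tm x)) x = fun i => D i (tm x) := by
  ext i; rw [gradv, h.fd, grd_single]

lemma HasG.lp {d : ℕ} {f : Td d → ℝ} {D : Fin d → Td d → ℝ} {DD : Fin d → Fin d → Td d → ℝ} (h : HasG f D)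
    (h2 : ∀ j, HasG (D j) (DD j)) (x : Vd d) : lapl (fun x => f (tm x)) x = ∑ i, DD i i (tm x) := by
  simp only [lapl, D2, h.fd, grd_single, (h2 _).fd]

lemma tm_per {d : ℕ} (x : Vd d) (z : Fin d → ℤ) : tm (x + intVec z) = tm x := by
  rw [tm_add]
  have : tm (intVec z : Vd d) = 0 := by
    ext i
    have := AddCircle.coe_period (1:ℝ)
    simp only [tm, intVec, Pi.zero_apply]
    rw [show ((z i : ℤ) : ℝ) = (z i : ℤ) • (1:ℝ) by simp, AddCircle.coe_zsmul, this, smul_zero]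
  rw [this, add_zero]

/-! ### Wasserstein distance and differences of measures -/

def MM {d : ℕ} (μ ν : PTd d) (f : Td d → ℝ) : ℝ := (∫ y, f y ∂(μ : Measure (Td d))) - ∫ y, f y ∂(ν : Measure (Td d))

lemma MM_sub {d : ℕ} (μ ν : PTd d) {f g : Td d → ℝ} (hf : Continuous f) (hg : Continuous g) :
    MM μ ν (fun y => f y - g y) = MM μ ν f - MM μ ν g := by
  simp only [MM]
  rw [integral_sub (integrable_cont hf _) (integrable_cont hg _), integral_sub (integrable_cont hf _) (integrable_cont hg _)]; ring

lemma MM_smul {d : ℕ} (μ ν : PTd d) (c : ℝ) (f : Td d → ℝ) :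
    MM μ ν (fun y => c * f y) = c * MM μ ν f := by
  simp only [MM, integral_const_mul]; ring

lemma int_bound {d : ℕ} (μ : PTd d) {f : Td d → ℝ} {M : ℝ} (hM : ∀ y, |f y| ≤ M) : |∫ y, f y ∂(μ : Measure (Td d))| ≤ M := by
  have := norm_integral_le_of_norm_le_const (μ := (μ : Measure (Td d))) (f := f) (C := M) (ae_of_all _ hM)
  simpa using this

lemma MM_bound {d : ℕ} (μ ν : PTd d) {f : Td d → ℝ} {M : ℝ} (hM : ∀ y, |f y| ≤ M) : |MM μ ν f| ≤ 2 * M := by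
  have h1 := int_bound μ hM
  have h2 := int_bound ν hM
  rw [MM]
  exact (abs_sub _ _).trans (by linarith)

lemma MM_const {d : ℕ} (μ ν : PTd d) (c : ℝ) : MM μ ν (fun _ => c) = 0 := by simp [MM]

lemma MM_lip_bdd {d : ℕ} (μ ν : PTd d) {φ : Td d → ℝ} (h : LipschitzWith 1 φ) : MM μ ν φ ≤ 2 * Metric.diam (univ : Set (Td d)) := by
  have e : MM μ ν φ = MM μ ν (fun y => φ y - φ 0) := by
    rw [MM_sub μ ν h.continuous continuous_const, MM_const, sub_zero]
  rw [e]
  refine (le_abs_self _).trans (MM_bound μ ν fun y => ?_)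
  have := h.dist_le_mul y 0
  rw [Real.dist_eq] at this
  refine this.trans ?_
  simp only [NNReal.coe_one, one_mul]
  exact Metric.dist_le_diam_of_mem isCompact_univ.isBounded (mem_univ _) (mem_univ _)

lemma W1_bddAbove {d : ℕ} (μ ν : PTd d) : BddAbove { r | ∃ φ : Td d → ℝ, LipschitzWith 1 φ ∧
    r = (∫ y, φ y ∂(μ : Measure (Td d))) - ∫ y, φ y ∂(ν : Measure (Td d)) } := by
  refine ⟨2 * Metric.diam (univ : Set (Td d)), ?_⟩
  rintro r ⟨φ, h, rfl⟩
  exact MM_lip_bdd μ ν h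

lemma W1_ge {d : ℕ} (μ ν : PTd d) {φ : Td d → ℝ} (h : LipschitzWith 1 φ) : MM μ ν φ ≤ W1 μ ν :=
  le_csSup (W1_bddAbove μ ν) ⟨φ, h, rfl⟩

lemma W1_nonneg {d : ℕ} (μ ν : PTd d) : 0 ≤ W1 μ ν := by
  have := W1_ge μ ν (φ := fun _ => 0) (LipschitzWith.const' 0)
  rwa [MM_const] at this

lemma W1_le {d : ℕ} (μ ν : PTd d) {C : ℝ} (h : ∀ φ : Td d → ℝ, LipschitzWith 1 φ → MM μ ν φ ≤ C) : W1 μ ν ≤ C := by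
  refine csSup_le ⟨_, fun _ => 0, LipschitzWith.const' 0, rfl⟩ ?_
  rintro r ⟨φ, hφ, rfl⟩
  exact h φ hφ

lemma MM_lip1 {d : ℕ} (μ ν : PTd d) {f : Td d → ℝ} {L : ℝ} (hL : 0 ≤ L) (h : LipschitzWith L.toNNReal f) : MM μ ν f ≤ L * W1 μ ν := by
  refine le_of_forall_pos_le_add fun ε hε => ?_
  set L' := L + ε / (W1 μ ν + 1) with hL'
  have hW := W1_nonneg μ ν
  have hL0 : 0 < L' := by positivity
  have h1 : LipschitzWith 1 (fun y => L'⁻¹ * f y) := by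
    refine LipschitzWith.of_dist_le_mul fun x y => ?_
    have := h.dist_le_mul x y
    rw [Real.dist_eq] at *
    rw [← mul_sub, abs_mul, abs_of_pos (by positivity), NNReal.coe_one, one_mul, inv_mul_le_iff₀ hL0]
    rw [Real.coe_toNNReal _ hL] at this
    refine this.trans (mul_le_mul_of_nonneg_right ?_ dist_nonneg)
    rw [hL']; linarith [show 0 ≤ ε / (W1 μ ν + 1) by positivity]
  have h2 := W1_ge μ ν h1
  rw [MM_smul, inv_mul_le_iff₀ hL0] at h2
  refine h2.trans ?_
  rw [hL', add_mul]
  have : ε / (W1 μ ν + 1) * W1 μ ν ≤ ε := by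
    rw [div_mul_eq_mul_div, div_le_iff₀ (by positivity)]; nlinarith
  linarith

lemma MM_lip {d : ℕ} (μ ν : PTd d) {f : Td d → ℝ} {L : ℝ} (hL : 0 ≤ L) (h : LipschitzWith L.toNNReal f) : |MM μ ν f| ≤ L * W1 μ ν := by
  rw [abs_le]
  refine ⟨?_, MM_lip1 μ ν hL h⟩
  have := MM_lip1 μ ν (f := fun y => (-1) * f y) hL (by have h' := h.neg; simp only [neg_one_mul]; exact h')
  rw [MM_smul] at this; linarith

lemma HasG.exists_lip {d : ℕ} {f : Td d → ℝ} {D : Fin d → Td d → ℝ} (h : HasG f D) : ∃ L : ℝ, 0 ≤ L ∧ LipschitzWith L.toNNReal f := by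
  choose M hM0 hM using fun i => bdd_of_cont (h.1 i)
  have h0 : 0 ≤ ∑ i, M i := Finset.sum_nonneg fun i _ => hM0 i
  exact ⟨d * ∑ i, M i, by positivity, h.lip h0 fun i y => (hM i y).trans (Finset.single_le_sum (fun i _ => hM0 i) (Finset.mem_univ i))⟩

/-! ### Weak continuity -/

lemma weak_cont {d : ℕ} {m : ℝ → PTd d} (hm : W1ContOn m (Ici 0)) {f : Td d → ℝ} (hf : Continuous f) :
    ContinuousOn (fun τ => ∫ y, f y ∂(m τ : Measure (Td d))) (Ici 0) := by
  rw [Metric.continuousOn_iff]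
  intro t ht ε hε
  obtain ⟨s, c, hs⟩ := trig_dense hf (ε := ε/4) (by positivity)
  obtain ⟨L, hL0, hL⟩ := (Tsum_HasG s c).exists_lip
  obtain ⟨η, hη, h⟩ := hm t ht (ε / (4 * (L+1))) (by positivity)
  refine ⟨η, hη, fun τ hτ hd => ?_⟩
  rw [Real.dist_eq] at hd ⊢
  have h1 := h τ hτ hd
  show |MM (m τ) (m t) f| < ε
  have h2 := MM_lip (m τ) (m t) hL0 hL
  have h3 := MM_bound (m τ) (m t) hs
  rw [MM_sub _ _ hf (Tsum_cont s c)] at h3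
  have h4 : L * W1 (m τ) (m t) ≤ ε / 4 := by
    calc L * W1 (m τ) (m t) ≤ (L+1) * (ε / (4 * (L+1))) := mul_le_mul (by linarith) h1.le (W1_nonneg _ _) (by positivity)
      _ = ε/4 := by field_simp
  have h5 := abs_sub_abs_le_abs_sub (MM (m τ) (m t) f) (MM (m τ) (m t) (Tsum s c))
  linarith

lemma weak_cont2 {d : ℕ} {m : ℝ → PTd d} (hm : W1ContOn m (Ici 0)) {f : ℝ → Td d → ℝ} (hf : Continuous (fun p : ℝ × Td d => f p.1 p.2)) :
    ContinuousOn (fun τ => ∫ y, f τ y ∂(m τ : Measure (Td d))) (Ici 0) := by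
  have hft : ∀ t, Continuous (f t) := fun t => hf.comp (Continuous.prodMk_right t)
  let F : C(ℝ, C(Td d, ℝ)) := ContinuousMap.curry ⟨_, hf⟩
  intro t ht
  have h1 : Tendsto (fun τ => ∫ y, f t y ∂(m τ : Measure (Td d))) (nhdsWithin t (Ici 0)) (nhds (∫ y, f t y ∂(m t : Measure (Td d)))) :=
    weak_cont hm (hft t) t ht
  have h2 : Tendsto (fun τ => (∫ y, f τ y ∂(m τ : Measure (Td d))) - ∫ y, f t y ∂(m τ : Measure (Td d))) (nhdsWithin t (Ici 0)) (nhds 0) := by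
    have h3 : Tendsto (fun τ => dist (F τ) (F t)) (nhdsWithin t (Ici 0)) (nhds 0) :=
      (tendsto_iff_dist_tendsto_zero.1 (F.continuous.tendsto t)).mono_left nhdsWithin_le_nhds
    refine squeeze_zero_norm (fun τ => ?_) h3
    rw [← integral_sub (integrable_cont (hft τ) _) (integrable_cont (hft t) _)]
    refine int_bound (m τ) fun y => ?_
    exact ContinuousMap.dist_apply_le_dist (f := F τ) (g := F t) y
  have h4 := h2.add h1
  simp only [sub_add_cancel, zero_add] at h4
  exact h4

/-! ### Abstract Fokker-Planck data -/

structure FPD {d : ℕ} (m1 m2 : ℝ → PTd d) (b : ℝ → Td d → Vd d) (B : ℝ) : Prop where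
  c1 : W1ContOn m1 (Ici 0)
  c2 : W1ContOn m2 (Ici 0)
  B0 : 0 < B
  bc : ∀ τ, 0 ≤ τ → ∀ i, Continuous (fun y => b τ y i)
  bb : ∀ τ, 0 ≤ τ → ∀ y i, |b τ y i| ≤ B
  lim : ∃ (c : ℕ → ℝ → Td d → Vd d) (B' : ℝ), (∀ n i, Continuous (fun p : ℝ × Td d => c n p.1 p.2 i)) ∧
    (∀ n τ y i, |c n τ y i| ≤ B') ∧ ∀ τ, 0 ≤ τ → ∀ y i, Tendsto (fun n => c n τ y i) atTop (nhds (b τ y i))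
  fp1 : ∀ s₁ s₂, 0 ≤ s₁ → s₁ ≤ s₂ → FPeq 1 m1 b s₁ s₂
  fp2 : ∀ s₁ s₂, 0 ≤ s₁ → s₁ ≤ s₂ → FPeq 1 m2 b s₁ s₂

lemma meas_aux {d : ℕ} {m : ℝ → PTd d} (hm : W1ContOn m (Ici 0)) {b : ℝ → Td d → Vd d}
    (lim : ∃ (c : ℕ → ℝ → Td d → Vd d) (B' : ℝ), (∀ n i, Continuous (fun p : ℝ × Td d => c n p.1 p.2 i)) ∧
    (∀ n τ y i, |c n τ y i| ≤ B') ∧ ∀ τ, 0 ≤ τ → ∀ y i, Tendsto (fun n => c n τ y i) atTop (nhds (b τ y i)))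
    {A : ℝ → Td d → ℝ} (hA : Continuous (fun p : ℝ × Td d => A p.1 p.2)) {Φ : Fin d → ℝ → Td d → ℝ}
    (hΦ : ∀ i, Continuous (fun p : ℝ × Td d => Φ i p.1 p.2)) {s t : ℝ} (hs : 0 ≤ s) :
    AEStronglyMeasurable (fun τ => ∫ y, (A τ y - ∑ i, b τ y i * Φ i τ y) ∂(m τ : Measure (Td d))) (volume.restrict (Ioc s t)) := by
  obtain ⟨c, B', hc, hb, hl⟩ := lim
  have hsub : Ioc s t ⊆ Ici 0 := fun x hx => hs.trans hx.1.le
  refine aestronglyMeasurable_of_tendsto_ae atTop (f := fun n τ => ∫ y, (A τ y - ∑ i, c n τ y i * Φ i τ y) ∂(m τ : Measure (Td d))) (fun n => ?_) ?_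
  · refine ContinuousOn.aestronglyMeasurable ?_ measurableSet_Ioc
    refine (weak_cont2 hm (f := fun τ y => A τ y - ∑ i, c n τ y i * Φ i τ y) ?_).mono hsub
    exact hA.sub (continuous_finsetSum _ fun i _ => (hc n i).mul (hΦ i))
  · refine (ae_restrict_iff' measurableSet_Ioc).2 (ae_of_all _ fun τ hτ => ?_)
    have hAτ : Continuous (A τ) := hA.comp (Continuous.prodMk_right τ)
    have hΦτ : ∀ i, Continuous (Φ i τ) := fun i => (hΦ i).comp (Continuous.prodMk_right τ)
    have hcτ : ∀ n i, Continuous (fun y => c n τ y i) := fun n i => (hc n i).comp (Continuous.prodMk_right τ)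
    refine tendsto_integral_of_dominated_convergence (fun y => |A τ y| + ∑ i, B' * |Φ i τ y|) (fun n => ?_) ?_ (fun n => ?_) ?_
    · exact (hAτ.sub (continuous_finsetSum _ fun i _ => (hcτ n i).mul (hΦτ i))).aestronglyMeasurable
    · exact integrable_cont (hAτ.abs.add (continuous_finsetSum _ fun i _ => continuous_const.mul (hΦτ i).abs)) _
    · refine ae_of_all _ fun y => (norm_sub_le _ _).trans (add_le_add le_rfl ((norm_sum_le _ _).trans (Finset.sum_le_sum fun i _ => ?_)))
      rw [norm_mul]; exact mul_le_mul_of_nonneg_right (hb _ _ _ _) (abs_nonneg _)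
    · refine ae_of_all _ fun y => tendsto_const_nhds.sub (tendsto_finsetSum _ fun i _ => (hl τ (hsub hτ) y i).mul_const _)

lemma FPD.bdot {d : ℕ} {m1 m2 : ℝ → PTd d} {b : ℝ → Td d → Vd d} {B : ℝ} (h : FPD m1 m2 b B) {τ : ℝ} (hτ : 0 ≤ τ)
    {Φ : Fin d → Td d → ℝ} {q : Td d → ℝ} (hq : ∀ i y, |Φ i y| ≤ q y) (y : Td d) : |∑ i, b τ y i * Φ i y| ≤ d * B * q y := by
  calc _ ≤ ∑ i : Fin d, B * q y := (Finset.abs_sum_le_sum_abs _ _).trans (Finset.sum_le_sum fun i _ => by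
        rw [abs_mul]; exact mul_le_mul (h.bb τ hτ y i) (hq i y) (abs_nonneg _) h.B0.le)
    _ = _ := by simp; ring

lemma FPD.bdot_cont {d : ℕ} {m1 m2 : ℝ → PTd d} {b : ℝ → Td d → Vd d} {B : ℝ} (h : FPD m1 m2 b B) {τ : ℝ} (hτ : 0 ≤ τ)
    {Φ : Fin d → Td d → ℝ} (hΦ : ∀ i, Continuous (Φ i)) : Continuous (fun y => ∑ i, b τ y i * Φ i y) :=
  continuous_finsetSum _ fun i _ => (h.bc τ hτ i).mul (hΦ i)

lemma FPD.test {d : ℕ} {m1 m2 : ℝ → PTd d} {b : ℝ → Td d → Vd d} {B : ℝ} (h : FPD m1 m2 b B)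
    {φ : ℝ → Td d → ℝ} (hφ : IsTestFun (fun τ x => φ τ (tm x)))
    {A : ℝ → Td d → ℝ} (hA : Continuous (fun p : ℝ × Td d => A p.1 p.2)) {Φ : Fin d → ℝ → Td d → ℝ}
    (hΦ : ∀ i, Continuous (fun p : ℝ × Td d => Φ i p.1 p.2))
    (h1 : ∀ τ x, tderiv (fun τ x => φ τ (tm x)) τ x + lapl (fun x => φ τ (tm x)) x = A τ (tm x))
    (h2 : ∀ τ x, gradv (fun x => φ τ (tm x)) x = fun i => Φ i τ (tm x)) {s t : ℝ} (hs : 0 ≤ s) (hst : s ≤ t) :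
    IntervalIntegrable (fun τ => MM (m1 τ) (m2 τ) (fun y => A τ y - ∑ i, b τ y i * Φ i τ y)) volume s t ∧
    MM (m1 t) (m2 t) (φ t) - MM (m1 s) (m2 s) (φ s) = ∫ τ in s..t, MM (m1 τ) (m2 τ) (fun y => A τ y - ∑ i, b τ y i * Φ i τ y) := by
  have hsub : ∀ τ, τ ∈ Ioc s t → 0 ≤ τ := fun x hx => hs.trans hx.1.le
  -- bounds on the compact time interval
  have hbd : ∀ f : ℝ → Td d → ℝ, Continuous (fun p : ℝ × Td d => f p.1 p.2) → ∃ M, ∀ τ ∈ Ioc s t, ∀ y, |f τ y| ≤ M := by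
    intro f hf
    obtain ⟨M, hM⟩ := (isCompact_Icc (a := s) (b := t) |>.prod (isCompact_univ (X := Td d))).exists_bound_of_continuousOn hf.continuousOn
    exact ⟨M, fun τ hτ y => hM (τ, y) ⟨⟨hτ.1.le, hτ.2⟩, mem_univ _⟩⟩
  obtain ⟨MA, hMA⟩ := hbd A hA
  choose MP hMP using fun i => hbd (Φ i) (hΦ i)
  have key : ∀ {m : ℝ → PTd d}, W1ContOn m (Ici 0) → (∀ s₁ s₂, 0 ≤ s₁ → s₁ ≤ s₂ → FPeq 1 m b s₁ s₂) →
      IntervalIntegrable (fun τ => ∫ y, (A τ y - ∑ i, b τ y i * Φ i τ y) ∂(m τ : Measure (Td d))) volume s t ∧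
      (∫ y, φ t y ∂(m t : Measure (Td d))) - (∫ y, φ s y ∂(m s : Measure (Td d))) = ∫ τ in s..t, ∫ y, (A τ y - ∑ i, b τ y i * Φ i τ y) ∂(m τ : Measure (Td d)) := by
    intro m hm hfp
    constructor
    · rw [intervalIntegrable_iff_integrableOn_Ioc_of_le hst]
      refine Integrable.of_bound (meas_aux hm h.lim hA hΦ hs) (MA + ∑ i, B * MP i) ?_
      refine (ae_restrict_iff' measurableSet_Ioc).2 (ae_of_all _ fun τ hτ => ?_)
      refine int_bound (m τ) fun y => (abs_sub _ _).trans (add_le_add (hMA τ hτ y) ((Finset.abs_sum_le_sum_abs _ _).trans (Finset.sum_le_sum fun i _ => ?_)))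
      rw [abs_mul]; exact mul_le_mul (h.bb τ (hsub τ hτ) y i) (hMP i τ hτ y) (abs_nonneg _) h.B0.le
    · have := hfp s t hs hst _ hφ
      simp only [tm_secT, h2, one_mul, h1, dotp] at this
      exact this
  obtain ⟨i1, e1⟩ := key h.c1 h.fp1
  obtain ⟨i2, e2⟩ := key h.c2 h.fp2
  refine ⟨i1.sub i2, ?_⟩
  simp only [MM]
  rw [intervalIntegral.integral_sub i1 i2, ← e1, ← e2]; ring

/-! ### Duhamel formula -/

lemma FPD.duhamel_trig {d : ℕ} {m1 m2 : ℝ → PTd d} {b : ℝ → Td d → Vd d} {B : ℝ} (h : FPD m1 m2 b B)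
    (F : Finset (Fin d → ℤ)) (c : (Fin d → ℤ) → ℂ) {s t : ℝ} (hs : 0 ≤ s) (hst : s ≤ t) {β : ℝ → ℝ} (hβ : IntervalIntegrable β volume s t)
    (hb : ∀ τ, s < τ → τ < t → |MM (m1 τ) (m2 τ) (fun y => ∑ i, b τ y i * Qh i (t-τ) (Tsum F c) y)| ≤ β τ) :
    |MM (m1 t) (m2 t) (Tsum F c) - MM (m1 s) (m2 s) (Ph (t-s) (Tsum F c))| ≤ ∫ τ in s..t, β τ := by
  set e : (Fin d → ℤ) → ℝ → ℝ := fun k τ => Real.exp (-(lam k)*(t-τ)) with he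
  set cc : ℝ → (Fin d → ℤ) → ℂ := fun τ k => (e k τ : ℝ) * c k with hcc
  set φ : ℝ → Td d → ℝ := fun τ => Tsum F (cc τ) with hφ
  have φe : ∀ τ y, φ τ y = ∑ k ∈ F, e k τ * ch k (c k) y := fun τ y => Finset.sum_congr rfl fun k _ => (ch_smul _ _ _ _).symm
  set Φ : Fin d → ℝ → Td d → ℝ := fun i τ => Tsum F (fun k => 2*π*k i*Complex.I*cc τ k) with hΦ
  have Φe : ∀ i τ y, Φ i τ y = ∑ k ∈ F, e k τ * ch k (2*π*k i*Complex.I*c k) y := fun i τ y =>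
    Finset.sum_congr rfl fun k _ => by rw [ch_smul]; congr 1; simp only [hcc]; ring
  have hec : ∀ k, ContDiff ℝ 2 (e k) := fun k => by
    simp only [he]; fun_prop
  have htest : IsTestFun (fun τ x => φ τ (tm x)) := by
    refine ⟨?_, fun τ x z => by show φ τ (tm (x + intVec z)) = φ τ (tm x); rw [tm_per]⟩
    simp only [φe]
    refine ContDiff.sum fun k _ => ContDiff.mul ((hec k).comp contDiff_fst) ?_
    have := (ch_HasG k (c k)).c2 (fun j => ch_HasG k _)
    exact this.comp contDiff_snd
  have hΦc : ∀ i, Continuous (fun p : ℝ × Td d => Φ i p.1 p.2) := fun i => by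
    simp only [Φe]
    exact continuous_finsetSum _ fun k _ => ((hec k).continuous.comp continuous_fst).mul ((ch_cont k _).comp continuous_snd)
  have h1 : ∀ τ x, tderiv (fun τ x => φ τ (tm x)) τ x + lapl (fun x => φ τ (tm x)) x = 0 := by
    intro τ x
    have a1 : tderiv (fun τ x => φ τ (tm x)) τ x = ∑ k ∈ F, lam k * e k τ * ch k (c k) (tm x) := by
      simp only [tderiv, φe]
      refine HasDerivAt.deriv (HasDerivAt.fun_sum fun k _ => HasDerivAt.mul_const ?_ _)
      have : HasDerivAt (fun τ => -(lam k)*(t-τ)) (lam k) τ := by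
        have := ((hasDerivAt_id τ).const_sub t).const_mul (-(lam k))
        refine this.congr_deriv (by ring)
      refine this.exp.congr_deriv (by simp only [he]; ring)
    have a2 := (Tsum_HasG F (cc τ)).lp (fun j => Tsum_HasG F _) x
    rw [a1]
    refine (congrArg _ a2).trans ?_
    simp only [Tsum]
    rw [Finset.sum_comm, ← Finset.sum_add_distrib]
    refine Finset.sum_eq_zero fun k _ => ?_
    have : ∀ i, ch k (2*π*k i*Complex.I*(2*π*k i*Complex.I*cc τ k)) (tm x) = -(4*π^2*(k i:ℝ)^2) * (e k τ * ch k (c k) (tm x)) := by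
      intro i
      rw [ch_smul, ch_smul]; congr 1; simp only [hcc]; push_cast; ring_nf; rw [Complex.I_sq]; ring
    simp only [this, ← Finset.sum_mul, Finset.sum_neg_distrib, ← Finset.mul_sum, lam]; ring
  obtain ⟨hi, he'⟩ := h.test htest (A := fun _ _ => 0) continuous_const hΦc h1 (fun τ x => (Tsum_HasG F (cc τ)).gr x) hs hst
  have et : φ t = Tsum F c := Tsum_congr fun k => by simp [hcc, he]
  have es : φ s = Ph (t-s) (Tsum F c) := by rw [Ph_Tsum _ _ (by linarith)]
  rw [et, es] at he'
  rw [he']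
  refine intervalIntegral.norm_integral_le_of_norm_le (f := fun τ => MM (m1 τ) (m2 τ) fun y => 0 - ∑ i, b τ y i * Φ i τ y) hst ?_ hβ
  have hne : ∀ᵐ τ : ℝ, τ ≠ t := by simp [ae_iff, measure_singleton]
  filter_upwards [hne] with τ hτ hm
  have hlt : τ < t := lt_of_le_of_ne hm.2 hτ
  have e2 : ∀ i, Qh i (t-τ) (Tsum F c) = Φ i τ := fun i => by
    rw [Qh_Tsum _ _ _ (by linarith)]; exact Tsum_congr fun k => by simp only [hcc]; ring
  have := hb τ hm.1 hlt
  simp only [e2] at this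
  rw [Real.norm_eq_abs]
  have e3 : (fun y => 0 - ∑ i, b τ y i * Φ i τ y) = fun y => (-1) * ∑ i, b τ y i * Φ i τ y := by ext y; ring
  rw [e3, MM_smul]
  simpa using this

lemma isq_int (t : ℝ) : IntervalIntegrable (fun τ : ℝ => (√τ)⁻¹) volume 0 t := by
  have := intervalIntegral.intervalIntegrable_rpow' (a := 0) (b := t) (r := -(1/2:ℝ)) (by norm_num)
  rcases le_total 0 t with ht | ht
  · refine this.congr_ae ?_
    refine (ae_restrict_iff' measurableSet_uIoc).2 (ae_of_all _ fun τ hτ => ?_)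
    rw [uIoc_of_le ht] at hτ
    simp only []
    rw [Real.rpow_neg hτ.1.le, ← Real.sqrt_eq_rpow]
  · refine (intervalIntegrable_const (c := (0:ℝ))).congr_ae ?_
    refine (ae_restrict_iff' measurableSet_uIoc).2 (ae_of_all _ fun τ hτ => ?_)
    rw [uIoc_of_ge ht] at hτ
    simp only []
    rw [Real.sqrt_eq_zero_of_nonpos hτ.2, inv_zero]

lemma isq_val {t : ℝ} (ht : 0 ≤ t) : ∫ τ in (0:ℝ)..t, (√τ)⁻¹ = 2 * √t := by
  have e : ∫ τ in (0:ℝ)..t, (√τ)⁻¹ = ∫ τ in (0:ℝ)..t, τ ^ (-(1/2:ℝ)) := by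
    refine intervalIntegral.integral_congr fun τ hτ => ?_
    rw [uIcc_of_le ht] at hτ
    show (√τ)⁻¹ = τ ^ (-(1/2:ℝ))
    rw [Real.rpow_neg hτ.1, ← Real.sqrt_eq_rpow]
  rw [e, integral_rpow (Or.inl (by norm_num))]
  rw [show -(1/2:ℝ)+1 = 1/2 by norm_num, Real.zero_rpow (by norm_num), ← Real.sqrt_eq_rpow]; ring

lemma isq_int' (s t : ℝ) : IntervalIntegrable (fun τ : ℝ => (√(t-τ))⁻¹) volume s t := by
  have := ((isq_int (t-s)).comp_sub_left t).symm
  simpa using this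

lemma isq_val' {s t : ℝ} (ht : s ≤ t) : ∫ τ in s..t, (√(t-τ))⁻¹ = 2 * √(t-s) := by
  rw [intervalIntegral.integral_comp_sub_left (fun x => (√x)⁻¹) t]
  rw [sub_self]; exact isq_val (by linarith)

lemma FPD.duhamel {d : ℕ} {m1 m2 : ℝ → PTd d} {b : ℝ → Td d → Vd d} {B : ℝ} (h : FPD m1 m2 b B)
    {g : Td d → ℝ} (hg : Continuous g) {s t : ℝ} (hs : 0 ≤ s) (hst : s ≤ t) {β : ℝ → ℝ} (hβ : IntervalIntegrable β volume s t)
    (hb : ∀ τ, s < τ → τ < t → |MM (m1 τ) (m2 τ) (fun y => ∑ i, b τ y i * Qh i (t-τ) g y)| ≤ β τ) :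
    |MM (m1 t) (m2 t) g - MM (m1 s) (m2 s) (Ph (t-s) g)| ≤ ∫ τ in s..t, β τ := by
  set C : ℝ := 2 * (d * B * ((√2)⁻¹ * √2^d)) with hC
  have hC0 : 0 ≤ C := by have := h.B0; positivity
  refine le_of_forall_pos_le_add fun ε' hε' => ?_
  set I := ∫ τ in s..t, (√(t-τ))⁻¹ with hI
  have hI0 : 0 ≤ I := intervalIntegral.integral_nonneg hst fun τ _ => by positivity
  obtain ⟨ε, hε, hε2⟩ : ∃ ε > 0, (C * I + 4) * ε ≤ ε' := by
    refine ⟨ε' / (C*I+4), by positivity, ?_⟩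
    rw [mul_div_cancel₀]; positivity
  obtain ⟨F, c, hF⟩ := trig_dense hg hε
  have hT := Tsum_cont F c
  have key := h.duhamel_trig F c hs hst (β := fun τ => β τ + C * ε * (√(t-τ))⁻¹) (hβ.add ((isq_int' s t).const_mul _)) (fun τ h1 h2 => by
    have h0 : 0 ≤ τ := hs.trans h1.le
    have a1 := hb τ h1 h2
    have c1 := h.bdot_cont h0 (Φ := fun i => Qh i (t-τ) g) fun i => Qh_cont hg i _
    have c2 := h.bdot_cont h0 (Φ := fun i => Qh i (t-τ) (Tsum F c)) fun i => Qh_cont hT i _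
    have a2 : |MM (m1 τ) (m2 τ) (fun y => (∑ i, b τ y i * Qh i (t-τ) g y) - ∑ i, b τ y i * Qh i (t-τ) (Tsum F c) y)| ≤ 2 * (d * B * ((√(2*(t-τ)))⁻¹ * √2^d * ε)) := by
      refine MM_bound _ _ fun y => ?_
      rw [← Finset.sum_sub_distrib]
      simp only [← mul_sub]
      exact h.bdot h0 (Φ := fun i y => Qh i (t-τ) g y - Qh i (t-τ) (Tsum F c) y) (q := fun _ => (√(2*(t-τ)))⁻¹ * √2^d * ε) (fun i y => Qh_diff hg hT i _ hF y) y
    rw [MM_sub _ _ c1 c2] at a2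
    have a3 : 2 * (d * B * ((√(2*(t-τ)))⁻¹ * √2^d * ε)) = C * ε * (√(t-τ))⁻¹ := by
      rw [Real.sqrt_mul (by norm_num), mul_inv, hC]; ring
    rw [a3] at a2
    have := abs_sub_abs_le_abs_sub (MM (m1 τ) (m2 τ) (fun y => ∑ i, b τ y i * Qh i (t-τ) (Tsum F c) y)) (MM (m1 τ) (m2 τ) (fun y => ∑ i, b τ y i * Qh i (t-τ) g y))
    rw [abs_sub_comm] at this
    linarith)
  rw [intervalIntegral.integral_add hβ ((isq_int' s t).const_mul _), intervalIntegral.integral_const_mul] at key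
  have b1 := MM_bound (m1 t) (m2 t) hF
  rw [MM_sub _ _ hg hT] at b1
  have b2 := MM_bound (m1 s) (m2 s) (Ph_diff hg hT (t-s) hF)
  rw [MM_sub _ _ (Ph_cont hg _) (Ph_cont hT _)] at b2
  rw [abs_le] at *
  constructor <;> nlinarith [key.1, key.2, b1.1, b1.2, b2.1, b2.2]

/-! ### Short time estimate -/

lemma ker_split {t τ : ℝ} (h0 : 0 < τ) (h1 : τ < t) : (√(t-τ))⁻¹ * (√τ)⁻¹ ≤ √2 * (√t)⁻¹ * ((√τ)⁻¹ + (√(t-τ))⁻¹) := by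
  have ht : 0 < t := h0.trans h1
  have h2 : 0 < t - τ := by linarith
  have a1 : (√2)⁻¹ * √t = √(t/2) := by rw [Real.sqrt_div ht.le]; ring
  have e : √2 * (√t)⁻¹ = (√(t/2))⁻¹ := by rw [← a1, mul_inv, inv_inv]
  rw [e]
  have p1 : 0 < √(t/2) := Real.sqrt_pos.2 (by linarith)
  have p2 : 0 < √τ := Real.sqrt_pos.2 h0
  have p3 : 0 < √(t-τ) := Real.sqrt_pos.2 h2
  rcases le_total (t/2) τ with h | h
  · have : (√τ)⁻¹ ≤ (√(t/2))⁻¹ := inv_anti₀ p1 (Real.sqrt_le_sqrt h)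
    calc (√(t-τ))⁻¹ * (√τ)⁻¹ ≤ (√(t-τ))⁻¹ * (√(t/2))⁻¹ := by gcongr
      _ ≤ _ := by rw [mul_comm]; gcongr; linarith [inv_pos.2 p2]
  · have : (√(t-τ))⁻¹ ≤ (√(t/2))⁻¹ := inv_anti₀ p1 (Real.sqrt_le_sqrt (by linarith))
    calc (√(t-τ))⁻¹ * (√τ)⁻¹ ≤ (√(t/2))⁻¹ * (√τ)⁻¹ := by gcongr
      _ ≤ _ := by gcongr; linarith [inv_pos.2 p3]

def Ad (d : ℕ) : ℝ := d * √2^d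

lemma Ad_nonneg (d : ℕ) : 0 ≤ Ad d := by unfold Ad; positivity

def VP {d : ℕ} (m1 m2 : ℝ → PTd d) (s0 σ : ℝ) (h : Td d → ℝ) (Λ : ℝ) : Prop :=
  ∀ t, 0 < t → t ≤ σ → ∀ (g : Td d → ℝ) (c : ℝ), Continuous g → 0 ≤ c → (∀ y, |g y| ≤ c * Ph (2*(σ-t)) h y) →
    |MM (m1 (s0+t)) (m2 (s0+t)) g| ≤ c * Λ * (√t)⁻¹

lemma FPD.vstep {d : ℕ} {m1 m2 : ℝ → PTd d} {b : ℝ → Td d → Vd d} {B : ℝ} (D : FPD m1 m2 b B) {s0 σ : ℝ} (hs0 : 0 ≤ s0)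
    (hσ : √σ * (8 * (Ad d * B)) ≤ 1) {h : Td d → ℝ} (hh : Continuous h) {H : ℝ} (hH : ∀ y, Ph (2*σ) h y ≤ H) {Λ : ℝ} (hΛ : 0 ≤ Λ)
    (hP : VP m1 m2 s0 σ h Λ) : VP m1 m2 s0 σ h (Ad d * H * W1 (m1 s0) (m2 s0) + Λ / 2) := by
  intro t ht htσ g c hg hc hgc
  have hB := D.B0
  have hst : 0 < √t := Real.sqrt_pos.2 ht
  have hst' : √t ≤ √σ := Real.sqrt_le_sqrt htσ
  -- domination of Q
  have hdom : ∀ r, 0 < r → ∀ i y, |Qh i r g y| ≤ c * (√(2*r))⁻¹ * √2^d * Ph (2*(σ-t+r)) h y := by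
    intro r hr i y
    have a1 := Qh_dom (h := fun y => c * Ph (2*(σ-t)) h y) hg (continuous_const.mul (Ph_cont hh _)) hgc i r y
    rw [Ph_smul, Ph_Ph hh (by linarith) (by linarith), show 2*r + 2*(σ-t) = 2*(σ-t+r) by ring] at a1
    refine a1.trans (le_of_eq (by ring))
  have hsq : ∀ r : ℝ, (√(2*r))⁻¹ = (√2)⁻¹ * (√r)⁻¹ := fun r => by rw [Real.sqrt_mul (by norm_num), mul_inv]
  have h2inv : (√2)⁻¹ ≤ (1:ℝ) := inv_le_one_of_one_le₀ (by rw [Real.one_le_sqrt]; norm_num)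
  -- initial term
  have hinit : |MM (m1 s0) (m2 s0) (Ph (s0+t-s0) g)| ≤ c * (Ad d * H * W1 (m1 s0) (m2 s0)) * (√t)⁻¹ := by
    rw [add_sub_cancel_left]
    have hW := W1_nonneg (m1 s0) (m2 s0)
    have hCb : ∀ i y, |Qh i t g y| ≤ c * (√(2*t))⁻¹ * √2^d * H := fun i y => by
      have := hdom t ht i y
      rw [sub_add_cancel] at this
      exact this.trans (mul_le_mul_of_nonneg_left (hH y) (by positivity))
    rcases Nat.eq_zero_or_pos d with hd | hd
    · subst hd
      have hc0 : Ph t g = fun _ => Ph t g 0 := by ext y; rw [Subsingleton.elim y 0]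
      rw [hc0, MM_const]; simp [Ad]
    have hC0 : 0 ≤ c * (√(2*t))⁻¹ * √2^d * H := (abs_nonneg _).trans (hCb ⟨0, hd⟩ 0)
    have hlip := (Ph_HasG hg ht).lip hC0 hCb
    refine (MM_lip _ _ (by positivity) hlip).trans ?_
    rw [hsq]
    have hcH : 0 ≤ c * H := by
      have : 0 < (√(2*t))⁻¹ * √2^d := by positivity
      by_contra hneg
      push Not at hneg
      nlinarith
    have e1 : d * (c * ((√2)⁻¹ * (√t)⁻¹) * √2^d * H) * W1 (m1 s0) (m2 s0) = (√2)⁻¹ * (c * H * (d * √2^d * W1 (m1 s0) (m2 s0) * (√t)⁻¹)) := by ring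
    rw [e1]
    refine (mul_le_of_le_one_left (by positivity) h2inv).trans (le_of_eq (by unfold Ad; ring))
  -- Duhamel
  set C := c * Λ * (Ad d * B) * (√2)⁻¹ with hC
  have hA := Ad_nonneg d
  have hC0 : 0 ≤ C := by positivity
  set β : ℝ → ℝ := fun τ => C * (√2 * (√t)⁻¹ * ((√(τ-s0))⁻¹ + (√(s0+t-τ))⁻¹)) with hβ
  have i1 : IntervalIntegrable (fun τ => (√(τ-s0))⁻¹) volume s0 (s0+t) := by
    have := (isq_int t).comp_sub_right s0
    simpa [add_comm] using this
  have v1 : ∫ τ in s0..(s0+t), (√(τ-s0))⁻¹ = 2 * √t := by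
    rw [intervalIntegral.integral_comp_sub_right (fun x => (√x)⁻¹) s0]
    simpa using isq_val ht.le
  have i2 := isq_int' s0 (s0+t)
  have v2 := isq_val' (s := s0) (t := s0+t) (by linarith)
  rw [add_sub_cancel_left] at v2
  have hbd := D.duhamel hg hs0 (by linarith : s0 ≤ s0+t) (β := β) (((i1.add i2).const_mul _).const_mul _) (fun τ h1 h2 => by
    have e : τ = s0 + (τ - s0) := by ring
    have h0 : 0 ≤ τ := hs0.trans h1.le
    have := hP (τ-s0) (by linarith) (by linarith) (fun y => ∑ i, b τ y i * Qh i (s0+t-τ) g y) (d * B * (c * (√(2*(s0+t-τ)))⁻¹ * √2^d))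
      (D.bdot_cont h0 fun i => Qh_cont hg i _) (by positivity) (fun y => by
        have := D.bdot h0 (hdom (s0+t-τ) (by linarith)) y
        rw [show σ - t + (s0+t-τ) = σ - (τ-s0) by ring] at this
        refine this.trans (le_of_eq (by ring)))
    rw [← e] at this
    refine this.trans ?_
    have hk := ker_split (t := t) (τ := τ - s0) (by linarith) (by linarith)
    rw [show t - (τ-s0) = s0+t-τ by ring] at hk
    rw [hsq, hβ, hC]
    have := mul_le_mul_of_nonneg_left hk hC0
    rw [hC] at this
    refine le_trans (le_of_eq ?_) this
    unfold Ad; ring)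
  rw [hβ, intervalIntegral.integral_const_mul, intervalIntegral.integral_const_mul, intervalIntegral.integral_add i1 i2, v1, v2] at hbd
  have hfin : C * (√2 * (√t)⁻¹ * (2 * √t + 2 * √t)) ≤ c * (Λ/2) * (√t)⁻¹ := by
    have e1 : C * (√2 * (√t)⁻¹ * (2 * √t + 2 * √t)) = c * Λ * (4 * (Ad d * B)) := by
      rw [hC]; field_simp; ring
    rw [e1, le_mul_inv_iff₀ hst]
    have : √t * (8 * (Ad d * B)) ≤ 1 := le_trans (mul_le_mul_of_nonneg_right hst' (by positivity)) hσ
    nlinarith [mul_nonneg hc hΛ]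
  have := abs_sub_abs_le_abs_sub (MM (m1 (s0+t)) (m2 (s0+t)) g) (MM (m1 s0) (m2 s0) (Ph (s0+t-s0) g))
  calc _ ≤ c * (Ad d * H * W1 (m1 s0) (m2 s0)) * (√t)⁻¹ + c * (Λ/2) * (√t)⁻¹ := by linarith
    _ = _ := by ring

lemma FPD.short {d : ℕ} {m1 m2 : ℝ → PTd d} {b : ℝ → Td d → Vd d} {B : ℝ} (D : FPD m1 m2 b B) {s0 σ : ℝ} (hs0 : 0 ≤ s0) (hσ0 : 0 < σ)
    (hσ : √σ * (8 * (Ad d * B)) ≤ 1) {g : Td d → ℝ} (hg : Continuous g) :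
    |MM (m1 (s0+σ)) (m2 (s0+σ)) g| ≤ 2 * Ad d * Charn d (2*σ) * (√σ)⁻¹ * W1 (m1 s0) (m2 s0) * ∫ y, |g y| := by
  set H := Charn d (2*σ) * ∫ y, |g y| with hH
  have hW := W1_nonneg (m1 s0) (m2 s0)
  have hh : Continuous (fun y => |g y|) := hg.abs
  have hI : 0 ≤ ∫ y, |g y| := integral_nonneg fun y => abs_nonneg _
  have hH0 : 0 ≤ H := mul_nonneg (Charn_pos _ _).le hI
  have hHb : ∀ y, Ph (2*σ) (fun y => |g y|) y ≤ H := Ph_L1 hh (fun y => abs_nonneg _) (by positivity)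
  obtain ⟨M, hM0, hM⟩ := bdd_of_cont hg
  have hA := Ad_nonneg d
  set X := Ad d * H * W1 (m1 s0) (m2 s0) with hX
  have hX0 : 0 ≤ X := by positivity
  have hn : ∀ n : ℕ, VP m1 m2 s0 σ (fun y => |g y|) (2 * X + (2 * M * √σ) * (1/2)^n) := by
    intro n
    induction n with
    | zero =>
      intro t ht htσ f c hf hc hfc
      have : ∀ y, |f y| ≤ c * M := fun y => (hfc y).trans (mul_le_mul_of_nonneg_left
        ((le_abs_self _).trans (Ph_bound hh (fun y => by rw [abs_abs]; exact hM y) _ y)) hc)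
      refine (MM_bound _ _ this).trans ?_
      rw [le_mul_inv_iff₀ (Real.sqrt_pos.2 ht)]
      have : √t ≤ √σ := Real.sqrt_le_sqrt htσ
      have hcM : 0 ≤ c * M := by positivity
      have hcX : 0 ≤ c * X := by positivity
      simp only [pow_zero]
      nlinarith
    | succ n ih =>
      have := D.vstep hs0 hσ hh hHb (by positivity) ih
      rw [← hX] at this
      convert this using 1
      ring
  have hg1 : ∀ n : ℕ, |MM (m1 (s0+σ)) (m2 (s0+σ)) g| ≤ 1 * (2 * X + (2 * M * √σ) * (1/2)^n) * (√σ)⁻¹ := fun n =>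
    hn n σ hσ0 le_rfl g 1 hg zero_le_one (fun y => by rw [sub_self, mul_zero, Ph_zero, one_mul])
  have hl : Tendsto (fun n : ℕ => 1 * (2 * X + (2 * M * √σ) * (1/2)^n) * (√σ)⁻¹) atTop (nhds (1 * (2 * X + (2 * M * √σ) * 0) * (√σ)⁻¹)) :=
    (((tendsto_pow_atTop_nhds_zero_of_lt_one (by norm_num) (by norm_num)).const_mul _).const_add _ |>.const_mul _).mul_const _
  refine (ge_of_tendsto' hl hg1).trans (le_of_eq ?_)
  rw [hX, hH]; ring

/-! ### Densities -/

lemma sup_of_L1 {d : ℕ} {w : Td d → ℝ} (hw : Continuous w) {K : ℝ} (hK : ∀ g : Td d → ℝ, Continuous g → |∫ y, w y * g y| ≤ K * ∫ y, |g y|) (y : Td d) :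
    |w y| ≤ K := by
  have key : ∀ v : Td d → ℝ, Continuous v → (∀ g : Td d → ℝ, Continuous g → |∫ y, v y * g y| ≤ K * ∫ y, |g y|) → ∀ y, v y ≤ K := by
    intro v hv hK y
    set g : Td d → ℝ := fun y => max (v y - K) 0 with hg
    have hgc : Continuous g := (hv.sub continuous_const).max continuous_const
    have h1 := (le_abs_self _).trans (hK g hgc)
    have h2 : ∀ y, |g y| = g y := fun y => abs_of_nonneg (le_max_right _ _)
    simp only [h2] at h1
    rw [← integral_const_mul] at h1
    have h3 : ∫ y, g y ^ 2 ≤ 0 := by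
      have e : ∀ y, g y ^ 2 = v y * g y - K * g y := fun y => by
        simp only [hg]
        rcases le_total (v y - K) 0 with h | h
        · rw [max_eq_right h]; ring
        · rw [max_eq_left h]; ring
      simp only [e]
      rw [integral_sub (integrable_cont (hv.fun_mul hgc) _) (integrable_cont (continuous_const.fun_mul hgc) _)]
      linarith
    have h4 : ∫ y, g y ^ 2 = 0 := le_antisymm h3 (integral_nonneg fun y => sq_nonneg _)
    have h5 := (integral_eq_zero_iff_of_nonneg (fun y => sq_nonneg (g y)) (integrable_cont (hgc.pow 2) (volume : Measure (Td d)))).1 h4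
    replace h5 := (Continuous.ae_eq_iff_eq (volume : Measure (Td d)) (hgc.pow 2) continuous_const).1 h5
    have h6 : g y ^ 2 = 0 := congrFun h5 y
    have h7 : g y = 0 := by simpa using h6
    have : v y - K ≤ g y := le_max_left _ _
    linarith
  rw [abs_le]
  refine ⟨?_, key w hw hK y⟩
  have := key (fun y => - w y) hw.neg (fun g hg => by
    simp only [neg_mul, integral_neg, abs_neg]; exact hK g hg) y
  linarith

structure Dens {d : ℕ} (m1 m2 : ℝ → PTd d) (ρ : ℝ → Td d → ℝ) : Prop where
  c : ∀ τ, 0 < τ → Continuous (ρ τ)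
  e : ∀ τ, 0 < τ → ∀ f : Td d → ℝ, Continuous f → MM (m1 τ) (m2 τ) f = ∫ y, ρ τ y * f y

def sig0 (d : ℕ) (B : ℝ) : ℝ := (1 / (8 * (Ad d * B) + 1))^2

lemma sig0_pos (d : ℕ) {B : ℝ} (hB : 0 < B) : 0 < sig0 d B := by
  have := Ad_nonneg d; unfold sig0; positivity

lemma sig0_le (d : ℕ) {B : ℝ} (hB : 0 < B) {σ : ℝ} (h : σ ≤ sig0 d B) : √σ * (8 * (Ad d * B)) ≤ 1 := by
  have hA := Ad_nonneg d
  have h1 : √σ ≤ 1 / (8 * (Ad d * B) + 1) := by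
    refine (Real.sqrt_le_sqrt h).trans (le_of_eq ?_)
    rw [sig0, Real.sqrt_sq (by positivity)]
  calc √σ * (8 * (Ad d * B)) ≤ 1 / (8 * (Ad d * B) + 1) * (8 * (Ad d * B)) := mul_le_mul_of_nonneg_right h1 (by positivity)
    _ ≤ 1 := by rw [one_div, inv_mul_le_iff₀ (by positivity)]; linarith

lemma FPD.rho_bdd {d : ℕ} {m1 m2 : ℝ → PTd d} {b : ℝ → Td d → Vd d} {B : ℝ} (D : FPD m1 m2 b B) {ρ : ℝ → Td d → ℝ} (E : Dens m1 m2 ρ)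
    {t1 : ℝ} (ht1 : 0 < t1) : ∃ R, 0 ≤ R ∧ ∀ τ, t1 ≤ τ → ∀ y, |ρ τ y| ≤ R := by
  set σ := min t1 (sig0 d B) with hσ
  have hσ0 : 0 < σ := lt_min ht1 (sig0_pos d D.B0)
  have hA := Ad_nonneg d
  set C := 2 * Ad d * Charn d (2*σ) * (√σ)⁻¹ with hC
  have hC0 : 0 ≤ C := by have := Charn_pos d (2*σ); positivity
  refine ⟨C * (2 * Metric.diam (univ : Set (Td d))), by have := Metric.diam_nonneg (s := (univ : Set (Td d))); positivity, fun τ hτ => ?_⟩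
  refine sup_of_L1 (E.c τ (ht1.trans_le hτ)) fun g hg => ?_
  rw [← E.e τ (ht1.trans_le hτ) g hg]
  have h1 : σ ≤ t1 := min_le_left _ _
  have := D.short (s0 := τ - σ) (by linarith) hσ0 (sig0_le d D.B0 (min_le_right _ _)) hg
  rw [sub_add_cancel] at this
  refine this.trans (mul_le_mul_of_nonneg_right (mul_le_mul_of_nonneg_left ?_ hC0) (integral_nonneg fun y => abs_nonneg _))
  exact W1_le _ _ fun φ hφ => MM_lip_bdd _ _ hφ

/-! ### Static test functions -/

def Ls {d : ℕ} (r : ℝ) (F : Td d → ℝ) (y : Td d) : ℝ := ∑ i, Qh i (r/2) (Qh i (r/2) F) y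

lemma Ls_cont {d : ℕ} {F : Td d → ℝ} (hF : Continuous F) (r : ℝ) : Continuous (Ls r F) :=
  continuous_finsetSum _ fun i _ => Qh_cont (Qh_cont hF _ _) _ _

def qq (d : ℕ) (r : ℝ) : ℝ := (√(2*r))⁻¹ * √2^d

lemma qq_nonneg (d : ℕ) (r : ℝ) : 0 ≤ qq d r := by unfold qq; positivity

def Cst (d : ℕ) (B r : ℝ) : ℝ := d * (qq d (r/2) * qq d (r/2)) + d * B * qq d r

lemma Cst_nonneg (d : ℕ) {B : ℝ} (hB : 0 < B) (r : ℝ) : 0 ≤ Cst d B r := by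
  have := qq_nonneg d r; have := qq_nonneg d (r/2); unfold Cst; positivity

lemma Ls_bound {d : ℕ} {F : Td d → ℝ} (hF : Continuous F) {M : ℝ} (hM : ∀ y, |F y| ≤ M) (r : ℝ) (y : Td d) :
    |Ls r F y| ≤ d * (qq d (r/2) * qq d (r/2)) * M := by
  refine (Finset.abs_sum_le_sum_abs _ _).trans ?_
  refine (Finset.sum_le_sum fun i _ => Qh_bound (Qh_cont hF i _) (fun y => Qh_bound hF hM i _ y) i _ y).trans (le_of_eq ?_)
  simp [qq]; ring

lemma Ls_sub {d : ℕ} {F G : Td d → ℝ} (hF : Continuous F) (hG : Continuous G) (r : ℝ) (y : Td d) :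
    Ls r (fun y => F y - G y) y = Ls r F y - Ls r G y := by
  simp only [Ls]
  rw [← Finset.sum_sub_distrib]
  refine Finset.sum_congr rfl fun i _ => ?_
  rw [← Qh_sub (Qh_cont hF _ _) (Qh_cont hG _ _)]
  congr 1; ext y; exact Qh_sub hF hG i _ y

def TT {d : ℕ} (b : Td d → Vd d) (r : ℝ) (F : Td d → ℝ) (y : Td d) : ℝ := Ls r F y - ∑ i, b y i * Qh i r F y

lemma FPD.TT_bound {d : ℕ} {m1 m2 : ℝ → PTd d} {b : ℝ → Td d → Vd d} {B : ℝ} (D : FPD m1 m2 b B) {τ : ℝ} (hτ : 0 ≤ τ) {F : Td d → ℝ}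
    (hF : Continuous F) {M : ℝ} (hM : ∀ y, |F y| ≤ M) (r : ℝ) (y : Td d) : |TT (b τ) r F y| ≤ Cst d B r * M := by
  have h1 := Ls_bound hF hM r y
  have h2 := D.bdot hτ (Φ := fun i => Qh i r F) (q := fun _ => qq d r * M) (fun i y => Qh_bound hF hM i r y) y
  refine (abs_sub _ _).trans ?_
  rw [Cst, add_mul]; linarith

lemma FPD.TT_cont {d : ℕ} {m1 m2 : ℝ → PTd d} {b : ℝ → Td d → Vd d} {B : ℝ} (D : FPD m1 m2 b B) {τ : ℝ} (hτ : 0 ≤ τ) {F : Td d → ℝ}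
    (hF : Continuous F) (r : ℝ) : Continuous (TT (b τ) r F) :=
  (Ls_cont hF r).sub (D.bdot_cont hτ fun i => Qh_cont hF i r)

lemma TT_sub {d : ℕ} (b : Td d → Vd d) {F G : Td d → ℝ} (hF : Continuous F) (hG : Continuous G) (r : ℝ) (y : Td d) :
    TT b r (fun y => F y - G y) y = TT b r F y - TT b r G y := by
  simp only [TT, Ls_sub hF hG, Qh_sub hF hG, mul_sub, Finset.sum_sub_distrib]; ring

lemma FPD.static {d : ℕ} {m1 m2 : ℝ → PTd d} {b : ℝ → Td d → Vd d} {B : ℝ} (D : FPD m1 m2 b B) {r : ℝ} (hr : 0 < r) {F : Td d → ℝ}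
    (hF : Continuous F) {s t : ℝ} (hs : 0 ≤ s) (hst : s ≤ t) :
    IntervalIntegrable (fun τ => MM (m1 τ) (m2 τ) (TT (b τ) r F)) volume s t ∧
    MM (m1 t) (m2 t) (Ph r F) - MM (m1 s) (m2 s) (Ph r F) = ∫ τ in s..t, MM (m1 τ) (m2 τ) (TT (b τ) r F) := by
  have h1 := Ph_HasG hF hr
  have h2 := fun j => Qh_HasG hF hr j
  refine D.test (φ := fun _ => Ph r F) (A := fun _ => Ls r F) (Φ := fun i _ => Qh i r F) ?_ ((Ls_cont hF r).comp continuous_snd)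
    (fun i => (Qh_cont hF i r).comp continuous_snd) (fun τ x => ?_) (fun τ x => h1.gr x) hs hst
  · refine ⟨(h1.c2 h2).comp contDiff_snd, fun t x z => ?_⟩
    show Ph r F (tm (x + intVec z)) = Ph r F (tm x)
    rw [tm_per]
  · rw [h1.lp h2]
    simp [tderiv, Ls]

lemma FPD.static_bound {d : ℕ} {m1 m2 : ℝ → PTd d} {b : ℝ → Td d → Vd d} {B : ℝ} (D : FPD m1 m2 b B) {r : ℝ} (hr : 0 < r) {F : Td d → ℝ}
    (hF : Continuous F) {M : ℝ} (hM : ∀ y, |F y| ≤ M) {s t : ℝ} (hs : 0 ≤ s) (hst : s ≤ t) :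
    |MM (m1 t) (m2 t) (Ph r F) - MM (m1 s) (m2 s) (Ph r F)| ≤ 2 * (Cst d B r * M) * |t - s| := by
  rw [(D.static hr hF hs hst).2]
  refine intervalIntegral.norm_integral_le_of_norm_le_const (f := fun τ => MM (m1 τ) (m2 τ) (TT (b τ) r F)) fun τ hτ => ?_
  rw [uIoc_of_le hst] at hτ
  exact MM_bound _ _ fun y => D.TT_bound (hs.trans hτ.1.le) hF hM r y

def Ca (d : ℕ) (B r : ℝ) : ℝ := 2 * (Cst d B (r/2) * Charn d (r/2))

lemma Ca_nonneg (d : ℕ) {B : ℝ} (hB : 0 < B) (r : ℝ) : 0 ≤ Ca d B r := by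
  have := Cst_nonneg d hB (r/2); have := Charn_pos d (r/2); unfold Ca; positivity

lemma FPD.a_lip {d : ℕ} {m1 m2 : ℝ → PTd d} {b : ℝ → Td d → Vd d} {B : ℝ} (D : FPD m1 m2 b B) {ρ : ℝ → Td d → ℝ} (E : Dens m1 m2 ρ)
    {r : ℝ} (hr : 0 < r) {s t : ℝ} (hs : 0 < s) (hst : s ≤ t) (y : Td d) : |Ph r (ρ t) y - Ph r (ρ s) y| ≤ Ca d B r * |t - s| := by
  have ht : 0 < t := hs.trans_le hst
  refine sup_of_L1 (w := fun y => Ph r (ρ t) y - Ph r (ρ s) y) ((Ph_cont (E.c t ht) _).sub (Ph_cont (E.c s hs) _)) (fun g hg => ?_) y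
  have e1 : ∫ y, (Ph r (ρ t) y - Ph r (ρ s) y) * g y = MM (m1 t) (m2 t) (Ph r g) - MM (m1 s) (m2 s) (Ph r g) := by
    rw [E.e t ht _ (Ph_cont hg _), E.e s hs _ (Ph_cont hg _), Ph_adj (E.c t ht) hg, Ph_adj (E.c s hs) hg]
    simp only [sub_mul]
    rw [integral_sub (integrable_cont ((Ph_cont (E.c t ht) _).fun_mul hg) _) (integrable_cont ((Ph_cont (E.c s hs) _).fun_mul hg) _)]
    simp only [mul_comm]
  have e2 : Ph r g = Ph (r/2) (Ph (r/2) g) := by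
    ext y; rw [Ph_Ph hg (by positivity) (by positivity)]; congr 1; ring
  rw [e1, e2]
  have hb : ∀ y, |Ph (r/2) g y| ≤ Charn d (r/2) * ∫ y, |g y| := fun y =>
    (Ph_abs_le hg hg.abs (fun y => le_rfl) _ y).trans (Ph_L1 hg.abs (fun y => abs_nonneg _) (by positivity) y)
  refine (D.static_bound (by positivity) (Ph_cont hg _) hb hs.le hst).trans (le_of_eq ?_)
  unfold Ca; ring

lemma quad_mono {X : ℝ → ℝ} {t1 t2 C : ℝ} (h12 : t1 ≤ t2) (h : ∀ s t, t1 ≤ s → s ≤ t → t ≤ t2 → X t - X s ≤ C * (t-s)^2) : X t2 ≤ X t1 := by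
  have key : ∀ n : ℕ, X t2 - X t1 ≤ C * (t2-t1)^2 * (1/((n:ℝ)+1)) := by
    intro n
    set p : ℕ → ℝ := fun k => t1 + k * ((t2-t1)/((n:ℝ)+1)) with hp
    have hn : (0:ℝ) < n + 1 := by positivity
    have hst : 0 ≤ (t2-t1)/((n:ℝ)+1) := div_nonneg (by linarith) hn.le
    have e0 : p 0 = t1 := by simp [hp]
    have e1 : p (n+1) = t2 := by simp only [hp]; push_cast; field_simp; ring
    have hsum := Finset.sum_range_sub (fun k => X (p k)) (n+1)
    rw [e0, e1] at hsum
    rw [← hsum]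
    have : ∀ k ∈ Finset.range (n+1), X (p (k+1)) - X (p k) ≤ C * ((t2-t1)/((n:ℝ)+1))^2 := by
      intro k hk
      have hk' : (k:ℝ) + 1 ≤ n + 1 := by
        have := Finset.mem_range.1 hk
        exact_mod_cast this
      have a1 : p (k+1) - p k = (t2-t1)/((n:ℝ)+1) := by simp only [hp]; push_cast; ring
      rw [← a1]
      refine h _ _ ?_ (by linarith) ?_
      · simp only [hp]; have : 0 ≤ (k:ℝ) * ((t2-t1)/((n:ℝ)+1)) := by positivity
        linarith
      · rw [← e1]; simp only [hp]; push_cast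
        have := mul_le_mul_of_nonneg_right hk' hst
        linarith
    refine (Finset.sum_le_sum this).trans (le_of_eq ?_)
    simp only [Finset.sum_const, Finset.card_range, nsmul_eq_mul]; push_cast
    field_simp
  have hl : Tendsto (fun n : ℕ => C * (t2-t1)^2 * (1/((n:ℝ)+1))) atTop (nhds (C * (t2-t1)^2 * 0)) :=
    tendsto_one_div_add_atTop_nhds_zero_nat.const_mul _
  have := ge_of_tendsto' hl key
  linarith

/-! ### Regularized absolute value -/

def jj (η a : ℝ) : ℝ := √(a^2+η^2)
def j1 (η a : ℝ) : ℝ := a / √(a^2+η^2)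
def j2 (η a : ℝ) : ℝ := η^2 / (√(a^2+η^2))^3

lemma jj_pos {η : ℝ} (hη : 0 < η) (a : ℝ) : 0 < √(a^2+η^2) := Real.sqrt_pos.2 (by positivity)
lemma jj_sq {η : ℝ} (a : ℝ) : √(a^2+η^2)^2 = a^2+η^2 := Real.sq_sqrt (by positivity)
lemma jj_eta {η : ℝ} (hη : 0 < η) (a : ℝ) : η ≤ √(a^2+η^2) := Real.le_sqrt_of_sq_le (by nlinarith [sq_nonneg a])
lemma jj_abs (η a : ℝ) : |a| ≤ √(a^2+η^2) := Real.abs_le_sqrt (by nlinarith [sq_nonneg η])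
lemma jj_le {η : ℝ} (hη : 0 < η) (a : ℝ) : √(a^2+η^2) ≤ |a| + η := by
  refine Real.sqrt_le_iff.2 ⟨by positivity, ?_⟩
  nlinarith [sq_abs a, abs_nonneg a]
lemma jj_cont (η : ℝ) : Continuous (jj η) := by unfold jj; fun_prop

lemma jj_conv {η : ℝ} (hη : 0 < η) (s t : ℝ) : jj η t - jj η s ≤ j1 η t * (t - s) := by
  unfold jj j1
  have h1 := jj_pos hη t
  have h2 := jj_pos hη s
  rw [div_mul_eq_mul_div, le_div_iff₀ h1]
  have h3 : t*s + η^2 ≤ √(t^2+η^2) * √(s^2+η^2) := by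
    rw [← Real.sqrt_mul (by positivity)]
    refine Real.le_sqrt_of_sq_le ?_
    nlinarith [sq_nonneg (η*(t-s))]
  have := jj_sq (η := η) t
  nlinarith

lemma j1_deriv {η : ℝ} (hη : 0 < η) (a : ℝ) : HasDerivAt (j1 η) (j2 η a) a := by
  have h1 := jj_pos hη a
  have h : HasDerivAt (fun a : ℝ => √(a^2+η^2)) (2*a/(2*√(a^2+η^2))) a := by
    have h0 : HasDerivAt (fun a : ℝ => a^2+η^2) (2*a) a := by
      simpa using ((hasDerivAt_id a).pow 2).add_const (η^2)
    exact h0.sqrt (by positivity)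
  have := (hasDerivAt_id a).div h h1.ne'
  refine this.congr_deriv ?_
  have h2 := jj_sq (η := η) a
  simp only [id, j2, one_mul]
  field_simp
  rw [h2]; ring

lemma j2_nonneg {η : ℝ} (hη : 0 < η) (a : ℝ) : 0 ≤ j2 η a := by
  have := jj_pos hη a; unfold j2; positivity

lemma j2_le {η : ℝ} (hη : 0 < η) (a : ℝ) : j2 η a ≤ η⁻¹ := by
  have h1 := jj_pos hη a
  have h2 := jj_eta hη a
  unfold j2
  rw [div_le_iff₀ (by positivity), le_inv_mul_iff₀ hη]
  calc η * η^2 = η^3 := by ring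
    _ ≤ _ := by gcongr

lemma j2_sq {η : ℝ} (hη : 0 < η) (a : ℝ) : j2 η a * a^2 ≤ η := by
  have h1 := jj_pos hη a
  have h2 := jj_eta hη a
  have h3 := jj_sq (η := η) a
  unfold j2
  rw [div_mul_eq_mul_div, div_le_iff₀ (by positivity)]
  have e : η * √(a^2+η^2)^3 = η * √(a^2+η^2) * (a^2+η^2) := by
    calc η * √(a^2+η^2)^3 = η * √(a^2+η^2) * √(a^2+η^2)^2 := by ring
      _ = _ := by rw [h3]
  rw [e]
  have : η^2 ≤ η * √(a^2+η^2) := by nlinarith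
  nlinarith [sq_nonneg a, mul_nonneg hη.le h1.le]

lemma j2_cont {η : ℝ} (hη : 0 < η) : Continuous (j2 η) := by
  unfold j2
  refine continuous_const.div (by fun_prop) fun a => ?_
  have := jj_pos hη a; positivity

lemma j1_bound (η a : ℝ) : |j1 η a| ≤ 1 := by
  unfold j1
  rw [abs_div, abs_of_nonneg (Real.sqrt_nonneg _)]
  exact div_le_one_of_le₀ (jj_abs η a) (Real.sqrt_nonneg _)

lemma j1_cont {η : ℝ} (hη : 0 < η) : Continuous (j1 η) := continuous_iff_continuousAt.2 fun a => (j1_deriv hη a).continuousAt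

lemma j1_lip {η : ℝ} (hη : 0 < η) (a c : ℝ) : |j1 η a - j1 η c| ≤ η⁻¹ * |a - c| := by
  have := Convex.norm_image_sub_le_of_norm_hasDerivWithin_le (f := j1 η) (f' := j2 η) (s := univ) (C := η⁻¹)
    (fun x _ => (j1_deriv hη x).hasDerivWithinAt) (fun x _ => by rw [Real.norm_of_nonneg (j2_nonneg hη x)]; exact j2_le hη x) convex_univ (mem_univ c) (mem_univ a)
  simpa using this

/-! ### Pointwise Kato inequality -/

lemma kato_pt {d : ℕ} {ρ : Td d → ℝ} (hρ : Continuous ρ) {b : Td d → Vd d} (hb : ∀ i, Continuous (fun y => b y i)) {B : ℝ} (hB : 0 < B)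
    (hbB : ∀ y i, |b y i| ≤ B) {r η : ℝ} (hr : 0 < r) (hη : 0 < η) :
    ∫ y, ρ y * TT b r (fun y => j1 η (Ph r ρ y)) y ≤
      d * B^2 * η / 2 + (2*η)⁻¹ * ∑ i, ∫ y, (Ph r (fun y => ρ y * b y i) y - b y i * Ph r ρ y)^2 := by
  set a := Ph r ρ with ha
  set f : Td d → ℝ := fun y => j1 η (a y) with hf
  have haG : HasG a (fun i => Qh i r ρ) := Ph_HasG hρ hr
  have hfG : HasG f (fun i y => j2 η (a y) * Qh i r ρ y) := haG.comp (j1_deriv hη) (j2_cont hη)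
  have hfc := hfG.cont
  have hac := haG.cont
  have hj : Continuous (fun y => j2 η (a y)) := (j2_cont hη).comp hac
  have hQ : ∀ i, Continuous (Qh i r ρ) := fun i => Qh_cont hρ i r
  have hρb : ∀ i, Continuous (fun y => ρ y * b y i) := fun i => hρ.mul (hb i)
  have hP : ∀ i, Continuous (Ph r (fun y => ρ y * b y i)) := fun i => Ph_cont (hρb i) r
  have h1 : ∀ i, ∫ y, ρ y * Qh i (r/2) (Qh i (r/2) f) y = - ∫ y, j2 η (a y) * Qh i r ρ y * Qh i r ρ y := by
    intro i
    rw [Qh_adj hρ (Qh_cont hfc _ _)]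
    have e1 : ∫ y, Qh i (r/2) f y * Qh i (r/2) ρ y = ∫ y, Qh i (r/2) ρ y * Qh i (r/2) f y := by simp only [mul_comm]
    rw [e1, Qh_adj (Qh_cont hρ _ _) hfc, neg_neg, hfG.ibp (Qh_HasG hρ hr i) i]
    simp only [mul_comm]
  have h2 : ∀ i, ∫ y, ρ y * (b y i * Qh i r f y) = ∫ y, j2 η (a y) * Qh i r ρ y * Ph r (fun y => ρ y * b y i) y := by
    intro i
    simp only [← mul_assoc]
    rw [Qh_adj (hρb i) hfc, hfG.ibp (Ph_HasG (hρb i) hr) i, neg_neg]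
    simp only [mul_comm]
  have i1 : ∀ i, Integrable (fun y => ρ y * Qh i (r/2) (Qh i (r/2) f) y) := fun i => integrable_cont (hρ.mul (Qh_cont (Qh_cont hfc _ _) _ _)) _
  have i2 : ∀ i, Integrable (fun y => ρ y * (b y i * Qh i r f y)) := fun i => integrable_cont (hρ.mul ((hb i).mul (Qh_cont hfc _ _))) _
  have e : ∫ y, ρ y * TT b r f y = ∑ i, ((- ∫ y, j2 η (a y) * Qh i r ρ y * Qh i r ρ y) - ∫ y, j2 η (a y) * Qh i r ρ y * Ph r (fun y => ρ y * b y i) y) := by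
    simp only [TT, Ls, mul_sub, Finset.mul_sum]
    rw [integral_sub (integrable_finsetSum _ fun i _ => i1 i) (integrable_finsetSum _ fun i _ => i2 i), integral_finsetSum _ fun i _ => i1 i,
      integral_finsetSum _ fun i _ => i2 i, ← Finset.sum_sub_distrib]
    exact Finset.sum_congr rfl fun i _ => by rw [h1, h2]
  rw [e]
  have e2 : d * B^2 * η / 2 = ∑ _i : Fin d, B^2 * η/2 := by simp; ring
  rw [e2, Finset.mul_sum, ← Finset.sum_add_distrib]
  refine Finset.sum_le_sum fun i _ => ?_
  set P := Ph r (fun y => ρ y * b y i) with hPdef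
  have c1 : Continuous (fun y => j2 η (a y) * Qh i r ρ y * Qh i r ρ y) := (hj.mul (hQ i)).mul (hQ i)
  have c2 : Continuous (fun y => j2 η (a y) * Qh i r ρ y * P y) := (hj.mul (hQ i)).mul (hP i)
  have c3 : Continuous (fun y => (P y - b y i * a y)^2) := ((hP i).sub ((hb i).mul hac)).pow 2
  rw [← integral_neg, ← integral_sub (integrable_cont c1.fun_neg _) (integrable_cont c2 _), ← integral_const_mul]
  have e3 : B^2*η/2 = ∫ _ : Td d, B^2*η/2 := by simp
  rw [e3, ← integral_add (integrable_const _) (integrable_cont (continuous_const.fun_mul c3) _)]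
  refine integral_mono (integrable_cont (c1.fun_neg.fun_sub c2) _) ((integrable_const _).add (integrable_cont (continuous_const.fun_mul c3) _)) fun y => ?_
  have q0 := j2_nonneg hη (a y)
  have q1 := j2_le hη (a y)
  have q2 := j2_sq hη (a y)
  set J := j2 η (a y)
  set Q := Qh i r ρ y
  have hbb : b y i ^2 ≤ B^2 := by rw [← sq_abs]; exact pow_le_pow_left₀ (abs_nonneg _) (hbB y i) 2
  show -(J * Q * Q) - J * Q * P y ≤ B^2*η/2 + (2*η)⁻¹ * (P y - b y i * a y)^2
  set R := P y - b y i * a y with hR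
  have s1 : -(J * Q * Q) - J * Q * P y ≤ J * ((P y)^2/4) := by nlinarith [mul_nonneg q0 (sq_nonneg (Q + P y/2))]
  have s2 : (P y)^2/4 ≤ (b y i * a y)^2/2 + R^2/2 := by rw [hR]; nlinarith [sq_nonneg (2*(b y i * a y) - P y)]
  have s3 : J * (b y i * a y)^2 ≤ B^2 * η := by
    calc J * (b y i * a y)^2 = b y i^2 * (J * a y^2) := by ring
      _ ≤ B^2 * η := mul_le_mul hbb q2 (by positivity) (by positivity)
  have s4 : J * R^2 ≤ η⁻¹ * R^2 := mul_le_mul_of_nonneg_right q1 (sq_nonneg _)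
  have s5 := mul_le_mul_of_nonneg_left s2 q0
  rw [mul_inv]
  linarith

/-! ### L1 contraction -/

lemma joint_cont {d : ℕ} {f : ℝ → Td d → ℝ} (hf : ∀ t, Continuous (f t)) {L : ℝ} (hL : 0 ≤ L) (h : ∀ s t y, |f t y - f s y| ≤ L * |t - s|) :
    Continuous (fun p : ℝ × Td d => f p.1 p.2) := by
  refine continuous_prod_of_continuous_lipschitzWith (fun p : ℝ × Td d => f p.1 p.2) L.toNNReal (fun t => hf t) (fun y => ?_)
  refine LipschitzWith.of_dist_le_mul fun s t => ?_
  rw [Real.coe_toNNReal _ hL, Real.dist_eq, Real.dist_eq]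
  exact h t s y

def Psi {d : ℕ} (m1 m2 : ℝ → PTd d) (b : ℝ → Td d → Vd d) (ρ : ℝ → Td d → ℝ) (t1 r η τ : ℝ) : ℝ :=
  MM (m1 τ) (m2 τ) (TT (b τ) r (fun y => j1 η (Ph r (ρ (max τ t1)) y)))

lemma FPD.psi_step {d : ℕ} {m1 m2 : ℝ → PTd d} {b : ℝ → Td d → Vd d} {B : ℝ} (D : FPD m1 m2 b B) {ρ : ℝ → Td d → ℝ} (E : Dens m1 m2 ρ)
    {r η t1 t2 : ℝ} (hr : 0 < r) (hη : 0 < η) (ht1 : 0 < t1) (h12 : t1 ≤ t2) :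
    IntervalIntegrable (Psi m1 m2 b ρ t1 r η) volume t1 t2 ∧
    (∫ y, jj η (Ph r (ρ t2) y)) - ∫ y, jj η (Ph r (ρ t1) y) ≤ ∫ τ in t1..t2, Psi m1 m2 b ρ t1 r η τ := by
  set f : ℝ → Td d → ℝ := fun τ y => j1 η (Ph r (ρ (max τ t1)) y) with hf
  have hm : ∀ τ, 0 < max τ t1 := fun τ => lt_max_of_lt_right ht1
  have hac : ∀ τ, Continuous (Ph r (ρ (max τ t1))) := fun τ => Ph_cont (E.c _ (hm τ)) r
  have hfc : ∀ τ, Continuous (f τ) := fun τ => (j1_cont hη).comp (hac τ)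
  have hC0 := Ca_nonneg d D.B0 r
  have hal : ∀ s t y, |Ph r (ρ (max t t1)) y - Ph r (ρ (max s t1)) y| ≤ Ca d B r * |t - s| := by
    intro s t y
    have hk : |max t t1 - max s t1| ≤ |t - s| := abs_max_sub_max_le_abs _ _ _
    rcases le_total (max s t1) (max t t1) with h | h
    · exact (D.a_lip E hr (hm s) h y).trans (by gcongr)
    · rw [abs_sub_comm]; refine (D.a_lip E hr (hm t) h y).trans ?_
      rw [abs_sub_comm]; gcongr
  set Cf := η⁻¹ * Ca d B r with hCf
  have hCf0 : 0 ≤ Cf := by positivity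
  have hfl : ∀ s t y, |f t y - f s y| ≤ Cf * |t - s| := by
    intro s t y
    refine (j1_lip hη _ _).trans ?_
    rw [hCf, mul_assoc]
    exact mul_le_mul_of_nonneg_left (hal s t y) (by positivity)
  have hq := qq_nonneg d r
  have hq2 := qq_nonneg d (r/2)
  have hS := Cst_nonneg d D.B0 r
  have hA : Continuous (fun p : ℝ × Td d => Ls r (f p.1) p.2) := by
    refine joint_cont (f := fun t => Ls r (f t)) (fun t => Ls_cont (hfc t) r) (L := d * (qq d (r/2) * qq d (r/2)) * Cf) (by positivity) fun s t y => ?_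
    rw [← Ls_sub (hfc t) (hfc s)]
    exact (Ls_bound ((hfc t).sub (hfc s)) (hfl s t) r y).trans (by rw [mul_assoc _ Cf])
  have hP : ∀ i, Continuous (fun p : ℝ × Td d => Qh i r (f p.1) p.2) := by
    intro i
    refine joint_cont (f := fun t => Qh i r (f t)) (fun t => Qh_cont (hfc t) i r) (L := qq d r * Cf) (by positivity) fun s t y => ?_
    exact (Qh_diff (hfc t) (hfc s) i r (hfl s t) y).trans (by rw [mul_assoc (qq d r)]; exact le_rfl)
  have hint : ∀ s t, t1 ≤ s → s ≤ t → IntervalIntegrable (Psi m1 m2 b ρ t1 r η) volume s t := by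
    intro s t hs hst
    rw [intervalIntegrable_iff_integrableOn_Ioc_of_le hst]
    refine Integrable.of_bound ((meas_aux D.c1 D.lim hA hP (ht1.le.trans hs)).sub (meas_aux D.c2 D.lim hA hP (ht1.le.trans hs))) (2 * (Cst d B r * 1)) ?_
    refine (ae_restrict_iff' measurableSet_Ioc).2 (ae_of_all _ fun τ hτ => ?_)
    exact MM_bound _ _ fun y => D.TT_bound (ht1.le.trans (hs.trans hτ.1.le)) (hfc τ) (fun y => j1_bound _ _) r y
  refine ⟨hint t1 t2 le_rfl h12, ?_⟩
  have hjc : ∀ t, 0 < t → Continuous (fun y => jj η (Ph r (ρ t) y)) := fun t ht => (jj_cont η).comp (Ph_cont (E.c t ht) r)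
  have key := quad_mono (X := fun t => (∫ y, jj η (Ph r (ρ t) y)) - ∫ τ in t1..t, Psi m1 m2 b ρ t1 r η τ) (C := 2 * (Cst d B r * Cf)) h12 ?_
  · simp only [intervalIntegral.integral_same] at key
    linarith
  intro s t hs hst htt
  have hs0 : 0 < s := ht1.trans_le hs
  have ht0 : 0 < t := hs0.trans_le hst
  have e1 : (∫ τ in t1..t, Psi m1 m2 b ρ t1 r η τ) - ∫ τ in t1..s, Psi m1 m2 b ρ t1 r η τ = ∫ τ in s..t, Psi m1 m2 b ρ t1 r η τ :=
    intervalIntegral.integral_interval_sub_left (hint t1 t le_rfl (hs.trans hst)) (hint t1 s le_rfl hs)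
  obtain ⟨i3, e3⟩ := D.static hr (hfc t) hs0.le hst
  have hft : f t = fun y => j1 η (Ph r (ρ t) y) := by rw [hf]; simp only [max_eq_left (hs.trans hst)]
  have e2 : (∫ y, jj η (Ph r (ρ t) y)) - ∫ y, jj η (Ph r (ρ s) y) ≤ ∫ τ in s..t, MM (m1 τ) (m2 τ) (TT (b τ) r (f t)) := by
    rw [← e3, E.e t ht0 _ (Ph_cont (hfc t) r), E.e s hs0 _ (Ph_cont (hfc t) r), Ph_adj (E.c t ht0) (hfc t), Ph_adj (E.c s hs0) (hfc t)]
    have hct := Ph_cont (E.c t ht0) r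
    have hcs := Ph_cont (E.c s hs0) r
    rw [← integral_sub (integrable_cont (hjc t ht0) _) (integrable_cont (hjc s hs0) _), ← integral_sub (integrable_cont ((hfc t).fun_mul hct) _) (integrable_cont ((hfc t).fun_mul hcs) _)]
    refine integral_mono (integrable_cont ((hjc t ht0).sub (hjc s hs0)) _) (integrable_cont (((hfc t).mul hct).sub ((hfc t).mul hcs)) _) fun y => ?_
    show jj η (Ph r (ρ t) y) - jj η (Ph r (ρ s) y) ≤ f t y * Ph r (ρ t) y - f t y * Ph r (ρ s) y
    rw [← mul_sub, hft]
    exact jj_conv hη _ _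
  have e4 : (∫ τ in s..t, MM (m1 τ) (m2 τ) (TT (b τ) r (f t))) - ∫ τ in s..t, Psi m1 m2 b ρ t1 r η τ ≤ 2 * (Cst d B r * Cf) * (t-s)^2 := by
    rw [← intervalIntegral.integral_sub i3 (hint s t hs hst)]
    have : ∀ τ ∈ uIoc s t, ‖MM (m1 τ) (m2 τ) (TT (b τ) r (f t)) - Psi m1 m2 b ρ t1 r η τ‖ ≤ 2 * (Cst d B r * (Cf * (t-s))) := by
      intro τ hτ
      rw [uIoc_of_le hst] at hτ
      have hτ0 : 0 ≤ τ := hs0.le.trans hτ.1.le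
      have : MM (m1 τ) (m2 τ) (TT (b τ) r (f t)) - Psi m1 m2 b ρ t1 r η τ = MM (m1 τ) (m2 τ) (TT (b τ) r (fun y => f t y - f τ y)) := by
        rw [Psi, ← MM_sub _ _ (D.TT_cont hτ0 (hfc t) r) (D.TT_cont hτ0 (hfc τ) r)]
        congr 1; ext y; exact (TT_sub (b τ) (hfc t) (hfc τ) r y).symm
      rw [this]
      refine MM_bound _ _ fun y => D.TT_bound hτ0 ((hfc t).sub (hfc τ)) (fun y => (hfl τ t y).trans ?_) r y
      refine mul_le_mul_of_nonneg_left ?_ hCf0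
      rw [abs_of_nonneg (by linarith [hτ.2])]; linarith [hτ.1]
    have h := (le_abs_self _).trans (intervalIntegral.norm_integral_le_of_norm_le_const this)
    rw [abs_of_nonneg (by linarith)] at h
    refine h.trans (le_of_eq (by ring))
  show ((∫ y, jj η (Ph r (ρ t) y)) - ∫ τ in t1..t, Psi m1 m2 b ρ t1 r η τ) - ((∫ y, jj η (Ph r (ρ s) y)) - ∫ τ in t1..s, Psi m1 m2 b ρ t1 r η τ) ≤ _
  linarith

def Rr {d : ℕ} (b : Td d → Vd d) (ρ : Td d → ℝ) (r : ℝ) : ℝ := ∑ i, ∫ y, (Ph r (fun y => ρ y * b y i) y - b y i * Ph r ρ y)^2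

lemma Rr_lim {d : ℕ} {ρ : Td d → ℝ} (hρ : Continuous ρ) {b : Td d → Vd d} (hb : ∀ i, Continuous (fun y => b y i)) {B R : ℝ}
    (hR0 : 0 ≤ R) (hB0 : 0 ≤ B) (hR : ∀ y, |ρ y| ≤ R) (hbB : ∀ y i, |b y i| ≤ B) :
    (∀ r, Rr b ρ r ≤ d * (2*(R*B))^2) ∧ Tendsto (Rr b ρ) (nhds 0) (nhds 0) := by
  have hc : ∀ i, Continuous (fun y => ρ y * b y i) := fun i => hρ.mul (hb i)
  have hpt : ∀ r i y, (Ph r (fun y => ρ y * b y i) y - b y i * Ph r ρ y)^2 ≤ (2*(R*B))^2 := by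
    intro r i y
    have h1 : |Ph r (fun y => ρ y * b y i) y| ≤ R * B := Ph_bound (hc i) (fun y => by rw [abs_mul]; exact mul_le_mul (hR y) (hbB y i) (abs_nonneg _) hR0) r y
    have h2 : |b y i * Ph r ρ y| ≤ R * B := by rw [abs_mul, mul_comm]; exact mul_le_mul (Ph_bound hρ hR r y) (hbB y i) (abs_nonneg _) hR0
    have h3 := (abs_sub (Ph r (fun y => ρ y * b y i) y) (b y i * Ph r ρ y)).trans (add_le_add h1 h2)
    rw [← sq_abs]
    exact pow_le_pow_left₀ (abs_nonneg _) (by linarith) 2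
  have hcc : ∀ r i, Continuous (fun y => (Ph r (fun y => ρ y * b y i) y - b y i * Ph r ρ y)^2) := fun r i =>
    ((Ph_cont (hc i) r).sub ((hb i).mul (Ph_cont hρ r))).pow 2
  constructor
  · intro r
    have : ∀ i ∈ Finset.univ, ∫ y, (Ph r (fun y => ρ y * b y i) y - b y i * Ph r ρ y)^2 ≤ (2*(R*B))^2 := fun i _ => by
      refine (integral_mono (integrable_cont (hcc r i) _) (integrable_const _) (hpt r i)).trans ?_
      simp
    refine (Finset.sum_le_sum this).trans ?_
    simp
  · have : ∀ i ∈ Finset.univ, Tendsto (fun r => ∫ y, (Ph r (fun y => ρ y * b y i) y - b y i * Ph r ρ y)^2) (nhds 0) (nhds 0) := by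
      intro i _
      have := tendsto_integral_filter_of_dominated_convergence (μ := (volume : Measure (Td d))) (l := nhds (0:ℝ)) (F := fun r y => (Ph r (fun y => ρ y * b y i) y - b y i * Ph r ρ y)^2)
        (f := fun _ => 0) (fun _ => (2*(R*B))^2) (Eventually.of_forall fun r => (hcc r i).aestronglyMeasurable)
        (Eventually.of_forall fun r => ae_of_all _ fun y => by rw [Real.norm_of_nonneg (sq_nonneg _)]; exact hpt r i y) (integrable_const _)
        (ae_of_all _ fun y => ?_)
      · simpa using this
      · have := ((Ph_tendsto (hc i) y).sub ((Ph_tendsto hρ y).const_mul (b y i))).pow 2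
        have e : (ρ y * b y i - b y i * ρ y)^2 = 0 := by ring
        rwa [e] at this
    have := tendsto_finsetSum Finset.univ this
    rw [Finset.sum_const_zero] at this
    exact this

lemma FPD.contr_eta {d : ℕ} {m1 m2 : ℝ → PTd d} {b : ℝ → Td d → Vd d} {B : ℝ} (D : FPD m1 m2 b B) {ρ : ℝ → Td d → ℝ} (E : Dens m1 m2 ρ)
    {η t1 t2 : ℝ} (hη : 0 < η) (ht1 : 0 < t1) (h12 : t1 ≤ t2) :
    (∫ y, jj η (ρ t2 y)) - ∫ y, jj η (ρ t1 y) ≤ d * B^2 * η / 2 * (t2 - t1) := by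
  obtain ⟨R, hR0, hR⟩ := D.rho_bdd E ht1
  have hB := D.B0
  set r : ℕ → ℝ := fun n => 1/((n:ℝ)+1) with hr
  have hr0 : ∀ n, 0 < r n := fun n => by simp only [hr]; positivity
  have hrl : Tendsto r atTop (nhds 0) := tendsto_one_div_add_atTop_nhds_zero_nat
  set C := d * B^2 * η / 2 with hC
  have hC0 : 0 ≤ C := by positivity
  have hψ : ∀ n τ, t1 ≤ τ → Psi m1 m2 b ρ t1 (r n) η τ ≤ C + (2*η)⁻¹ * Rr (b τ) (ρ τ) (r n) := by
    intro n τ hτ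
    have hτ0 : 0 < τ := ht1.trans_le hτ
    have := kato_pt (E.c τ hτ0) (D.bc τ hτ0.le) hB (D.bb τ hτ0.le) (hr0 n) hη
    rw [Psi, max_eq_left hτ, E.e τ hτ0 _ (D.TT_cont hτ0.le (F := fun y => j1 η (Ph (r n) (ρ τ) y)) ((j1_cont hη).comp (Ph_cont (E.c τ hτ0) _)) _)]
    exact this
  have hRr := fun τ (hτ : t1 ≤ τ) => Rr_lim (E.c τ (ht1.trans_le hτ)) (D.bc τ (ht1.le.trans hτ)) hR0 hB.le (hR τ hτ) (D.bb τ (ht1.le.trans hτ))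
  have hL : ∀ t, t1 ≤ t → Tendsto (fun n => ∫ y, jj η (Ph (r n) (ρ t) y)) atTop (nhds (∫ y, jj η (ρ t y))) := by
    intro t ht
    have hc := E.c t (ht1.trans_le ht)
    refine tendsto_integral_of_dominated_convergence (fun _ => R + η) (fun n => ((jj_cont η).comp (Ph_cont hc _)).aestronglyMeasurable) (integrable_const _)
      (fun n => ae_of_all _ fun y => ?_) (ae_of_all _ fun y => ?_)
    · rw [Real.norm_of_nonneg (show 0 ≤ jj η _ from Real.sqrt_nonneg _)]
      exact (jj_le hη _).trans (by linarith [Ph_bound hc (hR t ht) (r n) y])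
    · exact ((jj_cont η).tendsto _).comp ((Ph_tendsto hc y).comp hrl)
  have hI : Tendsto (fun n => ∫ τ in t1..t2, max (Psi m1 m2 b ρ t1 (r n) η τ) C) atTop (nhds (∫ _ in t1..t2, C)) := by
    refine intervalIntegral.tendsto_integral_filter_of_dominated_convergence (fun _ => C + (2*η)⁻¹ * (d * (2*(R*B))^2)) (Eventually.of_forall fun n => ?_)
      (Eventually.of_forall fun n => ae_of_all _ fun τ hτ => ?_) intervalIntegrable_const (ae_of_all _ fun τ hτ => ?_)
    · have := (D.psi_step E (hr0 n) hη ht1 h12).1.aestronglyMeasurable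
      rw [uIoc_of_le h12]
      exact this.sup aestronglyMeasurable_const
    · rw [uIoc_of_le h12] at hτ
      rw [Real.norm_of_nonneg (hC0.trans (le_max_right _ _))]
      have h1 := mul_le_mul_of_nonneg_left ((hRr τ hτ.1.le).1 (r n)) (show 0 ≤ (2*η)⁻¹ by positivity)
      have h2 := hψ n τ hτ.1.le
      refine max_le (by linarith) ?_
      have : 0 ≤ (2*η)⁻¹ * (d * (2*(R*B))^2) := by positivity
      linarith
    · rw [uIoc_of_le h12] at hτ
      have h1 : Tendsto (fun n => C + (2*η)⁻¹ * Rr (b τ) (ρ τ) (r n)) atTop (nhds C) := by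
        simpa using (((hRr τ hτ.1.le).2.comp hrl).const_mul (2*η)⁻¹).const_add C
      refine tendsto_of_tendsto_of_tendsto_of_le_of_le tendsto_const_nhds h1 (fun n => le_max_right _ _) fun n => max_le (hψ n τ hτ.1.le) ?_
      have : 0 ≤ Rr (b τ) (ρ τ) (r n) := Finset.sum_nonneg fun i _ => integral_nonneg fun y => sq_nonneg _
      have : 0 ≤ (2*η)⁻¹ * Rr (b τ) (ρ τ) (r n) := by positivity
      linarith
  have hfin := le_of_tendsto_of_tendsto' ((hL t2 h12).sub (hL t1 le_rfl)) hI fun n => ?_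
  · refine hfin.trans (le_of_eq ?_)
    simp; ring
  · obtain ⟨i1, h1⟩ := D.psi_step E (hr0 n) hη ht1 h12
    refine h1.trans (intervalIntegral.integral_mono_on h12 i1 ?_ fun τ _ => le_max_left _ _)
    rw [intervalIntegrable_iff_integrableOn_Ioc_of_le h12] at i1 ⊢
    exact Integrable.sup i1 (integrable_const C)

lemma FPD.contr {d : ℕ} {m1 m2 : ℝ → PTd d} {b : ℝ → Td d → Vd d} {B : ℝ} (D : FPD m1 m2 b B) {ρ : ℝ → Td d → ℝ} (E : Dens m1 m2 ρ)
    {t1 t2 : ℝ} (ht1 : 0 < t1) (h12 : t1 ≤ t2) : ∫ y, |ρ t2 y| ≤ ∫ y, |ρ t1 y| := by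
  have hB := D.B0
  have c1 := E.c t1 ht1
  have c2 := E.c t2 (ht1.trans_le h12)
  have key : ∀ η : ℝ, 0 < η → ∫ y, |ρ t2 y| ≤ (∫ y, |ρ t1 y|) + η * (1 + d * B^2 / 2 * (t2-t1)) := by
    intro η hη
    have h := D.contr_eta E hη ht1 h12
    have h1 : ∫ y, |ρ t2 y| ≤ ∫ y, jj η (ρ t2 y) := integral_mono (integrable_cont c2.abs _) (integrable_cont ((jj_cont η).comp c2) _) fun y => jj_abs _ _
    have h2 : ∫ y, jj η (ρ t1 y) ≤ (∫ y, |ρ t1 y|) + η := by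
      have : (∫ y, |ρ t1 y|) + η = ∫ y, (|ρ t1 y| + η) := by
        rw [integral_add (integrable_cont c1.abs _) (integrable_const _)]; simp
      rw [this]
      exact integral_mono (integrable_cont ((jj_cont η).comp c1) _) ((integrable_cont c1.abs _).add (integrable_const _)) fun y => jj_le hη _
    linarith [show η * (1 + d * B^2 / 2 * (t2-t1)) = η + d * B^2 * η / 2 * (t2-t1) by ring]
  have hC : 0 < 1 + d * B^2 / 2 * (t2-t1) := by
    have : 0 ≤ t2 - t1 := by linarith
    positivity
  refine le_of_forall_pos_le_add fun ε hε => ?_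
  have := key (ε / (1 + d * B^2 / 2 * (t2-t1))) (by positivity)
  rwa [div_mul_cancel₀ _ hC.ne'] at this

lemma Dens.W1_le {d : ℕ} {m1 m2 : ℝ → PTd d} {ρ : ℝ → Td d → ℝ} (E : Dens m1 m2 ρ) {t : ℝ} (ht : 0 < t) :
    W1 (m1 t) (m2 t) ≤ Metric.diam (univ : Set (Td d)) * ∫ y, |ρ t y| := by
  refine _root_.W1_le _ _ fun φ hφ => ?_
  have e : MM (m1 t) (m2 t) φ = MM (m1 t) (m2 t) (fun y => φ y - φ 0) := by
    rw [MM_sub _ _ hφ.continuous continuous_const, MM_const, sub_zero]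
  have hc : Continuous (fun y => φ y - φ 0) := hφ.continuous.sub continuous_const
  rw [e, E.e t ht _ hc, ← integral_const_mul]
  refine integral_mono (integrable_cont ((E.c t ht).mul hc) _) (integrable_cont (continuous_const.mul (E.c t ht).abs) _) fun y => (le_abs_self _).trans ?_
  rw [abs_mul, mul_comm]
  refine mul_le_mul_of_nonneg_right ?_ (abs_nonneg _)
  have := hφ.dist_le_mul y 0
  rw [Real.dist_eq] at this
  refine this.trans ?_
  simpa using Metric.dist_le_diam_of_mem isCompact_univ.isBounded (mem_univ y) (mem_univ 0)

/-! ### Final estimate from the drift bound -/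

def Af (d : ℕ) (σ : ℝ) : ℝ := 2 * Ad d * Charn d (2*σ) * (√σ)⁻¹

lemma Af_nonneg (d : ℕ) (σ : ℝ) : 0 ≤ Af d σ := by
  have := Ad_nonneg d; have := Charn_pos d (2*σ); unfold Af; positivity

lemma Af_anti (d : ℕ) {s t : ℝ} (hs : 0 < s) (hst : s ≤ t) : Af d t ≤ Af d s := by
  have := Ad_nonneg d
  have ht := hs.trans_le hst
  unfold Af Charn
  gcongr

def Kf (d : ℕ) (B s : ℝ) : ℝ := Af d (min s (sig0 d B)) + Af d (sig0 d B / 2) * (Metric.diam (univ : Set (Td d)) * Af d (sig0 d B / 2))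

lemma Kf_nonneg (d : ℕ) (B s : ℝ) : 0 ≤ Kf d B s := by
  have := Af_nonneg d (min s (sig0 d B)); have := Af_nonneg d (sig0 d B / 2); have : 0 ≤ Metric.diam (univ : Set (Td d)) := Metric.diam_nonneg
  unfold Kf; positivity

lemma FPD.all {d : ℕ} {m1 m2 : ℝ → PTd d} {b : ℝ → Td d → Vd d} {B : ℝ} (D : FPD m1 m2 b B) {ρ : ℝ → Td d → ℝ} (E : Dens m1 m2 ρ)
    {s : ℝ} (hs : 0 < s) {g : Td d → ℝ} (hg : Continuous g) : |MM (m1 s) (m2 s) g| ≤ Kf d B s * W1 (m1 0) (m2 0) * ∫ y, |g y| := by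
  have hσ := sig0_pos d D.B0
  have hW := W1_nonneg (m1 0) (m2 0)
  have hd : 0 ≤ Metric.diam (univ : Set (Td d)) := Metric.diam_nonneg
  have hG : 0 ≤ ∫ y, |g y| := integral_nonneg fun y => abs_nonneg _
  have hA := Af_nonneg d (sig0 d B / 2)
  have hA2 := Af_nonneg d (min s (sig0 d B))
  set h := sig0 d B / 2 with hh
  have st : ∀ s, 0 < s → s ≤ sig0 d B → ∀ g : Td d → ℝ, Continuous g → |MM (m1 s) (m2 s) g| ≤ Af d s * W1 (m1 0) (m2 0) * ∫ y, |g y| := by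
    intro s hs hss g hg
    simpa [Af] using D.short le_rfl hs (sig0_le d D.B0 hss) hg
  rcases le_or_gt s (sig0 d B) with hc | hc
  · refine (st s hs hc g hg).trans ?_
    rw [Kf, min_eq_left hc]
    gcongr
    have : 0 ≤ Af d h * (Metric.diam (univ : Set (Td d)) * Af d h) := by positivity
    linarith
  · have h0 : 0 < h := by positivity
    have hsh : h ≤ s - h := by linarith
    have e := D.short (s0 := s - h) (σ := h) (by linarith) h0 (sig0_le d D.B0 (by linarith)) hg
    rw [sub_add_cancel] at e
    refine e.trans ?_
    have hρ : ∀ y, |ρ h y| ≤ Af d h * W1 (m1 0) (m2 0) := fun y => sup_of_L1 (E.c h h0) (fun f hf => by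
      rw [← E.e h h0 f hf]; exact st h h0 (by linarith) f hf) y
    have h1 : ∫ y, |ρ h y| ≤ Af d h * W1 (m1 0) (m2 0) := by
      refine (integral_mono (integrable_cont (E.c h h0).abs _) (integrable_const _) hρ).trans ?_
      simp
    have h2 : W1 (m1 (s-h)) (m2 (s-h)) ≤ Metric.diam (univ : Set (Td d)) * (Af d h * W1 (m1 0) (m2 0)) :=
      (E.W1_le (by linarith)).trans (mul_le_mul_of_nonneg_left ((D.contr E h0 hsh).trans h1) hd)
    refine mul_le_mul_of_nonneg_right ?_ hG
    refine (mul_le_mul_of_nonneg_left h2 hA).trans ?_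
    rw [Kf, add_mul]
    have : 0 ≤ Af d (min s (sig0 d B)) * W1 (m1 0) (m2 0) := by positivity
    linarith [show Af d h * (Metric.diam (univ : Set (Td d)) * (Af d h * W1 (m1 0) (m2 0))) = Af d h * (Metric.diam (univ : Set (Td d)) * Af d h) * W1 (m1 0) (m2 0) by ring]

lemma gradv_c1 {d : ℕ} {g : Vd d → ℝ} (hg : ContDiff ℝ 2 g) (i : Fin d) : ContDiff ℝ 1 (fun x => gradv g x i) := by
  have := hg.fderiv_right (m := 1) (by norm_num)
  exact this.clm_apply contDiff_const

lemma gradv_per {d : ℕ} {g : Vd d → ℝ} (hp : ∀ (x : Vd d) (z : Fin d → ℤ), g (x + intVec z) = g x) (x : Vd d) (z : Fin d → ℤ) :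
    gradv g (x + intVec z) = gradv g x := by
  have : fderiv ℝ g (x + intVec z) = fderiv ℝ g x := by
    rw [← fderiv_comp_add_right]
    congr 1; ext x; exact hp x z
  funext i
  show fderiv ℝ g (x + intVec z) _ = fderiv ℝ g x _
  rw [this]

lemma zeta_HasG {d : ℕ} {g : Vd d → ℝ} (hp : ∀ (x : Vd d) (z : Fin d → ℤ), g (x + intVec z) = g x) (hg : ContDiff ℝ 2 g) :
    HasG (fun y => g (secT y)) (fun i y => gradv g (secT y) i) ∧ ∀ j, HasG (fun y => gradv g (secT y) j) (fun i y => gradv (fun x => gradv g x j) (secT y) i) :=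
  ⟨HasG.of_per hp (hg.of_le (by norm_num)), fun j => HasG.of_per (g := fun x => gradv g x j) (fun x z => by rw [gradv_per hp]) (gradv_c1 hg j)⟩

lemma dens_of {d : ℕ} {μ ν : PTd d} {g : Vd d → ℝ} (hp : ∀ (x : Vd d) (z : Fin d → ℤ), g (x + intVec z) = g x) (hg : ContDiff ℝ 2 g)
    (h : ∀ f : Vd d → ℝ, ContDiff ℝ 2 f → (∀ (x : Vd d) (z : Fin d → ℤ), f (x + intVec z) = f x) →
            (∫ y, g (secT y) * lapl f (secT y) ∂(volume : Measure (Td d))) =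
              (∫ y, f (secT y) ∂(μ : Measure (Td d))) - ∫ y, f (secT y) ∂(ν : Measure (Td d))) :
    Continuous (fun y : Td d => lapl g (secT y)) ∧ ∀ f : Td d → ℝ, Continuous f → MM μ ν f = ∫ y, lapl g (secT y) * f y := by
  obtain ⟨h1, h2⟩ := zeta_HasG hp hg
  have hl : ∀ y : Td d, lapl g (secT y) = ∑ i, gradv (fun x => gradv g x i) (secT y) i := fun y => rfl
  have hDc : ∀ i, Continuous (fun y : Td d => gradv (fun x => gradv g x i) (secT y) i) := fun i => (h2 i).1 i
  have hc : Continuous (fun y : Td d => lapl g (secT y)) := by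
    simp only [hl]; exact continuous_finsetSum _ fun i _ => hDc i
  refine ⟨hc, fun f hf => ?_⟩
  obtain ⟨M, hM0, hM⟩ := bdd_of_cont hc
  refine dens_eq (fun f => MM μ ν f) (fun f => ∫ y, lapl g (secT y) * f y) (2 + M) (fun f g hf hg ε he => ?_) (fun f g hf hg ε he => ?_) (fun s c => ?_) hf
  · have h0 : 0 ≤ ε := (abs_nonneg _).trans (he 0)
    rw [← MM_sub _ _ hf hg]
    exact (MM_bound _ _ he).trans (by nlinarith)
  · have h0 : 0 ≤ ε := (abs_nonneg _).trans (he 0)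
    rw [← integral_sub (integrable_cont (hc.fun_mul hf) _) (integrable_cont (hc.fun_mul hg) _)]
    have := norm_integral_le_of_norm_le_const (μ := (volume : Measure (Td d))) (f := fun y => lapl (‹Vd d → ℝ›) (secT y) * f y - lapl (‹Vd d → ℝ›) (secT y) * g y) (C := M * ε) (ae_of_all _ fun y => by
      rw [← mul_sub, norm_mul]
      exact mul_le_mul (hM y) (he y) (abs_nonneg _) hM0)
    simp only [probReal_univ, mul_one] at this
    exact this.trans (by nlinarith)
  · have t1 := Tsum_HasG s c
    have t2 := fun j => Tsum_HasG s (fun k => 2*π*k j*Complex.I*c k)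
    have e := h (fun x => Tsum s c (tm x)) (t1.c2 t2) (fun x z => by rw [tm_per])
    simp only [tm_secT, t1.lp t2] at e
    show MM μ ν (Tsum s c) = ∫ y, lapl g (secT y) * Tsum s c y
    rw [MM, ← e]
    simp only [hl, Finset.mul_sum, Finset.sum_mul]
    rw [integral_finsetSum _ fun i _ => integrable_cont (h1.cont.fun_mul ((t2 i).1 i)) _, integral_finsetSum _ fun i _ => integrable_cont ((hDc i).fun_mul t1.cont) _]
    refine Finset.sum_congr rfl fun i _ => ?_
    have e2 : ∫ y : Td d, gradv (fun x => gradv g x i) (secT y) i * Tsum s c y = ∫ y : Td d, Tsum s c y * gradv (fun x => gradv g x i) (secT y) i := by simp only [mul_comm]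
    rw [h1.ibp (t2 i) i, e2, t1.ibp (h2 i) i]
    simp only [mul_comm]

lemma grad_final {d : ℕ} {μ ν : PTd d} {g : Vd d → ℝ} (hp : ∀ (x : Vd d) (z : Fin d → ℤ), g (x + intVec z) = g x) (hg : ContDiff ℝ 2 g)
    (h0 : ∫ y : Td d, g (secT y) = 0) (hd : ∀ f : Td d → ℝ, Continuous f → MM μ ν f = ∫ y, lapl g (secT y) * f y) {K : ℝ} (hK : 0 ≤ K)
    (hb : ∀ f : Td d → ℝ, Continuous f → |MM μ ν f| ≤ K * ∫ y, |f y|) :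
    √(∫ y : Td d, sqnorm (gradv g (secT y))) ≤ K * √d := by
  obtain ⟨h1, h2⟩ := zeta_HasG hp hg
  have hl : ∀ y : Td d, lapl g (secT y) = ∑ i, gradv (fun x => gradv g x i) (secT y) i := fun y => rfl
  have hD : ∀ i, Continuous (fun y : Td d => gradv g (secT y) i) := h1.1
  have hDc : ∀ i, Continuous (fun y : Td d => gradv (fun x => gradv g x i) (secT y) i) := fun i => (h2 i).1 i
  set E := ∫ y : Td d, sqnorm (gradv g (secT y)) with hE
  have hE0 : 0 ≤ E := integral_nonneg fun y => Finset.sum_nonneg fun i _ => sq_nonneg _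
  have hsc : Continuous (fun y : Td d => sqnorm (gradv g (secT y))) := continuous_finsetSum _ fun i _ => (hD i).pow 2
  have e1 : E = - MM μ ν (fun y => g (secT y)) := by
    rw [hd _ h1.cont, hE]
    simp only [hl, sqnorm, Finset.sum_mul]
    rw [integral_finsetSum _ fun i _ => integrable_cont ((hD i).fun_pow 2) _, integral_finsetSum _ fun i _ => integrable_cont ((hDc i).fun_mul h1.cont) _, ← Finset.sum_neg_distrib]
    refine Finset.sum_congr rfl fun i _ => ?_
    have := h1.ibp (h2 i) i
    have e : ∫ y : Td d, gradv (fun x => gradv g x i) (secT y) i * g (secT y) = ∫ y : Td d, g (secT y) * gradv (fun x => gradv g x i) (secT y) i := by simp only [mul_comm]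
    rw [e, this, neg_neg]
    simp only [sq]
  set w : Td d → ℝ := fun y => ∑ i, |gradv g (secT y) i| with hw
  have hwc : Continuous w := continuous_finsetSum _ fun i _ => (hD i).abs
  have e2 : E ≤ K * ∫ y, w y := by
    rw [e1]
    refine (neg_le_abs _).trans ((hb _ h1.cont).trans ?_)
    exact mul_le_mul_of_nonneg_left (h1.poincare h0) hK
  set c := ∫ y, w y with hc
  have hc0 : 0 ≤ c := integral_nonneg fun y => Finset.sum_nonneg fun i _ => abs_nonneg _
  have e3 : c^2 ≤ d * E := by
    have p1 : ∫ y, w y * (2*c) ≤ ∫ y : Td d, (d * sqnorm (gradv g (secT y)) + c^2) := by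
      refine integral_mono (integrable_cont (hwc.mul continuous_const) _) (integrable_cont ((continuous_const.mul hsc).add continuous_const) _) fun y => ?_
      show w y * (2*c) ≤ d * sqnorm (gradv g (secT y)) + c^2
      have q : (w y)^2 ≤ d * sqnorm (gradv g (secT y)) := by
        have := sq_sum_le_card_mul_sum_sq (s := Finset.univ) (f := fun i => |gradv g (secT y) i|)
        simpa [sqnorm] using this
      nlinarith [sq_nonneg (w y - c)]
    rw [integral_mul_const, integral_add (integrable_cont (continuous_const.fun_mul hsc) _) (integrable_const _), integral_const_mul] at p1
    simp at p1
    nlinarith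
  have e4 : c ≤ √d * √E := by
    rw [← Real.sqrt_mul (by positivity)]; exact Real.le_sqrt_of_sq_le e3
  have e5 : √E * √E ≤ K * √d * √E := by
    rw [Real.mul_self_sqrt hE0]
    refine e2.trans ((mul_le_mul_of_nonneg_left e4 hK).trans (le_of_eq (by ring)))
  rcases (Real.sqrt_nonneg E).eq_or_lt with h | h
  · rw [← h]; positivity
  · exact le_of_mul_le_mul_right e5 h

/-! ### Maximum principle tools -/

lemma second_max {h h1 : ℝ → ℝ} {h2 : ℝ} (H1 : ∀ s, HasDerivAt h (h1 s) s) (H2 : HasDerivAt h1 h2 0)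
    (hm : ∀ᶠ s in nhds 0, h s ≤ h 0) : h1 0 = 0 ∧ h2 ≤ 0 := by
  have hd : deriv h = h1 := funext fun s => (H1 s).deriv
  have h0 : h1 0 = 0 := IsLocalMax.hasDerivAt_eq_zero hm (H1 0)
  refine ⟨h0, ?_⟩
  by_contra hc
  push Not at hc
  have hdd : deriv (deriv h) 0 = h2 := by rw [hd]; exact H2.deriv
  have hmin := isLocalMin_of_deriv_deriv_pos (f := h) (x₀ := 0) (by rw [hdd]; exact hc) (by rw [hd, h0]) (H1 0).continuousAt
  have heq : h =ᶠ[nhds 0] fun _ => h 0 := by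
    filter_upwards [hm, hmin] with s a b using le_antisymm a b
  have h3 := heq.deriv.deriv_eq
  rw [hdd] at h3
  simp at h3
  linarith

lemma right_max {h : ℝ → ℝ} {h' x : ℝ} (H : HasDerivAt h h' x) (hm : ∀ᶠ s in nhdsWithin x (Ioi x), h s ≤ h x) : h' ≤ 0 := by
  have := H.hasDerivWithinAt (s := Ioi x)
  rw [hasDerivWithinAt_iff_tendsto_slope' (by simp)] at this
  refine le_of_tendsto this ?_
  filter_upwards [hm, self_mem_nhdsWithin] with s hs hx
  rw [slope_def_field]
  exact div_nonpos_of_nonpos_of_nonneg (by linarith) (by linarith [show x < s from hx])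

lemma line1 {d : ℕ} {g : Vd d → ℝ} (hg : ContDiff ℝ 2 g) (x v : Vd d) (s : ℝ) :
    HasDerivAt (fun s : ℝ => g (x + s • v)) (fderiv ℝ g (x + s • v) v) s := by
  have h1 : HasDerivAt (fun s : ℝ => x + s • v) v s := by
    simpa using ((hasDerivAt_id s).smul_const v).const_add x
  exact ((hg.differentiable (by norm_num)) _).hasFDerivAt.comp_hasDerivAt s h1

lemma line2 {d : ℕ} {g : Vd d → ℝ} (hg : ContDiff ℝ 2 g) (x v : Vd d) (s : ℝ) :
    HasDerivAt (fun s : ℝ => fderiv ℝ g (x + s • v) v) (D2 g (x + s • v) v v) s := by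
  have h1 : HasDerivAt (fun s : ℝ => x + s • v) v s := by
    simpa using ((hasDerivAt_id s).smul_const v).const_add x
  have h2 : ContDiff ℝ 1 (fun y => fderiv ℝ g y v) := (hg.fderiv_right (m := 1) (by norm_num)).clm_apply contDiff_const
  exact ((h2.differentiable (by norm_num)) _).hasFDerivAt.comp_hasDerivAt s h1

lemma D2_eq {d : ℕ} {g : Vd d → ℝ} (hg : ContDiff ℝ 2 g) (x v w : Vd d) : D2 g x v w = fderiv ℝ (fderiv ℝ g) x w v := by
  have h2 : DifferentiableAt ℝ (fderiv ℝ g) x := ((hg.fderiv_right (m := 1) (by norm_num)).differentiable (by norm_num)) x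
  unfold D2
  rw [fderiv_clm_apply h2 (differentiableAt_const v)]
  simp

lemma clm_sum {d : ℕ} (A : Vd d →L[ℝ] ℝ) (v : Vd d) : A v = ∑ i, v i * A (Pi.single i 1) := by
  conv_lhs => rw [clm_eq_grd A, grd_apply]
  exact Finset.sum_congr rfl fun i _ => mul_comm _ _

lemma refl_trace {d : ℕ} (Q : Vd d →L[ℝ] Vd d →L[ℝ] ℝ) {e : Vd d} (he : sqnorm e = 1) :
    ∑ i, Q (Pi.single i 1 - (2 * e i) • e) (Pi.single i 1 - (2 * e i) • e) = ∑ i, Q (Pi.single i 1) (Pi.single i 1) := by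
  have h1 : ∑ i, e i * Q e (Pi.single i 1) = Q e e := (clm_sum (Q e) e).symm
  have h2 : ∑ i, e i * Q (Pi.single i 1) e = Q e e := (clm_sum (Q.flip e) e).symm
  have h3 : ∑ i, e i ^ 2 = 1 := he
  have : ∀ i, Q (Pi.single i 1 - (2 * e i) • e) (Pi.single i 1 - (2 * e i) • e) =
      Q (Pi.single i 1) (Pi.single i 1) - 2 * (e i * Q (Pi.single i 1) e) - 2 * (e i * Q e (Pi.single i 1)) + 4 * (e i^2 * Q e e) := by
    intro i
    simp only [map_sub, map_smul, _root_.sub_apply, _root_.smul_apply, smul_eq_mul]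
    ring
  simp only [this, Finset.sum_add_distrib, Finset.sum_sub_distrib, ← Finset.mul_sum, ← Finset.sum_mul, h1, h2, h3]
  ring

lemma max_point {d : ℕ} {g : Vd d → ℝ} (hg : ContDiff ℝ 2 g) {x : Vd d} (hm : ∀ y, g y ≤ g x) : gradv g x = 0 ∧ lapl g x ≤ 0 := by
  have key : ∀ i : Fin d, fderiv ℝ g x (Pi.single i 1) = 0 ∧ D2 g x (Pi.single i 1) (Pi.single i 1) ≤ 0 := by
    intro i
    have := second_max (line1 hg x (Pi.single i 1)) (line2 hg x (Pi.single i 1) 0) (Eventually.of_forall fun s => by simpa using hm _)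
    simpa using this
  exact ⟨funext fun i => (key i).1, Finset.sum_nonpos fun i _ => (key i).2⟩

lemma max_exists {X : Type*} [TopologicalSpace X] {K : Set X} (hK : IsCompact K) (hne : K.Nonempty) {g : ℝ → X → ℝ}
    (hg : ContinuousOn (fun p : ℝ × X => g p.1 p.2) (Ici 0 ×ˢ K)) {M ε : ℝ} (hM : ∀ t, 0 ≤ t → ∀ x ∈ K, g t x ≤ M) (hε : 0 < ε) :
    ∃ t0, 0 ≤ t0 ∧ ∃ x0 ∈ K, ∀ t, 0 ≤ t → ∀ x ∈ K, g t x - ε * t ≤ g t0 x0 - ε * t0 := by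
  obtain ⟨x1, hx1⟩ := hne
  have h1 := hM 0 le_rfl x1 hx1
  set T := (M - g 0 x1)/ε with hT
  have hT0 : 0 ≤ T := div_nonneg (by linarith) hε.le
  have hsub : Icc 0 T ×ˢ K ⊆ Ici 0 ×ˢ K := prod_mono Icc_subset_Ici_self le_rfl
  obtain ⟨⟨t0, x0⟩, ⟨ht0, hx0⟩, hmax⟩ := (isCompact_Icc.prod hK).exists_isMaxOn ⟨(0, x1), ⟨⟨le_rfl, hT0⟩, hx1⟩⟩
    (f := fun p : ℝ × X => g p.1 p.2 - ε * p.1) ((hg.mono hsub).sub (by fun_prop))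
  refine ⟨t0, ht0.1, x0, hx0, fun t ht x hx => ?_⟩
  rcases le_or_gt t T with h | h
  · exact hmax (show ((t, x) : ℝ × X) ∈ Icc 0 T ×ˢ K from ⟨⟨ht, h⟩, hx⟩)
  · have h2 : g 0 x1 - ε * 0 ≤ g t0 x0 - ε * t0 := hmax (show ((0, x1) : ℝ × X) ∈ Icc 0 T ×ˢ K from ⟨⟨le_rfl, hT0⟩, hx1⟩)
    have h3 : ε * T = M - g 0 x1 := by rw [hT]; field_simp
    have h4 := hM t ht x hx
    nlinarith

/-! ### Hamiltonian -/

lemma DpH_eq {d : ℕ} (S : MFGSetting d) (x p v : Vd d) : fderiv ℝ (fun p' => S.H x p') p v = fderiv ℝ (fun q : Vd d × Vd d => S.H q.1 q.2) (x, p) (0, v) := by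
  have h1 : HasFDerivAt (fun p' : Vd d => ((x, p') : Vd d × Vd d)) (ContinuousLinearMap.inr ℝ (Vd d) (Vd d)) p := hasFDerivAt_prodMk_right x p
  have h2 := ((S.H_smooth.differentiable (by norm_num)) (x, p)).hasFDerivAt.comp p h1
  have h3 : fderiv ℝ (fun p' => S.H x p') p = _ := h2.fderiv
  rw [h3]; simp

lemma DpH_c1 {d : ℕ} (S : MFGSetting d) (v : Vd d) : ContDiff ℝ 1 (fun q : Vd d × Vd d => fderiv ℝ (fun p' => S.H q.1 p') q.2 v) := by
  simp only [DpH_eq]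
  exact (S.H_smooth.fderiv_right (m := 1) (by norm_num)).clm_apply contDiff_const

lemma DpH_cont {d : ℕ} (S : MFGSetting d) (i : Fin d) : Continuous (fun q : Vd d × Vd d => DpH S q.1 q.2 i) := (DpH_c1 S _).continuous

lemma DpH_per {d : ℕ} (S : MFGSetting d) (x : Vd d) (z : Fin d → ℤ) (p : Vd d) : DpH S (x + intVec z) p = DpH S x p := by
  have : (fun p' => S.H (x + intVec z) p') = fun p' => S.H x p' := funext fun p => S.H_per x z p
  unfold DpH; rw [this]

lemma cube_compact {d : ℕ} : IsCompact (Icc (0 : Vd d) 1) := isCompact_Icc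
lemma secT_cube {d : ℕ} (y : Td d) : secT y ∈ Icc (0 : Vd d) 1 := ⟨fun i => (secT_mem y i).1, fun i => (secT_mem y i).2.le⟩

lemma per_bdd {d : ℕ} {f : Vd d → Vd d → ℝ} (hf : Continuous (fun q : Vd d × Vd d => f q.1 q.2)) (hp : ∀ (x : Vd d) (z : Fin d → ℤ) p, f (x + intVec z) p = f x p) (L : ℝ) :
    ∃ B, 0 ≤ B ∧ ∀ x p, ‖p‖ ≤ L → |f x p| ≤ B := by
  obtain ⟨B, hB⟩ := (cube_compact.prod (isCompact_closedBall (0 : Vd d) L)).exists_bound_of_continuousOn hf.continuousOn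
  refine ⟨max B 0, le_max_right _ _, fun x p hp' => ?_⟩
  have := hB (secT (tm x), p) (Set.mk_mem_prod (secT_cube (tm x)) (by simpa using hp'))
  have e : f (secT (tm x)) p = f x p := per_secT (f := fun x => f x p) (fun x z => hp x z p) rfl
  rw [← e]; exact le_max_of_le_left this

lemma H_diff {d : ℕ} (S : MFGSetting d) {C0 L : ℝ} (hC0 : ∀ x, |S.H x 0| ≤ C0) {p : Vd d} (hp : ‖p‖ ≤ L) (x y : Vd d) :
    |S.H x p - S.H y p| ≤ 2 * C0 + S.Cg * (1 + L) * L * ‖x - y‖ := by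
  have hL : 0 ≤ L := (norm_nonneg p).trans hp
  have hHx : ∀ x, ContDiff ℝ 2 (fun p => S.H x p) := fun x => S.H_smooth.comp (contDiff_const.prodMk contDiff_id)
  have hd : ∀ s : ℝ, HasDerivAt (fun s : ℝ => S.H x (0 + s • p) - S.H y (0 + s • p)) (fderiv ℝ (fun p' => S.H x p') (0 + s • p) p - fderiv ℝ (fun p' => S.H y p') (0 + s • p) p) s :=
    fun s => (line1 (hHx x) 0 p s).sub (line1 (hHx y) 0 p s)
  have hb : ∀ s ∈ Icc (0:ℝ) 1, ‖fderiv ℝ (fun p' => S.H x p') (0 + s • p) p - fderiv ℝ (fun p' => S.H y p') (0 + s • p) p‖ ≤ S.Cg * (1 + L) * L * ‖x - y‖ := by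
    intro s hs
    have hc : ContDiff ℝ 1 (fun x' => fderiv ℝ (fun p' => S.H x' p') (0 + s • p) p) := (DpH_c1 S p).comp (contDiff_id.prodMk contDiff_const)
    refine Convex.norm_image_sub_le_of_norm_fderiv_le (𝕜 := ℝ) (f := fun x' => fderiv ℝ (fun p' => S.H x' p') (0 + s • p) p) (s := univ)
      (fun x' _ => hc.differentiable (by norm_num) x') (fun x' _ => ?_) convex_univ (mem_univ y) (mem_univ x)
    refine ContinuousLinearMap.opNorm_le_bound _ (by have := S.Cg_pos; positivity) fun w => ?_
    refine (S.Dxp_growth x' (0 + s • p) p w).trans ?_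
    have hsp : ‖0 + s • p‖ ≤ L := by
      rw [zero_add, norm_smul, Real.norm_of_nonneg hs.1]
      exact (mul_le_of_le_one_left (norm_nonneg _) hs.2).trans hp
    have hr : (1 + ‖0 + s • p‖) ^ S.θ ≤ 1 + L := by
      calc (1 + ‖0 + s • p‖) ^ S.θ ≤ (1 + ‖0 + s • p‖) ^ (1:ℝ) := Real.rpow_le_rpow_of_exponent_le (by linarith [norm_nonneg (0 + s • p)]) S.θ_mem.2.le
        _ ≤ 1 + L := by rw [Real.rpow_one]; linarith
    have := S.Cg_pos
    gcongr
  have key := Convex.norm_image_sub_le_of_norm_hasDerivWithin_le (fun s _ => (hd s).hasDerivWithinAt) hb (convex_Icc 0 1) (left_mem_Icc.2 zero_le_one) (right_mem_Icc.2 zero_le_one)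
  simp only [one_smul, zero_smul, add_zero, zero_add, sub_zero, norm_one, mul_one, Real.norm_eq_abs] at key
  have h1 := hC0 x
  have h2 := hC0 y
  have h3 := abs_le.1 key
  have h4 := abs_le.1 h1
  have h5 := abs_le.1 h2
  rw [abs_le]; constructor <;> linarith

/-! ### Bounds on the value function -/

lemma eps_le {a b k : ℝ} (hk : 0 ≤ k) (h : ∀ ε, 0 < ε → ε ≤ 1 → a ≤ b + ε * k) : a ≤ b := by
  by_contra hc
  push Not at hc
  have h1 := h (min 1 ((a - b)/(2*(k+1)))) (lt_min one_pos (div_pos (by linarith) (by linarith))) (min_le_left _ _)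
  have h2 : min 1 ((a - b)/(2*(k+1))) * k ≤ (a - b)/(2*(k+1)) * (k+1) := by
    have := min_le_right 1 ((a - b)/(2*(k+1)))
    have h3 : 0 ≤ (a - b)/(2*(k+1)) := div_nonneg (by linarith) (by linarith)
    nlinarith
  have h4 : (a - b)/(2*(k+1)) * (k+1) = (a-b)/2 := by field_simp
  linarith

lemma one_sided {d : ℕ} {g : ℝ → Vd d → ℝ} (hg : Creg12 g (Ici 0)) {δ c M : ℝ} (hδ : 0 < δ) (hM : ∀ t ∈ Ici (0:ℝ), ∀ x, g t x ≤ M)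
    (h : ∀ t ∈ Ici (0:ℝ), ∀ x, gradv (g t) x = 0 → - tderiv g t x - lapl (g t) x + δ * g t x ≤ c) :
    ∀ t ∈ Ici (0:ℝ), ∀ x, g t x ≤ c / δ := by
  intro t1 ht1 x1
  have ht1' : 0 ≤ t1 := ht1
  refine eps_le (k := 1/δ + t1) (by positivity) fun ε hε _ => ?_
  obtain ⟨t0, ht0, x0, -, hmax⟩ := max_exists (cube_compact (d := d)) ⟨0, ⟨le_rfl, zero_le_one⟩⟩
    (g := g) (hg.1.mono (prod_mono le_rfl (subset_univ _))) (fun t ht x _ => hM t ht x) hε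
  have hm : ∀ t, 0 ≤ t → ∀ x, g t x - ε * t ≤ g t0 x0 - ε * t0 := fun t ht x => by
    rw [← per_secT (f := g t) (hg.2.2.2 t ht) (rfl : tm x = tm x)]
    exact hmax t ht _ (secT_cube _)
  obtain ⟨h1, h2⟩ := max_point (hg.2.2.1 t0 ht0) (x := x0) (fun y => by linarith [hm t0 ht0 y])
  have h3 : tderiv g t0 x0 - ε * 1 ≤ 0 := right_max (h := fun s => g s x0 - ε * s) (x := t0)
    (((hg.2.1 x0 t0 ht0).hasDerivAt).sub ((hasDerivAt_id t0).const_mul ε))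
    (by filter_upwards [self_mem_nhdsWithin] with s hs
        exact hm s (ht0.trans (le_of_lt hs)) x0)
  have h4 := h t0 ht0 x0 h1
  have h5 := hm t1 ht1 x1
  have h6 : g t0 x0 ≤ (c + ε)/δ := by rw [le_div_iff₀ hδ]; linarith
  have h7 : (c + ε)/δ = c/δ + ε * (1/δ) := by ring
  nlinarith

lemma u_bound {d : ℕ} (S : MFGSetting d) {δ C0 MF : ℝ} (hδ : 0 < δ) (hC0 : ∀ x, |S.H x 0| ≤ C0) {u f : ℝ → Vd d → ℝ}
    (hu : Creg12 u (Ici 0)) (hf : ∀ t ∈ Ici (0:ℝ), ∀ x, |f t x| ≤ MF) (hb : ∃ M, ∀ t ∈ Ici (0:ℝ), ∀ x, |u t x| ≤ M)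
    (heq : ∀ t ∈ Ici (0:ℝ), ∀ x, - tderiv u t x - lapl (u t) x + δ * u t x + S.H x (gradv (u t) x) = f t x) :
    ∀ t ∈ Ici (0:ℝ), ∀ x, |u t x| ≤ (MF + C0)/δ := by
  obtain ⟨M, hM⟩ := hb
  have a1 := one_sided hu hδ (c := MF + C0) (fun t ht x => (abs_le.1 (hM t ht x)).2) (fun t ht x h0 => by
    have h1 := heq t ht x
    rw [h0] at h1
    have := abs_le.1 (hC0 x); have := abs_le.1 (hf t ht x); linarith)
  have hn : Creg12 (fun t x => -u t x) (Ici 0) := ⟨hu.1.neg, fun x t ht => (hu.2.1 x t ht).neg, fun t ht => (hu.2.2.1 t ht).neg,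
    fun t ht x z => by simp only [hu.2.2.2 t ht x z]⟩
  have e1 : ∀ t x, gradv (fun x => -u t x) x = - gradv (u t) x := fun t x => by
    funext i; simp [gradv, fderiv_fun_neg]
  have e2 : ∀ t x, lapl (fun x => -u t x) x = - lapl (u t) x := fun t x => by
    simp [lapl, D2, fderiv_fun_neg]
  have e3 : ∀ t x, tderiv (fun t x => -u t x) t x = - tderiv u t x := fun t x => by
    simp [tderiv, deriv.fun_neg]
  have a2 := one_sided hn hδ (c := MF + C0) (fun t ht x => (by linarith [(abs_le.1 (hM t ht x)).1] : -u t x ≤ M)) (fun t ht x h0 => by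
    have h1 := heq t ht x
    rw [e1, neg_eq_zero] at h0
    rw [h0] at h1
    rw [e2, e3]
    have := abs_le.1 (hC0 x); have := abs_le.1 (hf t ht x); linarith)
  intro t ht x
  have := a1 t ht x; have := a2 t ht x
  rw [abs_le]; constructor <;> linarith

def psi (r0 r : ℝ) : ℝ := r - r^2/(2*r0)

lemma psi_mono {r0 a b : ℝ} (h0 : 0 < r0) (hab : a ≤ b) (hb : b ≤ r0) : psi r0 a ≤ psi r0 b := by
  have : psi r0 b - psi r0 a = (b-a)*(2*r0 - a - b)/(2*r0) := by unfold psi; field_simp; ring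
  have h2 : 0 ≤ (b-a)*(2*r0 - a - b)/(2*r0) := div_nonneg (mul_nonneg (by linarith) (by linarith)) (by linarith)
  linarith

lemma psi_d1 {r0 : ℝ} (h0 : 0 < r0) (r k s : ℝ) : HasDerivAt (fun s => psi r0 (r + s * k)) (k * (1 - (r + s * k)/r0)) s := by
  have h1 : HasDerivAt (fun s : ℝ => r + s * k) (1 * k) s := ((hasDerivAt_id s).mul_const k).const_add r
  refine (h1.sub ((h1.pow 2).div_const (2*r0))).congr_deriv ?_
  field_simp
  simp
  ring

lemma psi_d2 {r0 : ℝ} (r k s : ℝ) : HasDerivAt (fun s => k * (1 - (r + s * k)/r0)) (- (k^2 / r0)) s := by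
  have h1 : HasDerivAt (fun s : ℝ => r + s * k) (1 * k) s := ((hasDerivAt_id s).mul_const k).const_add r
  refine (((h1.div_const r0).const_sub 1).const_mul k).congr_deriv ?_
  ring

lemma coord_le {d : ℕ} (w : Vd d) (i : Fin d) : |w i| ≤ √(sqnorm w) := by
  refine Real.abs_le_sqrt ?_
  exact Finset.single_le_sum (f := fun i => (w i)^2) (fun i _ => sq_nonneg _) (Finset.mem_univ i)

lemma norm_le_sq {d : ℕ} (w : Vd d) : ‖w‖ ≤ √(sqnorm w) := by
  rw [pi_norm_le_iff_of_nonneg (Real.sqrt_nonneg _)]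
  exact fun i => coord_le w i

lemma sqnorm_smul {d : ℕ} (c : ℝ) (w : Vd d) : √(sqnorm (c • w)) = |c| * √(sqnorm w) := by
  have : sqnorm (c • w) = c^2 * sqnorm w := by
    simp [sqnorm, mul_pow, Finset.mul_sum]
  rw [this, Real.sqrt_mul (sq_nonneg c), Real.sqrt_sq_eq_abs]

lemma sqnorm_tri {d : ℕ} (a b : Vd d) : √(sqnorm (a + b)) ≤ √(sqnorm a) + √(sqnorm b) := by
  have e : ∀ w : Vd d, √(sqnorm w) = ‖(WithLp.toLp 2 w : EuclideanSpace ℝ (Fin d))‖ := fun w => by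
    rw [EuclideanSpace.norm_eq]; simp [sqnorm]
  rw [e, e, e, WithLp.toLp_add]
  exact norm_add_le _ _

lemma sqnorm_single {d : ℕ} (i : Fin d) : √(sqnorm (Pi.single i 1 : Vd d)) = 1 := by
  have : sqnorm (Pi.single i 1 : Vd d) = 1 := by
    unfold sqnorm
    rw [Finset.sum_eq_single i] <;> simp +contextual [Pi.single_apply]
  rw [this]; simp

lemma sqnorm_cont {d : ℕ} : Continuous (fun w : Vd d => √(sqnorm w)) := by unfold sqnorm; fun_prop

lemma coord_bd {d : ℕ} {A : Vd d →L[ℝ] ℝ} {L : ℝ} (h : ∀ v : Vd d, √(sqnorm v) = 1 → A v ≤ L) (i : Fin d) : |A (Pi.single i 1)| ≤ L := by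
  rw [abs_le]
  have h1 := h _ (sqnorm_single i)
  have h2 := h (-Pi.single i 1) (by
    have := sqnorm_smul (-1) (Pi.single i 1 : Vd d)
    rw [neg_one_smul, sqnorm_single] at this
    simpa using this)
  rw [map_neg] at h2
  constructor <;> linarith

lemma touch {d : ℕ} {g : Vd d → ℝ} (hg : ContDiff ℝ 2 g) {L r0 : ℝ} (hL : 0 < L) (h0 : 0 < r0) {y w : Vd d}
    (hr : 0 < √(sqnorm w)) (hr0 : √(sqnorm w) < r0)
    (hm : ∀ y' w', √(sqnorm w') ≤ r0 → g (y' + w') - g y' - L * psi r0 (√(sqnorm w')) ≤ g (y + w) - g y - L * psi r0 (√(sqnorm w))) :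
    gradv g (y + w) = gradv g y ∧ ‖gradv g y‖ ≤ L ∧ lapl g (y + w) - lapl g y ≤ - (4 * L / r0) := by
  set r := √(sqnorm w) with hrdef
  have ha : gradv g (y + w) = gradv g y := by
    funext i
    have := second_max (h := fun s => g (y + w + s • Pi.single i 1) - g (y + s • Pi.single i 1))
      (fun s => (line1 hg (y + w) (Pi.single i 1) s).sub (line1 hg y (Pi.single i 1) s))
      ((line2 hg (y + w) (Pi.single i 1) 0).sub (line2 hg y (Pi.single i 1) 0)) (Eventually.of_forall fun s => by
        have := hm (y + s • Pi.single i 1) w hr0.le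
        rw [add_right_comm] at this
        simp only [zero_smul, add_zero]
        linarith)
    have := this.1
    simp only [zero_smul, add_zero] at this
    exact sub_eq_zero.1 this
  refine ⟨ha, ?_, ?_⟩
  · rw [← ha, pi_norm_le_iff_of_nonneg hL.le]
    refine fun i => coord_bd (A := fderiv ℝ g (y+w)) (fun v hv => ?_) i
    have hd := (line1 hg (y + w) v 0).sub ((psi_d1 h0 r 1 0).const_mul L)
    have := right_max hd (by
      have hev : ∀ᶠ s : ℝ in nhdsWithin 0 (Ioi 0), s < r0 - r :=
        nhdsWithin_le_nhds (Iio_mem_nhds (by linarith))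
      filter_upwards [self_mem_nhdsWithin, hev] with s hs hs2
      have hs' : 0 < s := hs
      have h1 : √(sqnorm (w + s • v)) ≤ r + s := by
        refine (sqnorm_tri _ _).trans ?_
        rw [sqnorm_smul, hv, abs_of_pos hs', mul_one]
      have h2 := hm y (w + s • v) (by linarith)
      have h3 := psi_mono h0 h1 (by linarith)
      have h4 := mul_le_mul_of_nonneg_left h3 hL.le
      rw [← add_assoc] at h2
      simp only [Pi.sub_apply, zero_smul, add_zero, mul_one]
      linarith)
    simp only [zero_smul, add_zero, mul_one, one_mul] at this
    have h5 : 0 ≤ r / r0 := by positivity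
    nlinarith
  · set e : Vd d := r⁻¹ • w with he
    have hw : w = r • e := by rw [he, smul_smul, mul_inv_cancel₀ hr.ne', one_smul]
    have hes : √(sqnorm e) = 1 := by rw [he, sqnorm_smul, abs_of_pos (inv_pos.2 hr), ← hrdef, inv_mul_cancel₀ hr.ne']
    have hes' : sqnorm e = 1 := by rwa [Real.sqrt_eq_one] at hes
    have key : ∀ i : Fin d, D2 g (y + w) (Pi.single i 1) (Pi.single i 1)
        - D2 g y (Pi.single i 1 - (2 * e i) • e) (Pi.single i 1 - (2 * e i) • e) ≤ - (4 * L / r0) * (e i)^2 := by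
      intro i
      set R : Vd d := Pi.single i 1 - (2 * e i) • e with hR
      have hd := fun s => ((line1 hg (y + w) (Pi.single i 1) s).sub (line1 hg y R s)).sub ((psi_d1 h0 r (2 * e i) s).const_mul L)
      have hd2 := ((line2 hg (y + w) (Pi.single i 1) 0).sub (line2 hg y R 0)).sub ((psi_d2 (r0 := r0) r (2 * e i) 0).const_mul L)
      have := (second_max hd hd2 (by
        have hc : Continuous (fun s : ℝ => r + s * (2 * e i)) := by fun_prop
        have e1 : ∀ᶠ s in nhds (0:ℝ), r + s * (2 * e i) ∈ Ioo 0 r0 :=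
          hc.continuousAt.eventually_mem (Ioo_mem_nhds (by simpa using hr) (by simpa using hr0))
        filter_upwards [e1] with s hs
        have h1 : √(sqnorm ((r + s * (2 * e i)) • e)) = r + s * (2 * e i) := by
          rw [sqnorm_smul, hes, abs_of_pos hs.1, mul_one]
        have h2 := hm (y + s • R) ((r + s * (2 * e i)) • e) (by rw [h1]; exact hs.2.le)
        rw [h1] at h2
        have h3 : y + s • R + (r + s * (2 * e i)) • e = y + w + s • Pi.single i 1 := by
          rw [hR, smul_sub, smul_smul, add_smul, ← hw]; abel
        rw [h3] at h2
        simp only [Pi.sub_apply, zero_smul, add_zero, zero_mul]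
        linarith)).2
      simp only [zero_smul, add_zero] at this
      have e2 : L * -((2 * e i)^2 / r0) = - (4 * L / r0) * (e i)^2 := by ring
      linarith
    have hsum := Finset.sum_le_sum fun i (_ : i ∈ Finset.univ) => key i
    rw [Finset.sum_sub_distrib, ← Finset.mul_sum] at hsum
    have h3 : ∑ i, e i ^ 2 = 1 := hes'
    have h4 : ∑ i, D2 g y (Pi.single i 1 - (2 * e i) • e) (Pi.single i 1 - (2 * e i) • e) = lapl g y := by
      unfold lapl
      simp only [D2_eq hg]
      exact refl_trace _ hes'
    rw [h3, h4] at hsum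
    unfold lapl at hsum ⊢
    linarith

lemma u_lip {d : ℕ} (S : MFGSetting d) {δ C0 MF Cu A L : ℝ} (hδ : 0 < δ) (hC0 : ∀ x, |S.H x 0| ≤ C0) {u f : ℝ → Vd d → ℝ}
    (hu : Creg12 u (Ici 0)) (hf : ∀ t ∈ Ici (0:ℝ), ∀ x, |f t x| ≤ MF) (hb : ∀ t ∈ Ici (0:ℝ), ∀ x, |u t x| ≤ Cu)
    (heq : ∀ t ∈ Ici (0:ℝ), ∀ x, - tderiv u t x - lapl (u t) x + δ * u t x + S.H x (gradv (u t) x) = f t x)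
    (hA : A = 4 * Cu + 2) (hL : 0 < L) (hLA : 2 * MF + 2 * C0 + S.Cg * (1 + L) * A + 1 < 4 * L^2 / A)
    {t1 : ℝ} (ht1 : 0 ≤ t1) (y1 w1 : Vd d) (hw1 : √(sqnorm w1) ≤ A / L) : u t1 (y1 + w1) - u t1 y1 ≤ L * √(sqnorm w1) := by
  have hCu : 0 ≤ Cu := (abs_nonneg _).trans (hb 0 self_mem_Ici 0)
  have hA0 : 0 < A := by linarith
  set r0 := A / L with hr0
  have h0 : 0 < r0 := by positivity
  refine eps_le ht1 fun ε hε hε1 => ?_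
  suffices hs : u t1 (y1 + w1) - u t1 y1 - L * psi r0 (√(sqnorm w1)) - ε * t1 ≤ 0 by
    have : psi r0 (√(sqnorm w1)) ≤ √(sqnorm w1) := by
      unfold psi
      have : 0 ≤ √(sqnorm w1)^2/(2*r0) := by positivity
      linarith
    nlinarith
  have hKw : IsCompact {w : Vd d | √(sqnorm w) ≤ r0} := by
    refine (isCompact_closedBall (0 : Vd d) r0).of_isClosed_subset (isClosed_le sqnorm_cont continuous_const) fun w hw => ?_
    rw [mem_closedBall_zero_iff]; exact (norm_le_sq w).trans hw
  set g : ℝ → Vd d × Vd d → ℝ := fun t q => u t (q.1 + q.2) - u t q.1 - L * psi r0 (√(sqnorm q.2)) with hg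
  have hgc : ContinuousOn (fun p : ℝ × (Vd d × Vd d) => g p.1 p.2) (Ici 0 ×ˢ (Icc (0 : Vd d) 1 ×ˢ {w : Vd d | √(sqnorm w) ≤ r0})) := by
    refine ContinuousOn.sub (ContinuousOn.sub ?_ ?_) ?_
    · exact hu.1.comp (f := fun p : ℝ × (Vd d × Vd d) => (p.1, p.2.1 + p.2.2)) (by fun_prop) (fun p hp => ⟨hp.1, mem_univ _⟩)
    · exact hu.1.comp (f := fun p : ℝ × (Vd d × Vd d) => (p.1, p.2.1)) (by fun_prop) (fun p hp => ⟨hp.1, mem_univ _⟩)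
    · have := (sqnorm_cont (d := d)).comp (continuous_snd.comp (continuous_snd (X := ℝ) (Y := Vd d × Vd d)))
      refine Continuous.continuousOn ?_
      unfold psi
      simp only [Function.comp_def] at this
      fun_prop
  have hpsi0 : ∀ r, 0 ≤ r → r ≤ r0 → 0 ≤ psi r0 r := fun r h1 h2 => by
    have := psi_mono h0 h1 h2
    simpa [psi] using this
  obtain ⟨t0, ht0, ⟨y, w⟩, ⟨-, hw⟩, hmax⟩ := max_exists ((cube_compact (d := d)).prod hKw) ⟨(0, 0), ⟨⟨le_rfl, zero_le_one⟩, by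
      show √(sqnorm (0 : Vd d)) ≤ r0
      simp [sqnorm, h0.le]⟩⟩ (g := g) hgc (M := 2 * Cu) (fun t ht q hq => by
      have h1 := abs_le.1 (hb t ht (q.1 + q.2)); have h2 := abs_le.1 (hb t ht q.1)
      have h3 := mul_nonneg hL.le (hpsi0 _ (Real.sqrt_nonneg _) hq.2)
      simp only [hg]; linarith) hε
  have hw' : √(sqnorm w) ≤ r0 := hw
  have hm : ∀ t, 0 ≤ t → ∀ y' w', √(sqnorm w') ≤ r0 → u t (y' + w') - u t y' - L * psi r0 (√(sqnorm w')) - ε * t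
      ≤ u t0 (y + w) - u t0 y - L * psi r0 (√(sqnorm w)) - ε * t0 := fun t ht y' w' hw' => by
    have := hmax t ht (secT (tm y'), w') (Set.mk_mem_prod (secT_cube _) hw')
    have e1 : u t (secT (tm y')) = u t y' := per_secT (hu.2.2.2 t ht) rfl
    have e2 : u t (secT (tm y') + w') = u t (y' + w') :=
      per_secT (f := fun x => u t (x + w')) (fun x z => by rw [add_right_comm]; exact hu.2.2.2 t ht _ z) rfl
    simp only [hg, e1, e2] at this
    exact this
  by_contra hc
  push Not at hc
  have hpos := hc.trans_le (hm t1 ht1 y1 w1 hw1)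
  have hεt : 0 ≤ ε * t0 := by positivity
  have hpos2 : 0 < u t0 (y + w) - u t0 y - L * psi r0 (√(sqnorm w)) := by linarith
  have hr : 0 < √(sqnorm w) := by
    rcases (Real.sqrt_nonneg (sqnorm w)).eq_or_lt with h | h
    · exfalso
      have hw0 : w = 0 := by
        have := norm_le_sq w
        rw [← h] at this
        exact norm_le_zero_iff.1 this
      rw [← h, hw0] at hpos2
      simp [psi] at hpos2
    · exact h
  have hrlt : √(sqnorm w) < r0 := by
    refine lt_of_le_of_ne hw' fun h => ?_
    rw [h] at hpos2
    have e1 : L * psi r0 r0 = A/2 := by unfold psi; rw [hr0]; field_simp; ring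
    have h1 := abs_le.1 (hb t0 ht0 (y + w)); have h2 := abs_le.1 (hb t0 ht0 y)
    linarith
  obtain ⟨a1, a2, a3⟩ := touch (hu.2.2.1 t0 ht0) hL h0 hr hrlt (fun y' w' h => by linarith [hm t0 ht0 y' w' h])
  have h3 : tderiv u t0 (y + w) - tderiv u t0 y - ε * 1 ≤ 0 := right_max (h := fun s => u s (y + w) - u s y - ε * s) (x := t0)
    ((((hu.2.1 (y + w) t0 ht0).hasDerivAt).sub ((hu.2.1 y t0 ht0).hasDerivAt)).sub ((hasDerivAt_id t0).const_mul ε))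
    (by filter_upwards [self_mem_nhdsWithin] with s hs
        have := hm s (ht0.trans (le_of_lt hs)) y w hw'
        linarith)
  have e1 := heq t0 ht0 (y + w)
  have e2 := heq t0 ht0 y
  rw [a1] at e1
  have e3 := abs_le.1 (H_diff S hC0 a2 (y + w) y)
  have e4 := abs_le.1 (hf t0 ht0 (y + w)); have e5 := abs_le.1 (hf t0 ht0 y)
  have e6 : L * ‖(y + w) - y‖ ≤ A := by
    rw [add_sub_cancel_left]
    calc L * ‖w‖ ≤ L * r0 := by gcongr; exact (norm_le_sq w).trans hw'
      _ = A := by rw [hr0]; field_simp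
  have e7 : S.Cg * (1 + L) * L * ‖(y + w) - y‖ ≤ S.Cg * (1 + L) * A := by
    have := S.Cg_pos
    rw [mul_assoc]; gcongr
  have e8 : 4 * L / r0 = 4 * L^2 / A := by rw [hr0]; field_simp
  have e9 : 0 ≤ δ * (u t0 (y + w) - u t0 y) := mul_nonneg hδ.le (by
    have := mul_nonneg hL.le (hpsi0 _ (Real.sqrt_nonneg _) hw'); linarith)
  rw [e8] at a3
  linarith

lemma grad_bound {d : ℕ} (S : MFGSetting d) {δ : ℝ} (hδ : 0 < δ) : ∃ L, 0 < L ∧ ∀ (u : ℝ → Vd d → ℝ) (m : ℝ → PTd d),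
    SolvesDiscMFG S δ u m → (∃ M : ℝ, ∀ t ∈ Ici (0:ℝ), ∀ x, |u t x| ≤ M) → ∀ t ∈ Ici (0:ℝ), ∀ x i, |gradv (u t) x i| ≤ L := by
  obtain ⟨C0, hC0', hC0⟩ := per_bdd (f := S.H) S.H_smooth.continuous S.H_per 0
  obtain ⟨MF, hMF⟩ := S.Fd_bounded
  set Cu := (|MF| + C0)/δ with hCu
  have hCu0 : 0 ≤ Cu := by positivity
  set A := 4 * Cu + 2 with hA
  have hA0 : 0 < A := by linarith
  set c := 2 * |MF| + 2 * C0 + S.Cg * A + 1 with hc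
  have := S.Cg_pos
  have hc0 : 0 < c := by positivity
  set L := A * (c + S.Cg * A) + 1 with hL
  have hL0 : 0 < L := by positivity
  have hL1 : 1 ≤ L := by have : 0 ≤ A * (c + S.Cg * A) := by positivity
                         linarith
  have hLA : 2 * |MF| + 2 * C0 + S.Cg * (1 + L) * A + 1 < 4 * L^2 / A := by
    rw [lt_div_iff₀ hA0]
    have e : (2 * |MF| + 2 * C0 + S.Cg * (1 + L) * A + 1) * A = (c + S.Cg * A * L) * A := by rw [hc]; ring
    rw [e]
    have e1 : (c + S.Cg * A * L) * A ≤ (c * L + S.Cg * A * L) * A := by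
      gcongr; exact le_mul_of_one_le_right hc0.le hL1
    have e2 : (c * L + S.Cg * A * L) * A = (L - 1) * L := by rw [hL]; ring
    nlinarith
  refine ⟨L, hL0, fun u m hs hb t ht x i => ?_⟩
  have hf : ∀ t ∈ Ici (0:ℝ), ∀ x, |S.Fd (m t : Measure (Td d)) x| ≤ |MF| := fun t _ x => (hMF (m t) x).trans (le_abs_self _)
  have hC : ∀ x, |S.H x 0| ≤ C0 := fun x => hC0 x 0 (by simp)
  have hub := u_bound S hδ hC hs.1 hf hb hs.2.1
  have hul := fun y w => u_lip S hδ hC hs.1 hf hub hs.2.1 hA hL0 hLA ht y w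
  refine coord_bd (A := fderiv ℝ (u t) x) (fun v hv => ?_) i
  have hd := (line1 (hs.1.2.2.1 t ht) x v 0).sub ((hasDerivAt_id (0:ℝ)).const_mul L)
  have := right_max hd (by
    have hev : ∀ᶠ s : ℝ in nhdsWithin 0 (Ioi 0), s < A / L := nhdsWithin_le_nhds (Iio_mem_nhds (by positivity))
    filter_upwards [self_mem_nhdsWithin, hev] with s hs hs2
    have hs' : 0 < s := hs
    have e : √(sqnorm (s • v)) = s := by rw [sqnorm_smul, hv, abs_of_pos hs', mul_one]
    have := hul x (s • v) (by rw [e]; exact hs2.le)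
    rw [e] at this
    simp only [Pi.sub_apply, zero_smul, add_zero, id, mul_zero]
    linarith)
  simp only [zero_smul, add_zero, mul_one] at this
  linarith

/-! ### Conclusion -/

lemma cont_lift2 {d : ℕ} {f : ℝ → Vd d → ℝ} (hc : Continuous (fun p : ℝ × Vd d => f p.1 p.2))
    (hf : ∀ t (x : Vd d) (z : Fin d → ℤ), f t (x + intVec z) = f t x) : Continuous (fun p : ℝ × Td d => f p.1 (secT p.2)) := by
  have hq : IsOpenQuotientMap (Prod.map (id : ℝ → ℝ) (tm (d := d))) := IsOpenQuotientMap.id.prodMap isOpenQuotientMap_tm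
  rw [hq.isQuotientMap.continuous_iff]
  have : (fun p : ℝ × Td d => f p.1 (secT p.2)) ∘ (Prod.map (id : ℝ → ℝ) (tm (d := d))) = fun p : ℝ × Vd d => f p.1 p.2 :=
    funext fun p => per_secT (f := f p.1) (hf p.1) rfl
  rwa [this]

lemma drift_bound {d : ℕ} (S : MFGSetting d) (L : ℝ) : ∃ B, 0 < B ∧ ∀ x p i, ‖p‖ ≤ L → |DpH S x p i| ≤ B := by
  choose B hB0 hB using fun i => per_bdd (f := fun x p => DpH S x p i) (DpH_cont S i) (fun x z p => by rw [DpH_per]) L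
  refine ⟨∑ i, B i + 1, by have := Finset.sum_nonneg fun i (_ : i ∈ Finset.univ) => hB0 i; linarith, fun x p i hp => ?_⟩
  have := Finset.single_le_sum (fun i _ => hB0 i) (Finset.mem_univ i)
  linarith [hB i x p hp]

lemma mk_FPD {d : ℕ} (S : MFGSetting d) {L B : ℝ} (hL : 0 < L) (hB0 : 0 < B) (hB : ∀ x p i, ‖p‖ ≤ L → |DpH S x p i| ≤ B)
    {u : ℝ → Vd d → ℝ} (hu : Creg12 u (Ici 0)) (hg : ∀ t ∈ Ici (0:ℝ), ∀ x i, |gradv (u t) x i| ≤ L)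
    {m1 m2 : ℝ → PTd d} (c1 : W1ContOn m1 (Ici 0)) (c2 : W1ContOn m2 (Ici 0))
    (f1 : ∀ s₁ s₂ : ℝ, 0 ≤ s₁ → s₁ ≤ s₂ → FPeq 1 m1 (fun s y => DpH S (secT y) (gradv (u s) (secT y))) s₁ s₂)
    (f2 : ∀ s₁ s₂ : ℝ, 0 ≤ s₁ → s₁ ≤ s₂ → FPeq 1 m2 (fun s y => DpH S (secT y) (gradv (u s) (secT y))) s₁ s₂) :
    FPD m1 m2 (fun s y => DpH S (secT y) (gradv (u s) (secT y))) B := by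
  have hn : ∀ t ∈ Ici (0:ℝ), ∀ x, ‖gradv (u t) x‖ ≤ L := fun t ht x =>
    (pi_norm_le_iff_of_nonneg hL.le).2 fun i => hg t ht x i
  refine ⟨c1, c2, hB0, fun τ hτ i => ?_, fun τ hτ y i => hB _ _ _ (hn τ hτ _), ?_, f1, f2⟩
  · refine continuous_lift (f := fun x => DpH S x (gradv (u τ) x) i) ?_ (fun x z => ?_)
    · exact (DpH_cont S i).comp (continuous_id.prodMk (continuous_pi fun j => (gradv_c1 (hu.2.2.1 τ hτ) j).continuous))
    · rw [gradv_per (hu.2.2.2 τ hτ), DpH_per]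
  · have hmax : ∀ τ : ℝ, max τ 0 ∈ Ici (0:ℝ) := fun τ => mem_Ici.2 (le_max_right _ _)
    set a : ℕ → ℝ := fun n => 1/((n:ℝ)+1) with ha
    have ha0 : ∀ n, 0 < a n := fun n => by simp only [ha]; positivity
    set q : ℕ → ℝ → Vd d → Vd d := fun n τ x i => (a n)⁻¹ * (u (max τ 0) (x + a n • Pi.single i 1) - u (max τ 0) x) with hq
    have huc : ∀ v : Vd d, Continuous (fun p : ℝ × Vd d => u (max p.1 0) (p.2 + v)) := fun v =>
      hu.1.comp_continuous (f := fun p : ℝ × Vd d => (max p.1 0, p.2 + v)) (by fun_prop) (fun p => ⟨hmax _, mem_univ _⟩)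
    have hqc : ∀ n, Continuous (fun p : ℝ × Vd d => q n p.1 p.2) := fun n => continuous_pi fun i => by
      have h2 := huc 0
      simp only [add_zero] at h2
      exact continuous_const.mul ((huc _).sub h2)
    have hqp : ∀ n t (x : Vd d) (z : Fin d → ℤ), q n t (x + intVec z) = q n t x := fun n t x z => funext fun i => by
      simp only [hq]
      rw [add_right_comm, hu.2.2.2 _ (hmax t), hu.2.2.2 _ (hmax t)]
    have hqb : ∀ n t x, ‖q n t x‖ ≤ L := fun n t x => by
      refine (pi_norm_le_iff_of_nonneg hL.le).2 fun i => ?_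
      have key := Convex.norm_image_sub_le_of_norm_hasDerivWithin_le
        (fun s _ => (line1 (hu.2.2.1 _ (hmax t)) x (Pi.single i 1) s).hasDerivWithinAt) (fun s _ => hg _ (hmax t) (x + s • Pi.single i 1) i)
        convex_univ (mem_univ (0:ℝ)) (mem_univ (a n))
      simp only [zero_smul, add_zero, sub_zero] at key
      simp only [hq]
      rw [norm_mul, norm_inv]
      have h3 : 0 < ‖a n‖ := norm_pos_iff.2 (ha0 n).ne'
      rw [inv_mul_le_iff₀ h3]; linarith
    refine ⟨fun n τ y => DpH S (secT y) (q n τ (secT y)), B, fun n i => ?_, fun n τ y i => hB _ _ _ (hqb _ _ _), fun τ hτ y i => ?_⟩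
    · refine cont_lift2 (f := fun t x => DpH S x (q n t x) i) ?_ (fun t x z => by rw [hqp, DpH_per])
      exact (DpH_cont S i).comp (continuous_snd.prodMk (hqc n))
    · have hl : Tendsto (fun n => q n τ (secT y)) atTop (nhds (gradv (u τ) (secT y))) := by
        rw [tendsto_pi_nhds]
        intro j
        have h1 := (line1 (hu.2.2.1 τ hτ) (secT y) (Pi.single j 1) 0).tendsto_slope_zero
        have h2 : Tendsto a atTop (nhdsWithin 0 {0}ᶜ) := tendsto_nhdsWithin_iff.2
          ⟨tendsto_one_div_add_atTop_nhds_zero_nat, Eventually.of_forall fun n => (ha0 n).ne'⟩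
        have h3 := h1.comp h2
        simp only [Function.comp_def, zero_add, zero_smul, add_zero, smul_eq_mul] at h3
        simp only [hq, max_eq_left hτ]
        exact h3
      exact (((DpH_cont S i).comp (Continuous.prodMk_right (secT y))).tendsto _).comp hl

/-- Lemma 1.4 of the paper.  If `(u₁,m₁)` solves the discounted MFG
system from `m₁⁰`, `m̃₂` solves the linear Fokker--Planck equation with drift
`D_pH(x,Du₁)` from `m₂⁰` and, for each `s > 0`, `ζ(s,·)` solves the Poisson equation
`Δζ(s,·) = m₁(s) - m̃₂(s)` with zero mean, then `‖Dζ(s,·)‖_{L²} ≤ K_s d(m₁⁰,m₂⁰)`,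
where `K_s > 0` does not depend on `m₁⁰, m₂⁰` and is bounded on `{s ≥ ε}` for each `ε > 0`. -/
theorem poisson_estimate (d : ℕ) (S : MFGSetting d) (δ : ℝ) (hδ : 0 < δ) :
    ∃ K : ℝ → ℝ,
      (∀ s : ℝ, 0 < s → 0 < K s) ∧
      (∀ ε : ℝ, 0 < ε → ∃ M : ℝ, ∀ s : ℝ, ε ≤ s → K s ≤ M) ∧
      ∀ (u₁ : ℝ → Vd d → ℝ) (m₁ mt₂ : ℝ → PTd d) (ζ : ℝ → Vd d → ℝ)
        (m₁0 m₂0 : PTd d),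
        SolvesDiscMFG S δ u₁ m₁ → m₁ 0 = m₁0 →
        (∃ M : ℝ, ∀ t ∈ Set.Ici (0:ℝ), ∀ x : Vd d, |u₁ t x| ≤ M) →
        W1ContOn mt₂ (Set.Ici 0) → mt₂ 0 = m₂0 →
        (∀ s₁ s₂ : ℝ, 0 ≤ s₁ → s₁ ≤ s₂ →
          FPeq 1 mt₂ (fun s y => DpH S (secT y) (gradv (u₁ s) (secT y))) s₁ s₂) →
        (∀ s : ℝ, 0 < s →
          (∀ (x : Vd d) (z : Fin d → ℤ), ζ s (x + intVec z) = ζ s x) ∧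
          ContDiff ℝ 2 (ζ s) ∧
          (∫ y, ζ s (secT y) ∂(volume : Measure (Td d))) = 0 ∧
          (∀ g : Vd d → ℝ, ContDiff ℝ 2 g →
            (∀ (x : Vd d) (z : Fin d → ℤ), g (x + intVec z) = g x) →
            (∫ y, ζ s (secT y) * lapl g (secT y) ∂(volume : Measure (Td d))) =
              (∫ y, g (secT y) ∂(m₁ s : Measure (Td d))) -
                ∫ y, g (secT y) ∂(mt₂ s : Measure (Td d)))) →
        ∀ s : ℝ, 0 < s →
          Real.sqrt (∫ y, sqnorm (gradv (ζ s) (secT y)) ∂(volume : Measure (Td d)))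
            ≤ K s * W1 m₁0 m₂0 := by
  obtain ⟨L, hL, hgrad⟩ := grad_bound S hδ
  obtain ⟨B, hB0, hB⟩ := drift_bound S L
  refine ⟨fun s => Kf d B s * √d + 1, fun s _ => ?_, fun ε hε => ⟨Kf d B ε * √d + 1, fun s hs => ?_⟩, ?_⟩
  · have := Kf_nonneg d B s; positivity
  · have hσ := sig0_pos d hB0
    have : Kf d B s ≤ Kf d B ε := by
      unfold Kf
      have := Af_anti d (lt_min hε hσ) (min_le_min_right (sig0 d B) hs)
      linarith
    show Kf d B s * √d + 1 ≤ Kf d B ε * √d + 1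
    gcongr
  · intro u₁ m₁ mt₂ ζ m₁0 m₂0 hs h10 hb hc2 h20 hfp hζ s hs0
    have D := mk_FPD S hL hB0 hB hs.1 (hgrad u₁ m₁ hs hb) hs.2.2.1 hc2 hs.2.2.2 hfp
    have hd := fun τ hτ => dens_of (hζ τ hτ).1 (hζ τ hτ).2.1 (hζ τ hτ).2.2.2
    have E : Dens m₁ mt₂ (fun τ y => lapl (ζ τ) (secT y)) := ⟨fun τ hτ => (hd τ hτ).1, fun τ hτ f hf => (hd τ hτ).2 f hf⟩
    have hW := W1_nonneg (m₁ 0) (mt₂ 0)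
    have hK := Kf_nonneg d B s
    have := grad_final (hζ s hs0).1 (hζ s hs0).2.1 (hζ s hs0).2.2.1 (hd s hs0).2 (mul_nonneg hK hW)
      (fun f hf => D.all E hs0 hf)
    rw [← h10, ← h20]
    refine this.trans ?_
    nlinarith
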